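/- Let d ≥ 3 be an integer, z ∈ ℝ^d with z ≠ 0, and α₁,…,α₅ ∈ ℂ; write α_{i…j} for sums of the α's. Assume: (i) the double integral I(α₁,…,α₅) = ∫_{ℝ^d} ∫_{ℝ^d} ‖x‖^{−2α₁} ‖y‖^{−2α₂} ‖z−y‖^{−2α₃} ‖z−x‖^{−2α₄} ‖x−y‖^{−2α₅} dx dy converges absolutely; (ii) Re(α₄) > d/4, Re(α₁₄₅) > 3d/4, Re(α₃) < d/4, Re(α₄₅) < 3d/4, Re(α₁₂₄₅) < 5d/4, Re(α₂₃₅) > 1/2; (iii) the three double series I₁, I₂, I₃ below converge absolutely and no Gamma factor in them is evaluated at a pole. Then I(α₁,…,α₅) = C · ‖z‖^{−2(α₁₂₃₄₅ − d)}, where C = π^d · (Γ(d/2 − 1)/Γ(d − 2)) · (a₀(α₁) a₀(α₄)/a₀(α₁₂₃₄₅ − d)) · (I₁ + I₂ + I₃), with a₀(γ) = Γ(d/2 − γ)/Γ(γ), M_n = (n + d/2 − 1) Γ(n + d − 2)/n!, and I₁ = ∑_{n=0}^{∞} M_n ∑_{k=0}^{∞} ((−1)^k/k!) · Γ(α₄+n+k)Γ(d/2−α₅+n+k)Γ(α₁₅−d/2−k)Γ(d−α₁₂₅+n+k)Γ(d/2−α₃₄−k)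 / [Γ(d/2−α₄−k)Γ(α₅−k)Γ(d−α₁₅+n+k)Γ(α₁₂₅−d/2−k)Γ(α₃₄+n+k)Γ(d/2+n+k)], I₂ = ∑_{n=0}^{∞} M_n ∑_{k=0}^{∞} ((−1)^k/k!) · Γ(α₁₄₅−d/2+n+k)Γ(d/2−α₁₅−k)Γ(α₁+n+k)Γ(d/2−α₂+n+k)Γ(d−α₁₃₄₅−k) / [Γ(d−α₁₄₅−k)Γ(α₁₅+n+k)Γ(d/2−α₁−k)Γ(α₂−k)Γ(α₁₃₄₅−d/2+n+k)Γ(d/2+n+k)], I₃ = ∑_{n=0}^{∞} M_n ∑_{k=0}^{∞} ((−1)^k/k!) · Γ(d/2−α₃+n+k)Γ(α₃₄−d/2−k)Γ(d−α₃₄₅+n+k)Γ(α₁₃₄₅−d−k)Γ(3d/2−α₁₂₃₄₅+n+k) / [Γ(α₃−k)Γ(d−α₃₄+n+k)Γ(α₃₄₅−d/2−k)Γ(3d/2−α₁₃₄₅+n+k)Γ(α₁₂₃₄₅−d−k)Γ(d/2+n+k)]. -/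

import Mathlib

open Complex MeasureTheory

namespace TwoLoop

open Filter Topology

/-- The rising factorial `z (z + 1) ⋯ (z + k - 1)`. -/
noncomputable def poch {R : Type*} [CommRing R] (z : R) (k : ℕ) : R :=
  ∏ j ∈ Finset.range k, (z + j)

section Pochhammer

variable {R : Type*} [CommRing R]

@[simp] lemma poch_zero (z : R) : poch z 0 = 1 := by simp [poch]

lemma poch_succ (z : R) (k : ℕ) : poch z (k + 1) = poch z k * (z + k) := by
  simp [poch, Finset.prod_range_succ]

lemma poch_add (z : R) (m n : ℕ) : poch z (m + n) = poch z m * poch (z + m) n := by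
  simp [poch, Finset.prod_range_add, add_assoc]

lemma poch_succ_left (z : R) (k : ℕ) : poch z (k + 1) = z * poch (z + 1) k := by
  rw [add_comm, poch_add]; simp [poch]

@[simp] lemma poch_ofReal (x : ℝ) (k : ℕ) : ((poch x k : ℝ) : ℂ) = poch (x : ℂ) k := by
  simp [poch]

lemma poch_pos {x : ℝ} (hx : 0 < x) (k : ℕ) : 0 < poch x k :=
  Finset.prod_pos fun j _ => by positivity

lemma poch_ne_zero {z : ℂ} (hz : ∀ j : ℕ, z ≠ -j) (k : ℕ) : poch z k ≠ 0 :=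
  Finset.prod_ne_zero_iff.2 fun j _ h => hz j (eq_neg_of_add_eq_zero_left h)

lemma ne_neg_nat_of_re_pos {z : ℂ} (hz : 0 < z.re) (j : ℕ) : z ≠ -j := by
  rintro rfl
  simp at hz
  linarith [(Nat.cast_nonneg j : (0 : ℝ) ≤ j)]

lemma Gamma_add_nat {z : ℂ} (hz : ∀ j : ℕ, z ≠ -j) (k : ℕ) :
    Gamma (z + k) = poch z k * Gamma z := by
  induction k with
  | zero => simp
  | succ k ih =>
    have h : z + k ≠ 0 := fun h => hz k (eq_neg_of_add_eq_zero_left h)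
    rw [poch_succ, Nat.cast_succ, ← add_assoc, Gamma_add_one _ h, ih]
    ring

/-- Reflection of a rising factorial: `Γ(ε - k) (1 - ε)_k = (-1)^k Γ(ε)`. -/
lemma Gamma_sub_nat {e : ℂ} (he : ∀ j : ℕ, e ≠ j) (k : ℕ) :
    Gamma (e - k) * poch (1 - e) k = (-1) ^ k * Gamma e := by
  induction k with
  | zero => simp
  | succ k ih =>
    have h : e - (k + 1 : ℕ) ≠ 0 := fun h => he (k + 1) (sub_eq_zero.1 h)
    have := Gamma_add_one _ h
    rw [show e - (k + 1 : ℕ) + 1 = e - k by push_cast; ring] at this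
    rw [this] at ih
    rw [poch_succ, pow_succ]
    push_cast at ih ⊢
    linear_combination (-1) * ih

/-- A positive sequence with a positive limit is bounded above and below by positive constants. -/
lemma exists_bounds_of_tendsto {q : ℕ → ℝ} {l : ℝ} (hq : ∀ k, 0 < q k) (hl : 0 < l)
    (h : Tendsto q atTop (𝓝 l)) : ∃ c C : ℝ, 0 < c ∧ 0 < C ∧ ∀ k, c ≤ q k ∧ q k ≤ C := by
  obtain ⟨C, hC⟩ := h.bddAbove_range
  obtain ⟨C', hC'⟩ := (h.inv₀ hl.ne').bddAbove_range
  have hC0 : ∀ k, q k ≤ C := fun k => hC ⟨k, rfl⟩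
  have hC1 : ∀ k, (q k)⁻¹ ≤ C' := fun k => hC' ⟨k, rfl⟩
  have p : 0 < C' := (inv_pos.2 (hq 0)).trans_le (hC1 0)
  refine ⟨C'⁻¹, C, inv_pos.2 p, (hq 0).trans_le (hC0 0), fun k => ⟨?_, hC0 k⟩⟩
  exact inv_le_of_inv_le₀ (hq k) (hC1 k)

lemma tendsto_ratio_rpow (s : ℝ) :
    Tendsto (fun n : ℕ => (n : ℝ) ^ s / (((n : ℝ) + 1) * ((n : ℝ) + 2) ^ (s - 1))) atTop (𝓝 1) := by
  have h1 : Tendsto (fun n : ℕ => (n : ℝ) / ((n : ℝ) + 2)) atTop (𝓝 1) :=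
    tendsto_natCast_div_add_atTop 2
  have h2 : Tendsto (fun n : ℕ => (n : ℝ) / ((n : ℝ) + 1)) atTop (𝓝 1) :=
    tendsto_natCast_div_add_atTop 1
  have h3 : Tendsto (fun n : ℕ => ((n : ℝ) / ((n : ℝ) + 2)) ^ (s - 1) * ((n : ℝ) / ((n : ℝ) + 1)))
      atTop (𝓝 1) := by
    have := (h1.rpow_const (p := s - 1) (Or.inl one_ne_zero)).mul h2
    simpa using this
  refine h3.congr' ?_
  filter_upwards [eventually_gt_atTop 0] with n hn
  have hn' : (0 : ℝ) < n := by exact_mod_cast hn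
  rw [Real.div_rpow hn'.le (by positivity), Real.rpow_sub_one hn'.ne', Real.rpow_sub_one (by positivity)]
  field_simp

lemma exists_bounds_poch {s : ℂ} (hs : ∀ j : ℕ, s ≠ -j) : ∃ c C : ℝ, 0 < c ∧ 0 < C ∧ ∀ k : ℕ,
    c * (k.factorial * ((k : ℝ) + 1) ^ (s.re - 1)) ≤ ‖poch s k‖ ∧
      ‖poch s k‖ ≤ C * (k.factorial * ((k : ℝ) + 1) ^ (s.re - 1)) := by
  have key : Tendsto (fun k : ℕ => ‖poch s k‖ / (k.factorial * ((k : ℝ) + 1) ^ (s.re - 1)))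
      atTop (𝓝 ‖Gamma s‖⁻¹) := by
    rw [← tendsto_add_atTop_iff_nat 1]
    have h := ((GammaSeq_tendsto_Gamma s).norm.inv₀ (norm_ne_zero_iff.2 (Gamma_ne_zero hs))).mul
      (tendsto_ratio_rpow s.re)
    rw [mul_one] at h
    refine h.congr' ?_
    filter_upwards [eventually_gt_atTop 0] with n hn
    have hn' : (0 : ℝ) < n := by exact_mod_cast hn
    have hp : ‖poch s (n + 1)‖ ≠ 0 := norm_ne_zero_iff.2 (poch_ne_zero hs _)
    have hg : GammaSeq s n = (n : ℂ) ^ s * n.factorial / poch s (n + 1) := rfl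
    rw [hg, norm_div, norm_mul, Complex.norm_natCast_cpow_of_pos hn, Complex.norm_natCast,
      Nat.factorial_succ]
    push_cast
    rw [show (n : ℝ) + 1 + 1 = n + 2 by ring]
    have : (0 : ℝ) < (n : ℝ) ^ s.re := by positivity
    have : (0 : ℝ) < ((n : ℝ) + 2) ^ (s.re - 1) := by positivity
    field_simp
  have hpos : ∀ k : ℕ, 0 < ‖poch s k‖ / (k.factorial * ((k : ℝ) + 1) ^ (s.re - 1)) := fun k => by
    have := norm_pos_iff.2 (poch_ne_zero hs k)
    positivity
  obtain ⟨c, C, hc, hC, h⟩ := exists_bounds_of_tendsto hpos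
    (inv_pos.2 (norm_pos_iff.2 (Gamma_ne_zero hs))) key
  refine ⟨c, C, hc, hC, fun k => ?_⟩
  have : (0 : ℝ) < k.factorial * ((k : ℝ) + 1) ^ (s.re - 1) := by positivity
  exact ⟨(le_div_iff₀ this).1 (h k).1, (div_le_iff₀ this).1 (h k).2⟩

lemma exists_norm_poch_le {s : ℂ} (hs : 0 < s.re) :
    ∃ C : ℝ, 0 < C ∧ ∀ k, ‖poch s k‖ ≤ C * poch s.re k := by
  obtain ⟨_, C, _, hC, h⟩ := exists_bounds_poch (ne_neg_nat_of_re_pos hs)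
  obtain ⟨c', _, hc', _, h'⟩ := exists_bounds_poch (s := (s.re : ℂ))
    (ne_neg_nat_of_re_pos (by simpa using hs))
  refine ⟨C / c', by positivity, fun k => (h k).2.trans ?_⟩
  have := (h' k).1
  rw [← poch_ofReal, Complex.norm_of_nonneg (poch_pos hs k).le, ofReal_re] at this
  calc _ = C / c' * (c' * (k.factorial * ((k : ℝ) + 1) ^ (s.re - 1))) := by field_simp
    _ ≤ _ := by gcongr

end Pochhammer

section Beta

lemma exists_le_norm_add_nat {A : ℂ} (hA : ∀ j : ℕ, A ≠ -j) :
    ∃ c : ℝ, 0 < c ∧ ∀ j : ℕ, c * ((j : ℝ) + 1) ≤ ‖A + j‖ := by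
  have hq : ∀ j : ℕ, 0 < ‖A + j‖ / ((j : ℝ) + 1) := fun j => by
    have : 0 < ‖A + j‖ := norm_pos_iff.2 fun h => hA j (eq_neg_of_add_eq_zero_left h)
    positivity
  have hlim : Tendsto (fun j : ℕ => ‖A + j‖ / ((j : ℝ) + 1)) atTop (𝓝 1) := by
    have h : Tendsto (fun j : ℕ => ‖(A - 1) * (((j : ℝ) + 1 : ℝ) : ℂ)⁻¹ + 1‖) atTop (𝓝 1) := by
      have h1 : Tendsto (fun j : ℕ => ((((j : ℝ) + 1 : ℝ) : ℂ)⁻¹)) atTop (𝓝 0) := by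
        have : Tendsto (fun j : ℕ => 1 / ((j : ℝ) + 1)) atTop (𝓝 0) :=
          tendsto_one_div_add_atTop_nhds_zero_nat
        have := (continuous_ofReal.tendsto 0).comp this
        simpa [Function.comp_def] using this
      simpa using ((h1.const_mul (A - 1)).add_const 1).norm
    refine h.congr fun j => ?_
    have hj : (0 : ℝ) < (j : ℝ) + 1 := by positivity
    have hj' : ((j : ℂ) + 1) ≠ 0 := by exact_mod_cast hj.ne'
    rw [show (A - 1) * (((j : ℝ) + 1 : ℝ) : ℂ)⁻¹ + 1 = (A + j) / ((((j : ℝ) + 1 : ℝ)) : ℂ) by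
      push_cast; field_simp; ring, norm_div, Complex.norm_of_nonneg hj.le]
  obtain ⟨c, _, hc, _, h⟩ := exists_bounds_of_tendsto hq one_pos hlim
  exact ⟨c, hc, fun j => (le_div_iff₀ (by positivity)).1 (h j).1⟩

/-- Taylor coefficients of `(1 - x) ^ (ε - 1)`. -/
noncomputable def bcoef (e : ℂ) (j : ℕ) : ℂ := poch (1 - e) j / j.factorial

lemma exists_norm_bcoef_le {e : ℂ} (he : ∀ j : ℕ, e ≠ j) :
    ∃ C : ℝ, 0 < C ∧ ∀ j : ℕ, ‖bcoef e j‖ ≤ C * ((j : ℝ) + 1) ^ (-e.re) := by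
  obtain ⟨_, C, _, hC, h⟩ := exists_bounds_poch (s := 1 - e) (fun j hj => he (j + 1) (by
    push_cast; linear_combination -hj))
  refine ⟨C, hC, fun j => ?_⟩
  have := (h j).2
  rw [bcoef, norm_div, Complex.norm_natCast, div_le_iff₀ (by positivity)]
  refine this.trans (le_of_eq ?_)
  simp only [sub_re, one_re, sub_sub_cancel_left]
  ring

lemma summable_rpow_add_one {p : ℝ} (hp : p < -1) : Summable fun j : ℕ => ((j : ℝ) + 1) ^ p := by
  have := (summable_nat_add_iff 1).2 (Real.summable_nat_rpow.2 hp)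
  simpa using this

lemma summable_norm_bcoef_div {e : ℂ} (he : ∀ j : ℕ, e ≠ j) (he0 : 0 < e.re) {A : ℂ}
    (hA : ∀ j : ℕ, A ≠ -j) : Summable fun j : ℕ => ‖bcoef e j / (A + j)‖ := by
  obtain ⟨C, hC, h⟩ := exists_norm_bcoef_le he
  obtain ⟨c, hc, h'⟩ := exists_le_norm_add_nat hA
  refine Summable.of_nonneg_of_le (fun _ => norm_nonneg _) (fun j => ?_)
    ((summable_rpow_add_one (p := -e.re - 1) (by linarith)).mul_left (C / c))
  have hj : (0 : ℝ) < (j : ℝ) + 1 := by positivity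
  rw [norm_div]
  calc _ ≤ C * ((j : ℝ) + 1) ^ (-e.re) / (c * ((j : ℝ) + 1)) := by
        gcongr
        · exact h j
        · exact h' j
    _ = _ := by rw [Real.rpow_sub_one hj.ne']; field_simp

lemma ascPochhammer_eval_eq_poch (z : ℂ) (k : ℕ) :
    (ascPochhammer ℂ k).eval z = poch z k := by
  induction k with
  | zero => simp
  | succ k ih => rw [ascPochhammer_succ_eval, ih, poch_succ]

lemma hasSum_one_sub_cpow (a : ℂ) {x : ℂ} (hx : ‖x‖ < 1) :
    HasSum (fun j : ℕ => poch a j / j.factorial * x ^ j) ((1 - x) ^ (-a)) := by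
  have h := (one_div_one_sub_cpow_hasFPowerSeriesOnBall_zero a).hasSum (y := x)
    (by simpa [← ofReal_norm, enorm_eq_nnnorm, ← NNReal.coe_lt_coe] using hx)
  simp only [FormalMultilinearSeries.ofScalars_apply_eq, zero_add, smul_eq_mul] at h
  rw [cpow_neg, ← one_div]
  convert! h using 3 with j
  rw [← Ring.multichoose_eq, ← ascPochhammer_eval_eq_poch, ← Polynomial.ascPochhammer_smeval_eq_eval,
    ← Ring.factorial_nsmul_multichoose_eq_ascPochhammer, nsmul_eq_mul,
    mul_div_cancel_left₀ _ (by exact_mod_cast j.factorial_ne_zero)]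

lemma hasSum_bcoef_div_of_re_pos {e : ℂ} (he : ∀ j : ℕ, e ≠ j) (he0 : 0 < e.re) {A : ℂ}
    (hA : 0 < A.re) :
    HasSum (fun j => bcoef e j / (A + j)) (Gamma A * Gamma e / Gamma (A + e)) := by
  have hG : Gamma A * Gamma e / Gamma (A + e) = A.betaIntegral e := by
    rw [Gamma_mul_Gamma_eq_betaIntegral hA he0, mul_div_cancel_left₀]
    exact Gamma_ne_zero_of_re_pos (by simpa using add_pos hA he0)
  set F : ℕ → ℝ → ℂ := fun j x => bcoef e j * (x : ℂ) ^ (A + j - 1) with hF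
  have hre : ∀ j : ℕ, -1 < (A + j - 1).re := fun j => by
    have : (0 : ℝ) ≤ j := j.cast_nonneg
    simp; linarith
  have hint : ∀ j : ℕ, IntervalIntegrable (fun x : ℝ => (x : ℂ) ^ (A + j - 1)) volume 0 1 := fun j =>
    intervalIntegral.intervalIntegrable_cpow' (hre j)
  have hval : ∀ j, ∫ x in Set.Ioc (0 : ℝ) 1, F j x = bcoef e j / (A + j) := fun j => by
    rw [← intervalIntegral.integral_of_le zero_le_one, intervalIntegral.integral_const_mul,
      integral_cpow (Or.inl (hre j))]
    have : A + j ≠ 0 := fun h => ne_neg_nat_of_re_pos hA j (eq_neg_of_add_eq_zero_left h)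
    simp [this, div_eq_mul_inv]
  have hnorm : ∀ j, ∫ x in Set.Ioc (0 : ℝ) 1, ‖F j x‖ = ‖bcoef e j‖ / (A.re + j) := fun j => by
    have : ∫ x in Set.Ioc (0 : ℝ) 1, ‖F j x‖ =
        ∫ x in Set.Ioc (0 : ℝ) 1, ‖bcoef e j‖ * x ^ (A.re + j - 1) := by
      refine setIntegral_congr_fun measurableSet_Ioc fun x hx => ?_
      simp only [hF, norm_mul]
      rw [norm_cpow_eq_rpow_re_of_pos hx.1]
      simp
    have hj : (0 : ℝ) < A.re + j := by positivity
    rw [this, ← intervalIntegral.integral_of_le zero_le_one, intervalIntegral.integral_const_mul,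
      integral_rpow (Or.inl (by linarith))]
    simp [hj.ne', div_eq_mul_inv]
  have key := hasSum_integral_of_summable_integral_norm (μ := volume.restrict (Set.Ioc (0 : ℝ) 1))
    (F := F) (fun j => by
      have := ((hint j).const_mul (bcoef e j)).1
      exact this) (by
      simp_rw [hnorm]
      have := summable_norm_bcoef_div he he0 (A := (A.re : ℂ)) (ne_neg_nat_of_re_pos (by simpa))
      refine this.congr fun j => ?_
      have hj : (0 : ℝ) < A.re + j := by positivity
      rw [norm_div]
      congr 1
      exact_mod_cast Complex.norm_of_nonneg hj.le)
  simp_rw [hval] at key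
  rw [hG]
  suffices h : A.betaIntegral e = ∫ x in Set.Ioc (0 : ℝ) 1, ∑' j, F j x by rw [h]; exact key
  rw [Complex.betaIntegral, intervalIntegral.integral_of_le zero_le_one, integral_Ioc_eq_integral_Ioo,
    integral_Ioc_eq_integral_Ioo]
  refine setIntegral_congr_fun measurableSet_Ioo fun x hx => ?_
  have h1 := (hasSum_one_sub_cpow (1 - e) (x := (x : ℂ))
    (by simpa [abs_of_pos hx.1] using hx.2)).mul_left ((x : ℂ) ^ (A - 1))
  have hx0 : (x : ℂ) ≠ 0 := by exact_mod_cast hx.1.ne'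
  rw [neg_sub] at h1
  rw [← h1.tsum_eq]
  refine tsum_congr fun j => ?_
  simp only [hF, bcoef]
  rw [show A + j - 1 = (A - 1) + j by ring, cpow_add _ _ hx0, cpow_natCast]
  ring

lemma tendsto_bcoef {e : ℂ} (he : ∀ j : ℕ, e ≠ j) (he0 : 0 < e.re) :
    Tendsto (bcoef e) atTop (𝓝 0) := by
  obtain ⟨C, hC, h⟩ := exists_norm_bcoef_le he
  rw [tendsto_zero_iff_norm_tendsto_zero]
  refine squeeze_zero (fun _ => norm_nonneg _) h ?_
  have h1 : Tendsto (fun j : ℕ => (j : ℝ) + 1) atTop atTop :=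
    tendsto_atTop_add_const_right _ _ tendsto_natCast_atTop_atTop
  simpa using ((tendsto_rpow_neg_atTop he0).comp h1).const_mul C

lemma tsum_bcoef_div_succ {e : ℂ} (he : ∀ j : ℕ, e ≠ j) (he0 : 0 < e.re) {A : ℂ}
    (hA : ∀ j : ℕ, A ≠ -j) :
    (A + e) * ∑' j, bcoef e j / (A + 1 + j) = A * ∑' j, bcoef e j / (A + j) := by
  have hA1 : ∀ j : ℕ, A + 1 ≠ -j := fun j h => hA (j + 1) (by
    push_cast; linear_combination h)
  have s1 := (summable_norm_bcoef_div he he0 hA).of_norm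
  have s2 := (summable_norm_bcoef_div he he0 hA1).of_norm
  set g : ℕ → ℂ := fun j => -(bcoef e j * (j / (A + j))) with hg
  have hne : ∀ j : ℕ, A + j ≠ 0 := fun j h => hA j (eq_neg_of_add_eq_zero_left h)
  have hne' : ∀ j : ℕ, A + 1 + j ≠ 0 := fun j h => hA1 j (eq_neg_of_add_eq_zero_left h)
  have hterm : ∀ j, (A + e) * (bcoef e j / (A + 1 + j)) - A * (bcoef e j / (A + j)) =
      g (j + 1) - g j := fun j => by
    have h1 := hne j
    have h2 := hne' j
    have h3 : bcoef e (j + 1) * ((j : ℂ) + 1) = bcoef e j * (1 - e + j) := by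
      have : ((j : ℂ) + 1) ≠ 0 := by exact_mod_cast j.succ_ne_zero
      have : (j.factorial : ℂ) ≠ 0 := by exact_mod_cast j.factorial_ne_zero
      rw [bcoef, bcoef, poch_succ, Nat.factorial_succ]
      push_cast
      field_simp
    have h4 : A + (j + 1 : ℕ) = A + 1 + j := by push_cast; ring
    simp only [hg]
    rw [h4, Nat.cast_succ, mul_div_assoc', mul_div_assoc' (bcoef e (j + 1)), h3]
    field_simp
    ring
  have hsum := (s2.hasSum.mul_left (A + e)).sub (s1.hasSum.mul_left A)
  simp_rw [hterm] at hsum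
  have hlim := hsum.tendsto_sum_nat
  simp_rw [Finset.sum_range_sub] at hlim
  have hg0 : Tendsto g atTop (𝓝 0) := by
    have h1 : Tendsto (fun j : ℕ => (j : ℂ) / ((j : ℂ) + A)) atTop (𝓝 1) :=
      tendsto_natCast_div_add_atTop A
    have := ((tendsto_bcoef he he0).mul h1).neg
    simpa [hg, add_comm] using this
  have hz := tendsto_nhds_unique hlim (hg0.sub_const (g 0))
  simp only [hg, Nat.cast_zero, zero_div, mul_zero, neg_zero, sub_zero] at hz
  exact sub_eq_zero.1 hz

/-- The partial fraction expansion `Γ(A) Γ(ε) / Γ(A + ε) = ∑ (1 - ε)ⱼ / (j! (A + j))`. -/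
lemma hasSum_bcoef_div {e : ℂ} (he : ∀ j : ℕ, e ≠ j) (he0 : 0 < e.re) {A : ℂ}
    (hA : ∀ j : ℕ, A ≠ -j) :
    HasSum (fun j => bcoef e j / (A + j)) (Gamma A * Gamma e / Gamma (A + e)) := by
  obtain ⟨N, hN⟩ := exists_nat_gt (-A.re)
  induction N generalizing A with
  | zero => exact hasSum_bcoef_div_of_re_pos he he0 (by simpa using hN)
  | succ N ih =>
    have hA1 : ∀ j : ℕ, A + 1 ≠ -j := fun j h => hA (j + 1) (by
      push_cast; linear_combination h)
    have h1 := (ih hA1 (by push_cast at hN; simp; linarith)).tsum_eq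
    have h2 := tsum_bcoef_div_succ he he0 hA
    have s1 := (summable_norm_bcoef_div he he0 hA).of_norm
    have hA0 : A ≠ 0 := by simpa using hA 0
    suffices h : Gamma A * Gamma e / Gamma (A + e) = ∑' j, bcoef e j / (A + j) by
      rw [h]; exact s1.hasSum
    apply mul_left_cancel₀ hA0
    rw [← h2, h1, Gamma_add_one _ hA0, div_eq_mul_inv, div_eq_mul_inv,
      one_div_Gamma_eq_self_mul_one_div_Gamma_add_one (A + e)]
    rw [show A + 1 + e = A + e + 1 by ring]
    ring

lemma summable_bcoef_pair {e m : ℂ} (he : ∀ j : ℕ, e ≠ j) (he0 : 0 < e.re) (hm : 0 < m.re) {A : ℂ}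
    (hA : ∀ j : ℕ, A ≠ -j) :
    Summable (fun p : ℕ × ℕ => bcoef e p.1 / (A + p.1) * (bcoef e p.2 / (m + p.1 + p.2))) := by
  have hmr : ∀ j : ℕ, (m.re : ℂ) ≠ -j := ne_neg_nat_of_re_pos (by simpa using hm)
  have := (summable_norm_bcoef_div he he0 hA).mul_of_nonneg
    (summable_norm_bcoef_div he he0 hmr) (fun _ => norm_nonneg _) (fun _ => norm_nonneg _)
  refine Summable.of_norm_bounded this fun p => ?_
  rw [norm_mul, norm_div (bcoef e p.2), norm_div (bcoef e p.2)]
  have h2 : ‖(m.re : ℂ) + p.2‖ = m.re + p.2 := by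
    exact_mod_cast Complex.norm_of_nonneg (by positivity)
  have h1 : (0 : ℝ) ≤ (p.1 : ℝ) := by positivity
  have h3 : ‖(m.re : ℂ) + p.2‖ ≤ ‖m + p.1 + p.2‖ := by
    rw [h2]
    refine le_trans ?_ (re_le_norm _)
    simp
  have h4 : 0 < ‖(m.re : ℂ) + p.2‖ := by rw [h2]; positivity
  gcongr

lemma hasSum_bcoef_pair {e m : ℂ} (he : ∀ j : ℕ, e ≠ j) (he0 : 0 < e.re) (hm : 0 < m.re) {A : ℂ}
    (hA : ∀ j : ℕ, A ≠ -j) : HasSum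
      (fun i : ℕ => bcoef e i / (A + i) * (Gamma (m + i) * Gamma e / Gamma (m + i + e)))
      (∑' p : ℕ × ℕ, bcoef e p.1 / (A + p.1) * (bcoef e p.2 / (m + p.1 + p.2))) := by
  have hmi : ∀ i : ℕ, 0 < (m + i).re := fun i => by
    have : (0 : ℝ) ≤ i := i.cast_nonneg
    simp; linarith
  have h1 := (summable_bcoef_pair he he0 hm hA).hasSum
  have h2 : ∀ i : ℕ, HasSum (fun j : ℕ => bcoef e i / (A + i) * (bcoef e j / (m + i + j)))
      (bcoef e i / (A + i) * (Gamma (m + i) * Gamma e / Gamma (m + i + e))) := fun i =>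
    (hasSum_bcoef_div he he0 (ne_neg_nat_of_re_pos (hmi i))).mul_left _
  exact h1.prod_fiberwise h2

lemma partial_fraction_pair {A B u v i j : ℂ} (h1 : A + i ≠ 0) (h2 : B + j ≠ 0)
    (h3 : A + B + i + j ≠ 0) : u / (A + i) * (v / (B + j)) =
      u / (A + i) * (v / (A + B + i + j)) + v / (B + j) * (u / (A + B + j + i)) := by
  rw [show A + B + j + i = A + B + i + j by ring]
  field_simp
  ring

lemma hasSum_bcoef_mul {e A B m : ℂ} (he : ∀ j : ℕ, e ≠ j) (he0 : 0 < e.re)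
    (hA : ∀ j : ℕ, A ≠ -j) (hB : ∀ j : ℕ, B ≠ -j) (hAB : A + B = m) (hm : 0 < m.re) :
    HasSum (fun i : ℕ => bcoef e i * (Gamma (m + i) * Gamma e / Gamma (m + i + e)) *
        (1 / (A + i) + 1 / (B + i)))
      (Gamma A * Gamma e / Gamma (A + e) * (Gamma B * Gamma e / Gamma (B + e))) := by
  subst hAB
  have sA := summable_norm_bcoef_div he he0 hA
  have sB := summable_norm_bcoef_div he he0 hB
  have hprod := (summable_mul_of_summable_norm sA sB).hasSum
  rw [← tsum_mul_tsum_of_summable_norm sA sB, (hasSum_bcoef_div he he0 hA).tsum_eq,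
    (hasSum_bcoef_div he he0 hB).tsum_eq] at hprod
  have hsw := (summable_bcoef_pair he he0 hm hB).prod_symm.hasSum
  have hadd := (summable_bcoef_pair he he0 hm hA).hasSum.add hsw
  have hfun : (fun p : ℕ × ℕ => bcoef e p.1 / (A + p.1) * (bcoef e p.2 / (B + p.2))) =
      fun p : ℕ × ℕ => bcoef e p.1 / (A + p.1) * (bcoef e p.2 / (A + B + p.1 + p.2)) +
        bcoef e p.2 / (B + p.2) * (bcoef e p.1 / (A + B + p.2 + p.1)) := by
    funext p
    refine partial_fraction_pair (fun h => hA _ (eq_neg_of_add_eq_zero_left h))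
      (fun h => hB _ (eq_neg_of_add_eq_zero_left h)) fun h => ?_
    refine ne_neg_nat_of_re_pos hm (p.1 + p.2) ?_
    push_cast
    linear_combination h
  rw [hfun] at hprod
  rw [hprod.unique hadd]
  have h := (hasSum_bcoef_pair he he0 hm hA).add (hasSum_bcoef_pair he he0 hm hB)
  have hfun2 : ∀ i : ℕ, bcoef e i * (Gamma (A + B + i) * Gamma e / Gamma (A + B + i + e)) *
        (1 / (A + i) + 1 / (B + i)) =
      bcoef e i / (A + i) * (Gamma (A + B + i) * Gamma e / Gamma (A + B + i + e)) +
        bcoef e i / (B + i) * (Gamma (A + B + i) * Gamma e / Gamma (A + B + i + e)) := fun i => by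
    ring
  simp_rw [hfun2]
  rw [← (Equiv.prodComm ℕ ℕ).tsum_eq (fun p : ℕ × ℕ => bcoef e p.1 / (B + p.1) *
    (bcoef e p.2 / (A + B + p.1 + p.2)))] at h
  exact h

/-- Coefficients of the expansion of a projected propagator into exponentials. -/
noncomputable def ccoef (D g : ℂ) (n k : ℕ) : ℂ :=
  poch g (n + k) * poch (1 - (D - g)) k / (k.factorial * poch D (n + k))

/-- The two-sided Laplace transform of `exp (-p |s|)`. -/
noncomputable def hker (p w : ℂ) : ℂ := 1 / (p - w) + 1 / (p + w)

lemma hasSum_ccoef_hker {D g w : ℂ} (n : ℕ) (hg : 0 < g.re) (he : ∀ j : ℕ, D - g ≠ j)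
    (he0 : 0 < (D - g).re) (hA : ∀ j : ℕ, (g + n + w) / 2 ≠ -j)
    (hB : ∀ j : ℕ, (g + n - w) / 2 ≠ -j) :
    HasSum (fun k : ℕ => ccoef D g n k * hker (g + n + 2 * k) w)
      (Gamma D * Gamma (D - g) / (2 * Gamma g) *
        (Gamma ((g + n + w) / 2) / Gamma ((g + n + w) / 2 + (D - g)) *
          (Gamma ((g + n - w) / 2) / Gamma ((g + n - w) / 2 + (D - g))))) := by
  have hn : (0 : ℝ) ≤ n := n.cast_nonneg
  have hD : 0 < D.re := by simp at he0; linarith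
  have h := (hasSum_bcoef_mul he he0 hA hB (m := g + n) (by ring) (by simp; linarith)).mul_left
    (Gamma D / (2 * Gamma g * Gamma (D - g)))
  have g1 := Gamma_ne_zero_of_re_pos hg
  have g2 := Gamma_ne_zero_of_re_pos he0
  have g3 := Gamma_ne_zero_of_re_pos hD
  convert! h using 1
  · funext k
    have e1 : Gamma (g + n + k) = poch g (n + k) * Gamma g := by
      rw [← Gamma_add_nat (ne_neg_nat_of_re_pos hg)]; push_cast; ring_nf
    have e2 : Gamma (g + n + k + (D - g)) = poch D (n + k) * Gamma D := by
      rw [← Gamma_add_nat (ne_neg_nat_of_re_pos hD)]; push_cast; ring_nf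
    have p1 := poch_ne_zero (ne_neg_nat_of_re_pos hD) (n + k)
    have e3 : 1 / ((g + n + w) / 2 + k) = 2 * (1 / (g + n + 2 * k + w)) := by
      rw [show (g + n + w) / 2 + k = (g + n + 2 * k + w) / 2 by ring, one_div_div]; ring
    have e4 : 1 / ((g + n - w) / 2 + k) = 2 * (1 / (g + n + 2 * k - w)) := by
      rw [show (g + n - w) / 2 + k = (g + n + 2 * k - w) / 2 by ring, one_div_div]; ring
    have p2 : (k.factorial : ℂ) ≠ 0 := by exact_mod_cast k.factorial_ne_zero
    rw [e1, e2, e3, e4, ccoef, hker, bcoef]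
    field_simp
    ring
  · field_simp

end Beta

section DiscreteBounds

lemma exists_exponents {a b c : ℝ} (ha : 0 < a) (hb : 0 < b) (hc : 0 < c) (h : 1 < a + b + c) :
    ∃ x y z : ℝ, 0 < x ∧ x < 1 ∧ x < a ∧ 0 < y ∧ y < 1 ∧ y < b ∧ 0 < z ∧ z < 1 ∧ z < c ∧
      1 < x + y + z := by
  have hm : 1 < min a 1 + min b 1 + min c 1 := by
    rcases min_choice a 1 with h1 | h1 <;> rcases min_choice b 1 with h2 | h2 <;>
      rcases min_choice c 1 with h3 | h3 <;> rw [h1, h2, h3] <;> linarith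
  set m := min a 1 + min b 1 + min c 1 with hmdef
  have hm0 : 0 < m := by linarith
  set t := (1 + m⁻¹) / 2 with ht
  have hinv : m⁻¹ < 1 := inv_lt_one_of_one_lt₀ hm
  have hinv0 : 0 < m⁻¹ := inv_pos.2 hm0
  have ht1 : t < 1 := by rw [ht]; linarith
  have ht0 : 0 < t := by rw [ht]; linarith
  have htm : 1 < t * m := by
    rw [ht, div_mul_eq_mul_div, add_mul, inv_mul_cancel₀ hm0.ne']; linarith
  have key : ∀ a : ℝ, 0 < a → 0 < t * min a 1 ∧ t * min a 1 < 1 ∧ t * min a 1 < a := by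
    intro a ha
    have h0 : 0 < min a 1 := lt_min ha one_pos
    have h1 : t * min a 1 < min a 1 := by nlinarith
    exact ⟨by positivity, h1.trans_le (min_le_right _ _), h1.trans_le (min_le_left _ _)⟩
  obtain ⟨p1, p2, p3⟩ := key a ha
  obtain ⟨q1, q2, q3⟩ := key b hb
  obtain ⟨r1, r2, r3⟩ := key c hc
  exact ⟨_, _, _, p1, p2, p3, q1, q2, q3, r1, r2, r3, by rw [hmdef] at htm; linarith⟩

/-- `1 + |j - k|` as a real number. -/
noncomputable def gap (j k : ℕ) : ℝ := 1 + |(j : ℝ) - k|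

lemma one_le_gap (j k : ℕ) : 1 ≤ gap j k := by
  unfold gap; linarith [abs_nonneg ((j : ℝ) - k)]

lemma gap_pos (j k : ℕ) : 0 < gap j k := one_pos.trans_le (one_le_gap j k)

lemma summable_gap_rpow {p : ℝ} (hp : 1 < p) : ∃ C : ℝ, ∀ k : ℕ,
    Summable (fun j => gap j k ^ (-p)) ∧ ∑' j, gap j k ^ (-p) ≤ C := by
  have hs : Summable (fun j : ℕ => ((j : ℝ) + 1) ^ (-p)) := summable_rpow_add_one (by linarith)
  refine ⟨2 * ∑' j : ℕ, ((j : ℝ) + 1) ^ (-p), fun k => ?_⟩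
  have h2 : ∀ j : ℕ, gap (j + k) k ^ (-p) = ((j : ℝ) + 1) ^ (-p) := fun j => by
    rw [gap]; push_cast; rw [add_sub_cancel_right, abs_of_nonneg j.cast_nonneg, add_comm]
  have h1 : Summable (fun j => gap j k ^ (-p)) := by
    rw [← summable_nat_add_iff k]
    simp_rw [h2]
    exact hs
  refine ⟨h1, ?_⟩
  rw [← h1.sum_add_tsum_nat_add k, two_mul]
  simp_rw [h2]
  gcongr
  rw [← Finset.sum_range_reflect]
  refine le_trans (Finset.sum_le_sum fun j hj => ?_) (hs.sum_le_tsum (Finset.range k)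
    fun j _ => by positivity)
  have hj' := Finset.mem_range.1 hj
  rw [gap, Nat.sub_sub, Nat.cast_sub (by omega)]
  push_cast
  rw [show ((k : ℝ) - (1 + j) - k) = -(j + 1) by ring, abs_neg, abs_of_nonneg (by positivity)]
  exact Real.rpow_le_rpow_of_nonpos (by positivity) (by linarith) (by linarith)

lemma rpow_mul_rpow_le {u v s t : ℝ} (hu : 1 ≤ u) (hv : 1 ≤ v) (hs : 0 ≤ s) (ht : 0 ≤ t) :
    u ^ (-s) * v ^ (-t) ≤ u ^ (-(s + t)) + v ^ (-(s + t)) := by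
  have hu0 : 0 < u := by linarith
  have hv0 : 0 < v := by linarith
  have h1 : 0 < u ^ (-(s + t)) := by positivity
  have h2 : 0 < v ^ (-(s + t)) := by positivity
  rcases le_total u v with h | h
  · have : v ^ (-t) ≤ u ^ (-t) := Real.rpow_le_rpow_of_nonpos hu0 h (by linarith)
    have h3 : u ^ (-s) * v ^ (-t) ≤ u ^ (-s) * u ^ (-t) := by gcongr
    rw [← Real.rpow_add hu0, ← neg_add] at h3
    linarith
  · have : u ^ (-s) ≤ v ^ (-s) := Real.rpow_le_rpow_of_nonpos hv0 h (by linarith)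
    have h3 : u ^ (-s) * v ^ (-t) ≤ v ^ (-s) * v ^ (-t) := by gcongr
    rw [← Real.rpow_add hv0, ← neg_add] at h3
    linarith

lemma summable_rpow_mul_gap {s t : ℝ} (hs : 0 ≤ s) (ht : 0 ≤ t) (hst : 1 < s + t) :
    ∃ C : ℝ, ∀ k : ℕ, Summable (fun j : ℕ => ((j : ℝ) + 1) ^ (-s) * gap j k ^ (-t)) ∧
      ∑' j : ℕ, ((j : ℝ) + 1) ^ (-s) * gap j k ^ (-t) ≤ C := by
  obtain ⟨C, hC⟩ := summable_gap_rpow hst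
  have h0 : Summable (fun j : ℕ => ((j : ℝ) + 1) ^ (-(s + t))) :=
    summable_rpow_add_one (by linarith)
  refine ⟨(∑' j : ℕ, ((j : ℝ) + 1) ^ (-(s + t))) + C, fun k => ?_⟩
  obtain ⟨h1, h2⟩ := hC k
  have hle : ∀ j : ℕ, ((j : ℝ) + 1) ^ (-s) * gap j k ^ (-t) ≤
      ((j : ℝ) + 1) ^ (-(s + t)) + gap j k ^ (-(s + t)) := fun j =>
    rpow_mul_rpow_le (by linarith [(Nat.cast_nonneg j : (0 : ℝ) ≤ j)]) (one_le_gap j k) hs ht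
  have h3 : Summable (fun j : ℕ => ((j : ℝ) + 1) ^ (-s) * gap j k ^ (-t)) :=
    Summable.of_nonneg_of_le (fun j => by have := gap_pos j k; positivity) hle (h0.add h1)
  refine ⟨h3, (h3.tsum_le_tsum hle (h0.add h1)).trans ?_⟩
  rw [h0.tsum_add h1]
  linarith

/-- Discrete convolution bound: `∑ⱼ (1 + j)^(-b) / (1 + |j - k|) = O((1 + k)^(-θ))`. -/
lemma exists_conv_bound {b θ : ℝ} (hθ : 0 < θ) (hθ1 : θ < 1) (hb : θ < b) :
    ∃ C : ℝ, 0 ≤ C ∧ ∀ k : ℕ, Summable (fun j : ℕ => ((j : ℝ) + 1) ^ (-b) * (gap j k)⁻¹) ∧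
      ∑' j : ℕ, ((j : ℝ) + 1) ^ (-b) * (gap j k)⁻¹ ≤ C * ((k : ℝ) + 1) ^ (-θ) := by
  obtain ⟨C1, h1⟩ := summable_rpow_mul_gap (s := b - θ) (t := 1) (by linarith) (by linarith)
    (by linarith)
  obtain ⟨C2, h2⟩ := summable_rpow_mul_gap (s := b) (t := 1 - θ) (by linarith) (by linarith)
    (by linarith)
  have hpos : 0 ≤ C1 + C2 := by
    refine add_nonneg ((tsum_nonneg fun j => ?_).trans (h1 0).2)
      ((tsum_nonneg fun j => ?_).trans (h2 0).2) <;>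
    · have := gap_pos j 0; positivity
  refine ⟨C1 + C2, hpos, fun k => ?_⟩
  have hk : (0 : ℝ) < (k : ℝ) + 1 := by positivity
  have hle : ∀ j : ℕ, ((j : ℝ) + 1) ^ (-b) * (gap j k)⁻¹ ≤ ((k : ℝ) + 1) ^ (-θ) *
      (((j : ℝ) + 1) ^ (-(b - θ)) * gap j k ^ (-(1 : ℝ)) +
        ((j : ℝ) + 1) ^ (-b) * gap j k ^ (-(1 - θ))) := fun j => by
    have hj : (0 : ℝ) < (j : ℝ) + 1 := by positivity
    have hg := gap_pos j k
    have hsub : ((k : ℝ) + 1) ^ θ ≤ ((j : ℝ) + 1) ^ θ + gap j k ^ θ := by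
      refine le_trans (Real.rpow_le_rpow hk.le ?_ hθ.le)
        (Real.rpow_add_le_add_rpow hj.le hg.le hθ.le hθ1.le)
      have := neg_abs_le ((j : ℝ) - k)
      unfold gap
      linarith
    rw [Real.rpow_neg hk.le, inv_mul_eq_div, le_div_iff₀ (by positivity), neg_sub, neg_sub,
      Real.rpow_neg_one, Real.rpow_sub hj, Real.rpow_sub hg, Real.rpow_one, Real.rpow_neg hj.le]
    have e : (((j : ℝ) + 1) ^ b)⁻¹ * (gap j k)⁻¹ * (((j : ℝ) + 1) ^ θ + gap j k ^ θ) =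
        ((j : ℝ) + 1) ^ θ / ((j : ℝ) + 1) ^ b * (gap j k)⁻¹ +
        (((j : ℝ) + 1) ^ b)⁻¹ * (gap j k ^ θ / gap j k) := by ring
    rw [← e]
    gcongr
  have hs := ((h1 k).1.add (h2 k).1).mul_left (((k : ℝ) + 1) ^ (-θ))
  have h3 : Summable (fun j : ℕ => ((j : ℝ) + 1) ^ (-b) * (gap j k)⁻¹) :=
    Summable.of_nonneg_of_le (fun j => by have := gap_pos j k; positivity) hle hs
  refine ⟨h3, (h3.tsum_le_tsum hle hs).trans ?_⟩
  rw [tsum_mul_left, (h1 k).1.tsum_add (h2 k).1, mul_comm]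
  have := (h1 k).2
  have := (h2 k).2
  gcongr

/-- Iterated summability criterion for nonnegative triple series `∑ u j * v j k * w j l`. -/
lemma summable_triple_of_le {u B : ℕ → ℝ} {v w : ℕ → ℕ → ℝ} (hu : ∀ j, 0 ≤ u j)
    (hv : ∀ j k, 0 ≤ v j k) (hw : ∀ j k, 0 ≤ w j k) (hvs : ∀ j, Summable (v j))
    (hws : ∀ j, Summable (w j)) (hB : Summable B)
    (hle : ∀ j, u j * ((∑' k, v j k) * ∑' k, w j k) ≤ B j) :
    Summable (fun p : ℕ × ℕ × ℕ => u p.1 * (v p.1 p.2.1 * w p.1 p.2.2)) := by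
  have hp : ∀ j : ℕ, Summable (fun p : ℕ × ℕ => v j p.1 * w j p.2) := fun j =>
    summable_mul_of_summable_norm (hvs j).norm (hws j).norm
  have hnn : 0 ≤ (fun p : ℕ × ℕ × ℕ => u p.1 * (v p.1 p.2.1 * w p.1 p.2.2)) := fun p =>
    mul_nonneg (hu _) (mul_nonneg (hv _ _) (hw _ _))
  have h1 : ∀ j : ℕ, Summable (fun p : ℕ × ℕ => u j * (v j p.1 * w j p.2)) := fun j =>
    (hp j).mul_left (u j)
  have e : ∀ j : ℕ, ∑' p : ℕ × ℕ, u j * (v j p.1 * w j p.2) =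
      u j * ((∑' k, v j k) * ∑' k, w j k) := fun j => by
    rw [tsum_mul_left, ← tsum_mul_tsum_of_summable_norm (hvs j).norm (hws j).norm]
  have h2 : Summable (fun j : ℕ => ∑' p : ℕ × ℕ, u j * (v j p.1 * w j p.2)) := by
    refine Summable.of_nonneg_of_le (fun j => tsum_nonneg fun p => ?_) (fun j => ?_) hB
    · exact mul_nonneg (hu _) (mul_nonneg (hv _ _) (hw _ _))
    · rw [e]; exact hle j
  exact (summable_prod_of_nonneg hnn).2 ⟨h1, h2⟩

lemma summable_triple_real {a b c y z : ℝ} (hy : 0 < y) (hy1 : y < 1) (hyb : y < b)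
    (hz : 0 < z) (hz1 : z < 1) (hzc : z < c) (h : 1 < a + y + z) :
    Summable (fun p : ℕ × ℕ × ℕ => ((p.1 : ℝ) + 1) ^ (-a) *
      ((((p.2.1 : ℝ) + 1) ^ (-b) * (gap p.2.1 p.1)⁻¹) *
        (((p.2.2 : ℝ) + 1) ^ (-c) * (gap p.2.2 p.1)⁻¹))) := by
  obtain ⟨C, hC, h1⟩ := exists_conv_bound hy hy1 hyb
  obtain ⟨C', hC', h2⟩ := exists_conv_bound hz hz1 hzc
  have hn : ∀ (b : ℝ) (j k : ℕ), 0 ≤ ((k : ℝ) + 1) ^ (-b) * (gap k j)⁻¹ := fun b j k => by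
    have := gap_pos k j; positivity
  refine summable_triple_of_le (u := fun j => ((j : ℝ) + 1) ^ (-a))
    (v := fun j k => ((k : ℝ) + 1) ^ (-b) * (gap k j)⁻¹)
    (w := fun j k => ((k : ℝ) + 1) ^ (-c) * (gap k j)⁻¹)
    (B := fun j => C * C' * ((j : ℝ) + 1) ^ (-(a + y + z)))
    (fun j => by positivity) (hn b) (hn c) (fun j => (h1 j).1) (fun j => (h2 j).1)
    ((summable_rpow_add_one (p := -(a + y + z)) (by linarith)).mul_left (C * C')) (fun j => ?_)
  have hj : (0 : ℝ) < (j : ℝ) + 1 := by positivity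
  calc _ ≤ ((j : ℝ) + 1) ^ (-a) * ((C * ((j : ℝ) + 1) ^ (-y)) * (C' * ((j : ℝ) + 1) ^ (-z))) :=
        mul_le_mul_of_nonneg_left (mul_le_mul (h1 j).2 (h2 j).2 (tsum_nonneg (hn c j))
          (by positivity)) (by positivity)
    _ = _ := by
        rw [neg_add, neg_add, Real.rpow_add hj, Real.rpow_add hj]; ring

lemma hasSum_triple {a b c y z : ℝ} (hy : 0 < y) (hy1 : y < 1) (hyb : y < b)
    (hz : 0 < z) (hz1 : z < 1) (hzc : z < c) (h : 1 < a + y + z)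
    {U V W : ℕ → ℂ} {H K : ℕ → ℕ → ℂ} {P Q : ℕ → ℂ} {C₁ C₂ C₃ C₄ C₅ : ℝ}
    (hU : ∀ j : ℕ, ‖U j‖ ≤ C₁ * ((j : ℝ) + 1) ^ (-a)) (hV : ∀ j : ℕ, ‖V j‖ ≤ C₂ * ((j : ℝ) + 1) ^ (-b))
    (hW : ∀ j : ℕ, ‖W j‖ ≤ C₃ * ((j : ℝ) + 1) ^ (-c)) (hH : ∀ j k, ‖H j k‖ ≤ C₄ * (gap k j)⁻¹)
    (hK : ∀ j k, ‖K j k‖ ≤ C₅ * (gap k j)⁻¹) (hP : ∀ j, HasSum (fun k => V k * H j k) (P j))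
    (hQ : ∀ j, HasSum (fun k => W k * K j k) (Q j)) :
    ∃ S : ℂ, HasSum (fun p : ℕ × ℕ × ℕ => U p.1 * V p.2.1 * W p.2.2 * (H p.1 p.2.1 * K p.1 p.2.2)) S ∧
      HasSum (fun j => U j * P j * Q j) S := by
  have hs : Summable (fun p : ℕ × ℕ × ℕ =>
      U p.1 * V p.2.1 * W p.2.2 * (H p.1 p.2.1 * K p.1 p.2.2)) := by
    refine Summable.of_norm_bounded ((summable_triple_real hy hy1 hyb hz hz1 hzc h).mul_left
      (C₁ * (C₂ * C₄) * (C₃ * C₅))) fun p => ?_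
    have h1 := mul_le_mul (hV p.2.1) (hH p.1 p.2.1) (norm_nonneg _) ((norm_nonneg _).trans (hV _))
    have h2 := mul_le_mul (hW p.2.2) (hK p.1 p.2.2) (norm_nonneg _) ((norm_nonneg _).trans (hW _))
    have h3 := mul_le_mul (hU p.1) (mul_le_mul h1 h2 (by positivity)
      (le_trans (by positivity) h1)) (by positivity) ((norm_nonneg _).trans (hU _))
    rw [norm_mul, norm_mul, norm_mul, norm_mul]
    refine (le_of_eq ?_).trans (h3.trans (le_of_eq ?_)) <;> ring
  refine ⟨_, hs.hasSum, ?_⟩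
  have hin : ∀ j, HasSum (fun p : ℕ × ℕ => U j * V p.1 * W p.2 * (H j p.1 * K j p.2))
      (U j * P j * Q j) := fun j => by
    have hsj : Summable (fun p : ℕ × ℕ => U j * V p.1 * W p.2 * (H j p.1 * K j p.2)) :=
      hs.prod_factor j
    have e1 : ∀ k, HasSum (fun l => U j * V k * W l * (H j k * K j l)) (U j * (V k * H j k) * Q j) :=
      fun k => by
        have := (hQ j).mul_left (U j * (V k * H j k))
        have e : (fun l => U j * V k * W l * (H j k * K j l)) =
            fun l => U j * (V k * H j k) * (W l * K j l) := by funext l; ring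
        rw [e]; exact this
    have e2 := hsj.hasSum.prod_fiberwise e1
    have e3 := ((hP j).mul_left (U j)).mul_right (Q j)
    rw [← e2.unique e3]
    exact hsj.hasSum
  exact hs.hasSum.prod_fiberwise hin

lemma exists_norm_ccoef_le {D g : ℂ} (n : ℕ) (hg : 0 < g.re) (he : ∀ j : ℕ, D - g ≠ j)
    (he0 : 0 < (D - g).re) : ∃ C : ℝ, 0 < C ∧ ∀ k : ℕ,
      ‖ccoef D g n k‖ ≤ C * ((k : ℝ) + 1) ^ (-(2 * (D - g).re)) := by
  have hD : 0 < D.re := by simp at he0; linarith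
  obtain ⟨_, C₁, _, hC₁, h₁⟩ := exists_bounds_poch (ne_neg_nat_of_re_pos hg)
  obtain ⟨c₂, _, hc₂, _, h₂⟩ := exists_bounds_poch (ne_neg_nat_of_re_pos hD)
  obtain ⟨C₃, hC₃, h₃⟩ := exists_norm_bcoef_le he
  refine ⟨C₁ / c₂ * C₃, by positivity, fun k => ?_⟩
  have hk : (0 : ℝ) < (k : ℝ) + 1 := by positivity
  have hnk : (0 : ℝ) < ((n + k : ℕ) : ℝ) + 1 := by positivity
  have e : ccoef D g n k = poch g (n + k) / poch D (n + k) * bcoef (D - g) k := by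
    rw [ccoef, bcoef, div_mul_div_comm, mul_comm (k.factorial : ℂ)]
  have hre : ((n + k : ℕ) + 1 : ℝ) ^ (g.re - 1) =
      ((n + k : ℕ) + 1 : ℝ) ^ (D.re - 1) * ((n + k : ℕ) + 1 : ℝ) ^ (-(D - g).re) := by
    rw [← Real.rpow_add hnk]; congr 1; simp
  rw [e, norm_mul, norm_div]
  calc _ ≤ C₁ * ((n + k).factorial * (((n + k : ℕ) : ℝ) + 1) ^ (g.re - 1)) /
        (c₂ * ((n + k).factorial * (((n + k : ℕ) : ℝ) + 1) ^ (D.re - 1))) *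
          (C₃ * ((k : ℝ) + 1) ^ (-(D - g).re)) := by
        gcongr
        · exact (h₁ _).2
        · exact (h₂ _).1
        · exact h₃ k
    _ = C₁ / c₂ * C₃ * ((((n + k : ℕ) : ℝ) + 1) ^ (-(D - g).re) * ((k : ℝ) + 1) ^ (-(D - g).re)) := by
        rw [hre]; field_simp
    _ ≤ C₁ / c₂ * C₃ * (((k : ℝ) + 1) ^ (-(D - g).re) * ((k : ℝ) + 1) ^ (-(D - g).re)) := by
        have : (((n + k : ℕ) : ℝ) + 1) ^ (-(D - g).re) ≤ ((k : ℝ) + 1) ^ (-(D - g).re) := by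
          refine Real.rpow_le_rpow_of_nonpos hk ?_ (by linarith)
          push_cast; linarith [(Nat.cast_nonneg n : (0 : ℝ) ≤ n)]
        gcongr
    _ = _ := by rw [← Real.rpow_add hk]; ring_nf

lemma exists_norm_hker_le {b b' : ℂ} (hb : ∀ m : ℤ, b ≠ m) (hb' : 0 < b'.re) :
    ∃ C : ℝ, 0 < C ∧ ∀ j k : ℕ, ∀ p w : ℂ, p - w = 2 * (b + k - j) → p + w = 2 * (b' + k + j) →
      ‖hker p w‖ ≤ C * (gap k j)⁻¹ := by
  obtain ⟨c₁, hc₁, h₁⟩ := exists_le_norm_add_nat (A := b) (fun j h => hb (-j) (by simpa using h))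
  obtain ⟨c₂, hc₂, h₂⟩ := exists_le_norm_add_nat (A := -b) (fun j h => hb j (by
    simpa using h))
  obtain ⟨c₃, hc₃, h₃⟩ := exists_le_norm_add_nat (ne_neg_nat_of_re_pos hb')
  have hc : 0 < min c₁ c₂ := lt_min hc₁ hc₂
  refine ⟨(min c₁ c₂)⁻¹ + c₃⁻¹, by positivity, fun j k p w hm hp => ?_⟩
  have hgap := gap_pos k j
  have hbd : min c₁ c₂ * gap k j ≤ ‖b + k - j‖ := by
    rcases le_total j k with h | h
    · obtain ⟨m, rfl⟩ := Nat.exists_eq_add_of_le h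
      have := h₁ m
      rw [gap, show b + ((j + m : ℕ) : ℂ) - j = b + m by push_cast; ring]
      push_cast
      rw [add_sub_cancel_left, abs_of_nonneg m.cast_nonneg, add_comm]
      refine le_trans ?_ this
      gcongr
      exact min_le_left _ _
    · obtain ⟨m, rfl⟩ := Nat.exists_eq_add_of_le h
      have := h₂ m
      rw [gap, show b + k - ((k + m : ℕ) : ℂ) = -(-b + m) by push_cast; ring, norm_neg]
      push_cast
      rw [sub_add_cancel_left, abs_neg, abs_of_nonneg m.cast_nonneg, add_comm]
      refine le_trans ?_ this
      gcongr
      exact min_le_right _ _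
  have hbd' : c₃ * gap k j ≤ ‖b' + k + j‖ := by
    have := h₃ (k + j)
    rw [show b' + k + j = b' + ((k + j : ℕ) : ℂ) by push_cast; ring]
    refine le_trans ?_ this
    have : |(k : ℝ) - j| ≤ k + j := by
      rw [abs_le]; constructor <;>
      linarith [(Nat.cast_nonneg k : (0 : ℝ) ≤ k), (Nat.cast_nonneg j : (0 : ℝ) ≤ j)]
    gcongr
    unfold gap
    push_cast
    linarith
  rw [hker, hm, hp, add_mul]
  refine (norm_add_le _ _).trans (add_le_add ?_ ?_)
  · rw [norm_div, norm_mul, norm_one, Complex.norm_ofNat, ← mul_inv, ← one_div]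
    have : 0 < min c₁ c₂ * gap k j := by positivity
    exact one_div_le_one_div_of_le this (by linarith)
  · rw [norm_div, norm_mul, norm_one, Complex.norm_ofNat, ← mul_inv, ← one_div]
    have : 0 < c₃ * gap k j := by positivity
    exact one_div_le_one_div_of_le this (by linarith)

end DiscreteBounds

section ExponentialIntegral

lemma integral_exp_region {ψ : ℝ × ℝ → ℝ × ℝ} (hψ : MeasurePreserving ψ volume volume)
    (hm : MeasurableEmbedding ψ) {R : Set (ℝ × ℝ)} (hR : ψ ⁻¹' R = Set.Ioi 0 ×ˢ Set.Ioi 0)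
    {f : ℝ × ℝ → ℂ} {G H : ℂ} (hG : 0 < G.re) (hH : 0 < H.re)
    (hf : ∀ u v : ℝ, 0 < u → 0 < v → f (ψ (u, v)) = cexp (-G * u) * cexp (-H * v)) :
    IntegrableOn f R ∧ ∫ x in R, f x = 1 / (G * H) := by
  have hQ : MeasurableSet (Set.Ioi (0 : ℝ) ×ˢ Set.Ioi (0 : ℝ)) := measurableSet_Ioi.prod measurableSet_Ioi
  have key : ∀ p ∈ (Set.Ioi (0 : ℝ) ×ˢ Set.Ioi (0 : ℝ)),
      f (ψ p) = cexp (-G * p.1) * cexp (-H * p.2) := fun p hp => hf p.1 p.2 hp.1 hp.2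
  have hG' : (-G).re < 0 := by simpa using hG
  have hH' : (-H).re < 0 := by simpa using hH
  constructor
  · rw [← hψ.integrableOn_comp_preimage hm, hR]
    have h0 : IntegrableOn (fun p : ℝ × ℝ => cexp (-G * p.1) * cexp (-H * p.2))
        (Set.Ioi 0 ×ˢ Set.Ioi 0) := by
      rw [IntegrableOn, Measure.volume_eq_prod, ← Measure.prod_restrict]
      exact Integrable.mul_prod (integrableOn_exp_mul_complex_Ioi hG' 0)
        (integrableOn_exp_mul_complex_Ioi hH' 0)
    exact h0.congr_fun (fun p hp => (key p hp).symm) hQ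
  · rw [← hψ.setIntegral_preimage_emb hm, hR, setIntegral_congr_fun hQ key,
      Measure.volume_eq_prod, setIntegral_prod_mul (fun u : ℝ => cexp (-G * u))
      (fun v : ℝ => cexp (-H * v)),
      integral_exp_mul_complex_Ioi hG' 0, integral_exp_mul_complex_Ioi hH' 0]
    simp [div_eq_mul_inv, mul_comm]

/-- The value of `∫∫ exp (A s + B t - r |s| - p |s - t| - q |t|)`. -/
def sixSum {K : Type*} [Field K] (A B p q r : K) : K :=
  1 / ((r + p - A) * (q + r - (A + B))) + 1 / ((p + q - B) * (q + r - (A + B))) +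
    1 / ((r + p + A) * (q + r + (A + B))) + 1 / ((p + q + B) * (q + r + (A + B))) +
    1 / ((r + p - A) * (p + q + B)) + 1 / ((r + p + A) * (p + q - B))

/-- The integrand `exp (A s + B t - r |s| - p |s - t| - q |t|)`. -/
noncomputable def expKer (A B p q r : ℂ) (x : ℝ × ℝ) : ℂ :=
  cexp (A * x.1 + B * x.2 - r * |x.1| - p * |x.1 - x.2| - q * |x.2|)

lemma measurePreserving_add_snd :
    MeasurePreserving (fun x : ℝ × ℝ => (x.1 + x.2, x.2)) volume volume := by
  have h : MeasurePreserving (Prod.swap ∘ (fun x : ℝ × ℝ => (x.1, x.1 + x.2)) ∘ Prod.swap)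
      (volume.prod volume) (volume.prod volume) :=
    Measure.measurePreserving_swap.comp
      ((measurePreserving_prod_add volume volume).comp Measure.measurePreserving_swap)
  have e : (fun x : ℝ × ℝ => (x.1 + x.2, x.2)) =
      Prod.swap ∘ (fun x : ℝ × ℝ => (x.1, x.1 + x.2)) ∘ Prod.swap := by
    funext x; ext <;> simp [add_comm]
  rw [e]
  exact h

lemma measurableEmbedding_add_snd : MeasurableEmbedding (fun x : ℝ × ℝ => (x.1 + x.2, x.2)) := by
  have h := (MeasurableEquiv.prodComm.measurableEmbedding.comp
    ((MeasurableEquiv.shearAddRight ℝ).measurableEmbedding.comp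
      (MeasurableEquiv.prodComm (α := ℝ) (β := ℝ)).measurableEmbedding))
  have e : (fun x : ℝ × ℝ => (x.1 + x.2, x.2)) = MeasurableEquiv.prodComm ∘
      MeasurableEquiv.shearAddRight ℝ ∘ MeasurableEquiv.prodComm (α := ℝ) (β := ℝ) := by
    funext x
    ext
    · exact add_comm _ _
    · rfl
  rw [e]
  exact h

lemma measurePreserving_neg_fst :
    MeasurePreserving (fun x : ℝ × ℝ => (-x.1, x.2)) volume volume :=
  (Measure.measurePreserving_neg (volume : Measure ℝ)).prod (MeasurePreserving.id volume)

lemma measurableEmbedding_neg_fst : MeasurableEmbedding (fun x : ℝ × ℝ => (-x.1, x.2)) :=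
  MeasurableEmbedding.prodMap (MeasurableEquiv.neg ℝ).measurableEmbedding MeasurableEmbedding.id

lemma measurePreserving_swap' :
    MeasurePreserving (fun x : ℝ × ℝ => (x.2, x.1)) volume volume :=
  Measure.measurePreserving_swap

lemma measurableEmbedding_swap' : MeasurableEmbedding (fun x : ℝ × ℝ => (x.2, x.1)) :=
  (MeasurableEquiv.prodComm (α := ℝ) (β := ℝ)).measurableEmbedding

lemma measurePreserving_neg_pair :
    MeasurePreserving (fun x : ℝ × ℝ => (-x.1, -x.2)) volume volume :=
  (Measure.measurePreserving_neg (volume : Measure ℝ)).prod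
    (Measure.measurePreserving_neg (volume : Measure ℝ))

lemma measurableEmbedding_neg_pair : MeasurableEmbedding (fun x : ℝ × ℝ => (-x.1, -x.2)) :=
  MeasurableEmbedding.prodMap (MeasurableEquiv.neg ℝ).measurableEmbedding
    (MeasurableEquiv.neg ℝ).measurableEmbedding

lemma ae_regions : ∀ᵐ x : ℝ × ℝ, x.1 ≠ 0 ∧ x.2 ≠ 0 ∧ x.1 ≠ x.2 := by
  rw [Measure.volume_eq_prod]
  have h0 : ∀ᵐ x : ℝ, x ≠ 0 := by simp [ae_iff]
  have h1 : ∀ᵐ x ∂((volume : Measure ℝ).prod (volume : Measure ℝ)), x.1 ≠ 0 :=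
    Measure.quasiMeasurePreserving_fst.ae h0
  have h2 : ∀ᵐ x ∂((volume : Measure ℝ).prod (volume : Measure ℝ)), x.2 ≠ 0 :=
    Measure.quasiMeasurePreserving_snd.ae h0
  have h3 : ∀ᵐ x ∂((volume : Measure ℝ).prod (volume : Measure ℝ)), x.1 ≠ x.2 := by
    rw [Measure.ae_prod_iff_ae_ae]
    · refine Filter.Eventually.of_forall fun x => ?_
      simp [ae_iff]
    · exact (measurableSet_eq_fun measurable_fst measurable_snd).compl
  filter_upwards [h1, h2, h3] with x a b c using ⟨a, b, c⟩

lemma integral_expKer {A B p q r : ℂ} (h1 : 0 < (r + p - A).re) (h2 : 0 < (r + p + A).re)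
    (h3 : 0 < (p + q - B).re) (h4 : 0 < (p + q + B).re) (h5 : 0 < (q + r - (A + B)).re)
    (h6 : 0 < (q + r + (A + B)).re) :
    Integrable (expKer A B p q r) ∧ ∫ x, expKer A B p q r x = sixSum A B p q r := by
  have mp := measurePreserving_add_snd
  have me := measurableEmbedding_add_snd
  obtain ⟨i1, v1⟩ := integral_exp_region (R := {x | 0 < x.2 ∧ x.2 < x.1}) (f := expKer A B p q r)
    mp me (by ext x; simp [and_comm]) h1 h5 (fun u v hu hv => by
      simp only [expKer]
      rw [abs_of_pos (add_pos hu hv), add_sub_cancel_right, abs_of_pos hu, abs_of_pos hv, ← exp_add]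
      push_cast; ring_nf)
  obtain ⟨i2, v2⟩ := integral_exp_region (R := {x | 0 < x.1 ∧ x.1 < x.2}) (f := expKer A B p q r)
    (measurePreserving_swap'.comp mp) (measurableEmbedding_swap'.comp me)
    (by ext x; simp [and_comm]) h3 h5 (fun u v hu hv => by
      simp only [expKer, Function.comp_apply]
      rw [abs_of_pos (add_pos hu hv), sub_add_cancel_right, abs_neg, abs_of_pos hu, abs_of_pos hv,
        ← exp_add]
      push_cast; ring_nf)
  obtain ⟨i3, v3⟩ := integral_exp_region (R := {x | x.2 < 0 ∧ x.1 < x.2}) (f := expKer A B p q r)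
    (measurePreserving_neg_pair.comp mp) (measurableEmbedding_neg_pair.comp me)
    (by ext x; simp [and_comm]) h2 h6 (fun u v hu hv => by
      simp only [expKer, Function.comp_apply]
      rw [abs_neg, abs_of_pos (add_pos hu hv), show -(u + v) - -v = -u by ring, abs_neg,
        abs_of_pos hu, abs_neg, abs_of_pos hv, ← exp_add]
      push_cast; ring_nf)
  obtain ⟨i4, v4⟩ := integral_exp_region (R := {x | x.1 < 0 ∧ x.2 < x.1}) (f := expKer A B p q r)
    ((measurePreserving_neg_pair.comp measurePreserving_swap').comp mp)
    ((measurableEmbedding_neg_pair.comp measurableEmbedding_swap').comp me)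
    (by ext x; simp [and_comm]) h4 h6 (fun u v hu hv => by
      simp only [expKer, Function.comp_apply]
      rw [abs_neg, abs_of_pos hv, show -v - -(u + v) = u by ring,
        abs_of_pos hu, abs_neg, abs_of_pos (add_pos hu hv), ← exp_add]
      push_cast; ring_nf)
  obtain ⟨i5, v5⟩ := integral_exp_region (R := {x | 0 < x.1 ∧ x.2 < 0}) (f := expKer A B p q r)
    ((measurePreserving_neg_pair.comp measurePreserving_neg_fst))
    ((measurableEmbedding_neg_pair.comp measurableEmbedding_neg_fst))
    (by ext x; simp) h1 h4 (fun u v hu hv => by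
      simp only [expKer, Function.comp_apply]
      rw [neg_neg, abs_of_pos hu, sub_neg_eq_add, abs_neg, abs_of_pos (add_pos hu hv),
        abs_of_pos hv, ← exp_add]
      push_cast; ring_nf)
  obtain ⟨i6, v6⟩ := integral_exp_region (R := {x | x.1 < 0 ∧ 0 < x.2}) (f := expKer A B p q r)
    measurePreserving_neg_fst measurableEmbedding_neg_fst
    (by ext x; simp) h2 h3 (fun u v hu hv => by
      simp only [expKer]
      rw [show -u - v = -(u + v) by ring, abs_neg, abs_neg, abs_of_pos hu, abs_of_pos (add_pos hu hv),
        abs_of_pos hv, ← exp_add]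
      push_cast; ring_nf)
  have m2 : MeasurableSet {x : ℝ × ℝ | 0 < x.1 ∧ x.1 < x.2} := by measurability
  have m3 : MeasurableSet {x : ℝ × ℝ | x.2 < 0 ∧ x.1 < x.2} := by measurability
  have m4 : MeasurableSet {x : ℝ × ℝ | x.1 < 0 ∧ x.2 < x.1} := by measurability
  have m5 : MeasurableSet {x : ℝ × ℝ | 0 < x.1 ∧ x.2 < 0} := by measurability
  have m6 : MeasurableSet {x : ℝ × ℝ | x.1 < 0 ∧ 0 < x.2} := by measurability
  have j2 := i1.union i2
  have j3 := j2.union i3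
  have j4 := j3.union i4
  have j5 := j4.union i5
  have j6 := j5.union i6
  have hae : ({x : ℝ × ℝ | 0 < x.2 ∧ x.2 < x.1} ∪ {x | 0 < x.1 ∧ x.1 < x.2} ∪
      {x | x.2 < 0 ∧ x.1 < x.2} ∪ {x | x.1 < 0 ∧ x.2 < x.1} ∪ {x | 0 < x.1 ∧ x.2 < 0} ∪
      {x | x.1 < 0 ∧ 0 < x.2} : Set (ℝ × ℝ)) =ᵐ[volume] Set.univ := by
    rw [eventuallyEq_univ, mem_ae_iff]
    refine measure_mono_null (fun x hx => ?_) (ae_iff.1 ae_regions)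
    simp only [Set.mem_compl_iff, Set.mem_union, Set.mem_ofPred_eq, not_or, not_and, not_lt] at hx ⊢
    intro hx0 hx1
    obtain ⟨⟨⟨⟨⟨a, b⟩, c⟩, e⟩, f⟩, g⟩ := hx
    rcases lt_or_gt_of_ne hx0 with k | k <;> rcases lt_or_gt_of_ne hx1 with l | l
    · exact not_not.2 (le_antisymm (e k) (c l))
    · exact absurd (g k) (not_le.2 l)
    · exact absurd (f k) (not_le.2 l)
    · exact not_not.2 (le_antisymm (a l) (b k))
  have hint : Integrable (expKer A B p q r) := by
    rw [← integrableOn_univ]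
    exact j6.congr_set_ae hae.symm
  refine ⟨hint, ?_⟩
  rw [← setIntegral_univ, ← setIntegral_congr_set hae, setIntegral_union _ m6 j5 i6,
    setIntegral_union _ m5 j4 i5, setIntegral_union _ m4 j3 i4, setIntegral_union _ m3 j2 i3,
    setIntegral_union _ m2 i1 i2, v1, v2, v3, v4, v5, v6, sixSum]
  all_goals
    rw [Set.disjoint_left]
    intro x hx hx'
    simp only [Set.mem_union, Set.mem_ofPred_eq] at hx hx'
    have := hx'.1
    have := hx'.2
    (try rcases hx with hx | hx) <;> (try rcases hx with hx | hx) <;> (try rcases hx with hx | hx) <;>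
      (try rcases hx with hx | hx) <;> linarith [hx.1, hx.2]

lemma partial_fractions_aux {x y a b b' : ℂ} (hx : x ≠ 0) (hy : y ≠ 0) (hw : x + y ≠ 0)
    (ha : a ≠ 0) (hb : b ≠ 0) (hb' : b' ≠ 0) (hc' : a + x ≠ 0) (hc : b + (x + y) ≠ 0)
    (hd : b' + y ≠ 0) :
    1 / ((b' + y) * (b + (x + y))) + 1 / (b * (b + (x + y))) + 1 / (a * (a + x)) +
      1 / (b' * (a + x)) + 1 / ((b' + y) * b') + 1 / (a * b) =
    (1 / x + 1 / b) * (1 / (x + y) + 1 / a) + (1 / -x + 1 / b') * (1 / y + 1 / (a + x)) +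
      (1 / -(x + y) + 1 / (b' + y)) * (1 / -y + 1 / (b + (x + y))) := by
  have e1 : 1 / x * (1 / a) - 1 / x * (1 / (a + x)) = 1 / (a * (a + x)) := by field_simp; ring
  have e2 : 1 / b * (1 / (x + y)) - 1 / (x + y) * (1 / (b + (x + y))) =
      1 / (b * (b + (x + y))) := by field_simp; ring
  have e3 : 1 / b' * (1 / y) - 1 / y * (1 / (b' + y)) = 1 / ((b' + y) * b') := by field_simp; ring
  have e4 : 1 / x * (1 / (x + y)) - 1 / x * (1 / y) + 1 / (x + y) * (1 / y) = 0 := by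
    field_simp; ring
  rw [← e1, ← e2, ← e3, one_div_neg_eq_neg_one_div, one_div_neg_eq_neg_one_div,
    one_div_neg_eq_neg_one_div, one_div_mul_eq_div, ← one_div_mul_one_div, ← one_div_mul_one_div,
    ← one_div_mul_one_div]
  linear_combination -e4

lemma sixSum_eq_hker {A B p q r : ℂ} (h1 : r + p - A ≠ 0) (h2 : r + p + A ≠ 0)
    (h3 : p + q - B ≠ 0) (h4 : p + q + B ≠ 0) (h5 : q + r - (A + B) ≠ 0)
    (h6 : q + r + (A + B) ≠ 0) (k1 : q - (p - B) ≠ 0) (k2 : r - (p + A) ≠ 0)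
    (k4 : r - (q + A + B) ≠ 0) :
    sixSum A B p q r = hker q (p - B) * hker r (p + A) + hker p (q + B) * hker r (q + A + B) +
      hker p (r - A) * hker q (r - A - B) := by
  have e := partial_fractions_aux (x := q - (p - B)) (y := r - (q + A + B)) (a := r + p + A)
    (b := p + q - B) (b' := p + q + B) k1 k4 (by convert k2 using 1; ring) h2 h3 h4
    (by convert h6 using 1; ring) (by convert h5 using 1; ring) (by convert h1 using 1; ring)
  rw [show p + q + B + (r - (q + A + B)) = r + p - A by ring,
    show q - (p - B) + (r - (q + A + B)) = r - (p + A) by ring,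
    show p + q - B + (r - (p + A)) = q + r - (A + B) by ring,
    show r + p + A + (q - (p - B)) = q + r + (A + B) by ring] at e
  simp only [hker, sixSum]
  rw [show q + (p - B) = p + q - B by ring, show r + (p + A) = r + p + A by ring,
    show p + (q + B) = p + q + B by ring, show r + (q + A + B) = q + r + (A + B) by ring,
    show p + (r - A) = r + p - A by ring, show q + (r - A - B) = q + r - (A + B) by ring,
    show p - (q + B) = -(q - (p - B)) by ring, show p - (r - A) = -(r - (p + A)) by ring,
    show q - (r - A - B) = -(r - (q + A + B)) by ring]
  exact e

end ExponentialIntegral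

section RadialSeries

lemma inv_one_add_add_le {x : ℝ} (hx : 0 ≤ x) (hx1 : x ≤ 1) (j k : ℕ) :
    (1 + (j : ℝ) + k)⁻¹ ≤ ((j : ℝ) + 1) ^ (-(1 - x)) * ((k : ℝ) + 1) ^ (-x) := by
  have hj : (0 : ℝ) < (j : ℝ) + 1 := by positivity
  have hk : (0 : ℝ) < (k : ℝ) + 1 := by positivity
  have hL : (0 : ℝ) < 1 + (j : ℝ) + k := by positivity
  rw [Real.rpow_neg hj.le, Real.rpow_neg hk.le, ← mul_inv]
  gcongr
  calc ((j : ℝ) + 1) ^ (1 - x) * ((k : ℝ) + 1) ^ x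
      ≤ (1 + (j : ℝ) + k) ^ (1 - x) * (1 + (j : ℝ) + k) ^ x := by
        have h1 : (j : ℝ) + 1 ≤ 1 + j + k := by have := (Nat.cast_nonneg k : (0 : ℝ) ≤ k); linarith
        have h2 : (k : ℝ) + 1 ≤ 1 + j + k := by have := (Nat.cast_nonneg j : (0 : ℝ) ≤ j); linarith
        have h3 : 0 ≤ 1 - x := by linarith
        gcongr
    _ = _ := by rw [← Real.rpow_add hL]; simp

lemma summable_triple_prod {f g h : ℕ → ℝ} (hf : Summable f) (hg : Summable g) (hh : Summable h) :
    Summable (fun p : ℕ × ℕ × ℕ => f p.1 * (g p.2.1 * h p.2.2)) := by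
  have h1 : Summable (fun p : ℕ × ℕ => g p.1 * h p.2) := summable_mul_of_summable_norm hg.norm hh.norm
  exact summable_mul_of_summable_norm hf.norm h1.norm

lemma summable_inv_pairs {a b c : ℝ} (ha : 0 < a) (hb : 0 < b) (hc : 0 < c) (h : 1 < a + b + c) :
    Summable (fun p : ℕ × ℕ × ℕ => ((p.1 : ℝ) + 1) ^ (-a) * (((p.2.1 : ℝ) + 1) ^ (-b) *
      ((p.2.2 : ℝ) + 1) ^ (-c)) * ((1 + (p.1 : ℝ) + p.2.2)⁻¹ * (1 + (p.2.1 : ℝ) + p.2.2)⁻¹ +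
        (1 + (p.1 : ℝ) + p.2.1)⁻¹ * (1 + (p.2.1 : ℝ) + p.2.2)⁻¹ +
        (1 + (p.1 : ℝ) + p.2.2)⁻¹ * (1 + (p.1 : ℝ) + p.2.1)⁻¹)) := by
  obtain ⟨x, y, z, hx0, hx1, hxa, hy0, hy1, hyb, hz0, hz1, hzc, hxyz⟩ := exists_exponents ha hb hc h
  have S : ∀ {e : ℝ}, 1 < e → Summable (fun k : ℕ => ((k : ℝ) + 1) ^ (-e)) := fun he =>
    summable_rpow_add_one (by linarith)
  have s1 := summable_triple_prod (S (e := a + (1 - x)) (by linarith)) (S (e := b + (1 - y)) (by linarith))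
    (S (e := c + x + y) (by linarith))
  have s2 := summable_triple_prod (S (e := a + (1 - x)) (by linarith)) (S (e := b + x + z) (by linarith))
    (S (e := c + (1 - z)) (by linarith))
  have s3 := summable_triple_prod (S (e := a + y + z) (by linarith)) (S (e := b + (1 - y)) (by linarith))
    (S (e := c + (1 - z)) (by linarith))
  refine Summable.of_nonneg_of_le (fun p => by positivity) (fun p => ?_) ((s1.add s2).add s3)
  obtain ⟨i, j, k⟩ := p
  have hi : (0 : ℝ) < (i : ℝ) + 1 := by positivity
  have hj : (0 : ℝ) < (j : ℝ) + 1 := by positivity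
  have hk : (0 : ℝ) < (k : ℝ) + 1 := by positivity
  simp only
  rw [mul_add, mul_add]
  refine add_le_add (add_le_add ?_ ?_) ?_
  · calc _ ≤ ((i : ℝ) + 1) ^ (-a) * (((j : ℝ) + 1) ^ (-b) * ((k : ℝ) + 1) ^ (-c)) *
        ((((i : ℝ) + 1) ^ (-(1 - x)) * ((k : ℝ) + 1) ^ (-x)) *
          (((j : ℝ) + 1) ^ (-(1 - y)) * ((k : ℝ) + 1) ^ (-y))) := by
          gcongr
          · exact inv_one_add_add_le hx0.le hx1.le i k
          · exact inv_one_add_add_le hy0.le hy1.le j k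
      _ = _ := by
        rw [neg_add a, neg_add b, neg_add (c + x), neg_add c, Real.rpow_add hi, Real.rpow_add hj,
          Real.rpow_add hk, Real.rpow_add hk]
        ring
  · calc _ ≤ ((i : ℝ) + 1) ^ (-a) * (((j : ℝ) + 1) ^ (-b) * ((k : ℝ) + 1) ^ (-c)) *
        ((((i : ℝ) + 1) ^ (-(1 - x)) * ((j : ℝ) + 1) ^ (-x)) *
          (((k : ℝ) + 1) ^ (-(1 - z)) * ((j : ℝ) + 1) ^ (-z))) := by
          gcongr
          · exact inv_one_add_add_le hx0.le hx1.le i j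
          · rw [add_right_comm]; exact inv_one_add_add_le hz0.le hz1.le k j
      _ = _ := by
        rw [neg_add a, neg_add (b + x), neg_add b, neg_add c, Real.rpow_add hi, Real.rpow_add hj,
          Real.rpow_add hj, Real.rpow_add hk]
        ring
  · calc _ ≤ ((i : ℝ) + 1) ^ (-a) * (((j : ℝ) + 1) ^ (-b) * ((k : ℝ) + 1) ^ (-c)) *
        ((((k : ℝ) + 1) ^ (-(1 - z)) * ((i : ℝ) + 1) ^ (-z)) *
          (((j : ℝ) + 1) ^ (-(1 - y)) * ((i : ℝ) + 1) ^ (-y))) := by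
          gcongr
          · rw [add_right_comm]; exact inv_one_add_add_le hz0.le hz1.le k i
          · rw [add_right_comm]; exact inv_one_add_add_le hy0.le hy1.le j i
      _ = _ := by
        rw [neg_add (a + y), neg_add a, neg_add b, neg_add c, Real.rpow_add hi, Real.rpow_add hi,
          Real.rpow_add hj, Real.rpow_add hk]
        ring

lemma norm_expKer (A B p q r : ℂ) (x : ℝ × ℝ) :
    (‖expKer A B p q r x‖ : ℂ) = expKer A.re B.re p.re q.re r.re x := by
  rw [expKer, expKer, norm_exp, ofReal_exp]
  congr 1
  simp

lemma integral_norm_expKer {A B p q r : ℂ} (h1 : 0 < (r + p - A).re) (h2 : 0 < (r + p + A).re)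
    (h3 : 0 < (p + q - B).re) (h4 : 0 < (p + q + B).re) (h5 : 0 < (q + r - (A + B)).re)
    (h6 : 0 < (q + r + (A + B)).re) :
    ∫ x, ‖expKer A B p q r x‖ = sixSum A.re B.re p.re q.re r.re := by
  have h := (integral_expKer (A := (A.re : ℂ)) (B := B.re) (p := p.re) (q := q.re) (r := r.re)
    (by simpa using h1) (by simpa using h2) (by simpa using h3) (by simpa using h4)
    (by simpa using h5) (by simpa using h6)).2
  simp_rw [← norm_expKer] at h
  rw [integral_complex_ofReal] at h
  apply ofReal_injective
  rw [h]
  simp [sixSum]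

lemma sixSum_le {A B p q r δ u v w : ℝ} (hδ : 0 < δ) (hu : 0 < u) (hv : 0 < v) (hw : 0 < w)
    (h1 : δ * u ≤ r + p - A) (h2 : δ * u ≤ r + p + A) (h3 : δ * v ≤ p + q - B)
    (h4 : δ * v ≤ p + q + B) (h5 : δ * w ≤ q + r - (A + B)) (h6 : δ * w ≤ q + r + (A + B)) :
    sixSum A B p q r ≤ 2 * (δ⁻¹) ^ 2 * (u⁻¹ * w⁻¹ + v⁻¹ * w⁻¹ + u⁻¹ * v⁻¹) := by
  have k : ∀ {a b x y : ℝ}, 0 < x → 0 < y → δ * x ≤ a → δ * y ≤ b →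
      1 / (a * b) ≤ (δ⁻¹) ^ 2 * (x⁻¹ * y⁻¹) := fun {a b x y} hx hy ha hb => by
    have : (δ⁻¹) ^ 2 * (x⁻¹ * y⁻¹) = 1 / ((δ * x) * (δ * y)) := by field_simp
    have ha0 : 0 ≤ a := le_trans (by positivity) ha
    rw [this]
    gcongr
  have := k hu hw h1 h5
  have := k hv hw h3 h5
  have := k hu hw h2 h6
  have := k hv hw h4 h6
  have := k hu hv h1 h4
  have := k hu hv h2 h3
  unfold sixSum
  linarith

/-- The radial function `∑ₖ cₖ exp (-(g + n + 2 k) |s|)`. -/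
noncomputable def radial (D g : ℂ) (n : ℕ) (s : ℝ) : ℂ :=
  ∑' k : ℕ, ccoef D g n k * cexp (-(g + n + 2 * k) * |s|)

/-- Admissibility of a line exponent `g` in half-dimension `D`. -/
structure Admissible (D g : ℂ) : Prop where
  re_pos : 0 < g.re
  compl_re_pos : 0 < (D - g).re
  compl_ne_nat : ∀ j : ℕ, D - g ≠ j

lemma summable_radial {D g : ℂ} (n : ℕ) (hg : Admissible D g) {s : ℝ} (hs : s ≠ 0) :
    Summable (fun k : ℕ => ‖ccoef D g n k * cexp (-(g + n + 2 * k) * |s|)‖) := by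
  obtain ⟨C, hC, h⟩ := exists_norm_ccoef_le n hg.re_pos hg.compl_ne_nat hg.compl_re_pos
  have hs' : 0 < |s| := abs_pos.2 hs
  have hgeo : Summable (fun k : ℕ => C * (Real.exp (-(2 * |s|))) ^ k) :=
    (summable_geometric_of_lt_one (Real.exp_nonneg _)
      (by rw [Real.exp_lt_one_iff]; linarith)).mul_left C
  refine Summable.of_nonneg_of_le (fun k => norm_nonneg _) (fun k => ?_) hgeo
  rw [norm_mul, norm_exp, ← Real.exp_nat_mul]
  have h1 : ‖ccoef D g n k‖ ≤ C := (h k).trans <| by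
    have : ((k : ℝ) + 1) ^ (-(2 * (D - g).re)) ≤ 1 :=
      Real.rpow_le_one_of_one_le_of_nonpos (by linarith [(Nat.cast_nonneg k : (0 : ℝ) ≤ k)])
        (by linarith [hg.compl_re_pos])
    nlinarith
  have hg0 := hg.re_pos
  refine mul_le_mul h1 (Real.exp_le_exp.2 ?_) (Real.exp_nonneg _) hC.le
  have e : ((-(g + n + 2 * k) * |s| : ℂ)).re = -(g.re + n + 2 * k) * |s| := by simp
  rw [e]
  have : 0 ≤ (g.re + n) * |s| := by positivity
  nlinarith


lemma tsum_mul_mul_of_summable_norm {f g h : ℕ → ℂ} (hf : Summable fun k => ‖f k‖)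
    (hg : Summable fun k => ‖g k‖) (hh : Summable fun k => ‖h k‖) :
    ∑' p : ℕ × ℕ × ℕ, f p.1 * (g p.2.1 * h p.2.2) =
      (∑' k, f k) * ((∑' k, g k) * ∑' k, h k) := by
  have h1 : Summable (fun p : ℕ × ℕ => ‖g p.1 * h p.2‖) := by
    have := summable_mul_of_summable_norm (R := ℝ) (f := fun k => ‖g k‖) (g := fun k => ‖h k‖)
      hg.norm hh.norm
    simpa only [norm_mul] using this
  rw [tsum_mul_tsum_of_summable_norm hg hh, tsum_mul_tsum_of_summable_norm hf h1]

lemma exists_min_pos (a b c d e f : ℝ) (ha : 0 < a) (hb : 0 < b) (hc : 0 < c) (hd : 0 < d)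
    (he : 0 < e) (hf : 0 < f) :
    ∃ δ, 0 < δ ∧ δ ≤ 1 ∧ δ ≤ a ∧ δ ≤ b ∧ δ ≤ c ∧ δ ≤ d ∧ δ ≤ e ∧ δ ≤ f := by
  refine ⟨min 1 (min a (min b (min c (min d (min e f))))), by positivity, ?_⟩
  simp only [min_le_iff, le_refl, true_or, or_true, and_self]

theorem hasSum_radial_integral {D α₁ α₄ α₆ A B : ℂ} (n : ℕ) (a₁ : Admissible D α₁)
    (a₄ : Admissible D α₄) (a₆ : Admissible D α₆)
    (hD : 1 < 2 * (D - α₁).re + 2 * (D - α₄).re + 2 * (D - α₆).re)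
    (h1 : 0 < (α₆ + α₁ - A).re) (h2 : 0 < (α₆ + α₁ + A).re)
    (h3 : 0 < (α₁ + α₄ - B).re) (h4 : 0 < (α₁ + α₄ + B).re) (h5 : 0 < (α₄ + α₆ - (A + B)).re)
    (h6 : 0 < (α₄ + α₆ + (A + B)).re) :
    HasSum (fun p : ℕ × ℕ × ℕ => ccoef D α₁ n p.1 * (ccoef D α₄ n p.2.1 * ccoef D α₆ n p.2.2) *
        sixSum A B (α₁ + n + 2 * p.1) (α₄ + n + 2 * p.2.1) (α₆ + n + 2 * p.2.2))
      (∫ x : ℝ × ℝ, cexp (A * x.1 + B * x.2) *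
        (radial D α₁ n (x.1 - x.2) * (radial D α₄ n x.2 * radial D α₆ n x.1))) := by
  have pos : ∀ {z : ℂ} (m : ℕ) (i j : ℕ), 0 < z.re → 0 < (z + m + (2 * i + 2 * j)).re :=
    fun {z} m i j hz => by
      have : (z + m + (2 * i + 2 * j)).re = z.re + m + (2 * i + 2 * j) := by simp
      rw [this]; positivity
  have g1 : ∀ i k : ℕ, α₆ + n + 2 * k + (α₁ + n + 2 * i) - A =
    α₆ + α₁ - A + (2 * n : ℕ) + (2 * i + 2 * k) := fun i k => by push_cast; ring
  have g2 : ∀ i k : ℕ, α₆ + n + 2 * k + (α₁ + n + 2 * i) + A =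
    α₆ + α₁ + A + (2 * n : ℕ) + (2 * i + 2 * k) := fun i k => by push_cast; ring
  have g3 : ∀ i j : ℕ, α₁ + n + 2 * i + (α₄ + n + 2 * j) - B =
    α₁ + α₄ - B + (2 * n : ℕ) + (2 * i + 2 * j) := fun i k => by push_cast; ring
  have g4 : ∀ i j : ℕ, α₁ + n + 2 * i + (α₄ + n + 2 * j) + B =
    α₁ + α₄ + B + (2 * n : ℕ) + (2 * i + 2 * j) := fun i k => by push_cast; ring
  have g5 : ∀ j k : ℕ, α₄ + n + 2 * j + (α₆ + n + 2 * k) - (A + B) =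
    α₄ + α₆ - (A + B) + (2 * n : ℕ) + (2 * j + 2 * k) := fun i k => by push_cast; ring
  have g6 : ∀ j k : ℕ, α₄ + n + 2 * j + (α₆ + n + 2 * k) + (A + B) =
    α₄ + α₆ + (A + B) + (2 * n : ℕ) + (2 * j + 2 * k) := fun i k => by push_cast; ring
  set c : ℕ × ℕ × ℕ → ℂ := fun p => ccoef D α₁ n p.1 * (ccoef D α₄ n p.2.1 * ccoef D α₆ n p.2.2)
    with hc
  set F : ℕ × ℕ × ℕ → ℝ × ℝ → ℂ := fun p x => c p *
    expKer A B (α₁ + n + 2 * p.1) (α₄ + n + 2 * p.2.1) (α₆ + n + 2 * p.2.2) x with hF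
  have hI : ∀ p : ℕ × ℕ × ℕ, Integrable (expKer A B (α₁ + n + 2 * p.1) (α₄ + n + 2 * p.2.1)
      (α₆ + n + 2 * p.2.2)) ∧ ∫ x, expKer A B (α₁ + n + 2 * p.1) (α₄ + n + 2 * p.2.1)
      (α₆ + n + 2 * p.2.2) x = sixSum A B (α₁ + n + 2 * p.1) (α₄ + n + 2 * p.2.1)
      (α₆ + n + 2 * p.2.2) := fun p => by
    apply integral_expKer
    · rw [g1]; exact pos _ _ _ h1
    · rw [g2]; exact pos _ _ _ h2
    · rw [g3]; exact pos _ _ _ h3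
    · rw [g4]; exact pos _ _ _ h4
    · rw [g5]; exact pos _ _ _ h5
    · rw [g6]; exact pos _ _ _ h6
  have hN : ∀ p : ℕ × ℕ × ℕ, ∫ x, ‖expKer A B (α₁ + n + 2 * p.1) (α₄ + n + 2 * p.2.1)
      (α₆ + n + 2 * p.2.2) x‖ = sixSum A.re B.re (α₁ + n + 2 * p.1 : ℂ).re
        (α₄ + n + 2 * p.2.1 : ℂ).re (α₆ + n + 2 * p.2.2 : ℂ).re := fun p => by
    apply integral_norm_expKer
    · rw [g1]; exact pos _ _ _ h1
    · rw [g2]; exact pos _ _ _ h2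
    · rw [g3]; exact pos _ _ _ h3
    · rw [g4]; exact pos _ _ _ h4
    · rw [g5]; exact pos _ _ _ h5
    · rw [g6]; exact pos _ _ _ h6
  obtain ⟨δ, hδ, hδ1, d1, d2, d3, d4, d5, d6⟩ := exists_min_pos _ _ _ _ _ _ h1 h2 h3 h4 h5 h6
  obtain ⟨C₁, hC₁, b₁⟩ := exists_norm_ccoef_le n a₁.re_pos a₁.compl_ne_nat a₁.compl_re_pos
  obtain ⟨C₄, hC₄, b₄⟩ := exists_norm_ccoef_le n a₄.re_pos a₄.compl_ne_nat a₄.compl_re_pos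
  obtain ⟨C₆, hC₆, b₆⟩ := exists_norm_ccoef_le n a₆.re_pos a₆.compl_ne_nat a₆.compl_re_pos
  have hS : Summable (fun p => ∫ x, ‖F p x‖) := by
    have hp := summable_inv_pairs (mul_pos two_pos a₁.compl_re_pos)
      (mul_pos two_pos a₄.compl_re_pos) (mul_pos two_pos a₆.compl_re_pos) hD
    refine Summable.of_nonneg_of_le (fun p => integral_nonneg fun x => norm_nonneg _) (fun p => ?_)
      (hp.mul_left (C₁ * (C₄ * C₆) * (2 * (δ⁻¹) ^ 2)))
    obtain ⟨i, j, k⟩ := p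
    simp only [hF, norm_mul]
    have hNp := hN (i, j, k)
    simp only at hNp
    rw [integral_const_mul, hNp]
    have q : ∀ {z : ℂ} (i j : ℕ), δ ≤ z.re →
        δ * (1 + (i : ℝ) + j) ≤ (z + (2 * n : ℕ) + (2 * i + 2 * j)).re := fun {z} i j hz => by
      have e : (z + (2 * n : ℕ) + (2 * i + 2 * j)).re = z.re + (2 * n : ℕ) + (2 * i + 2 * j) := by
        simp
      rw [e]
      have h0 : (0 : ℝ) ≤ (2 * n : ℕ) := Nat.cast_nonneg _
      have hi : (0 : ℝ) ≤ i := Nat.cast_nonneg _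
      have hj : (0 : ℝ) ≤ j := Nat.cast_nonneg _
      nlinarith
    have hsix := sixSum_le (A := A.re) (B := B.re) (p := (α₁ + n + 2 * i : ℂ).re)
      (q := (α₄ + n + 2 * j : ℂ).re) (r := (α₆ + n + 2 * k : ℂ).re) (δ := δ)
      (u := 1 + (i : ℝ) + k) (v := 1 + (i : ℝ) + j) (w := 1 + (j : ℝ) + k) hδ (by positivity)
      (by positivity) (by positivity)
      (by rw [← add_re, ← sub_re, g1]; exact q _ _ d1)
      (by rw [← add_re, ← add_re, g2]; exact q _ _ d2)
      (by rw [← add_re, ← sub_re, g3]; exact q _ _ d3)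
      (by rw [← add_re, ← add_re, g4]; exact q _ _ d4)
      (by rw [← add_re, ← add_re, ← sub_re, g5]; exact q _ _ d5)
      (by rw [← add_re, ← add_re, ← add_re, g6]; exact q _ _ d6)
    have hcn : ‖c (i, j, k)‖ ≤ (C₁ * ((i : ℝ) + 1) ^ (-(2 * (D - α₁).re))) *
        ((C₄ * ((j : ℝ) + 1) ^ (-(2 * (D - α₄).re))) *
          (C₆ * ((k : ℝ) + 1) ^ (-(2 * (D - α₆).re)))) := by
      rw [hc]
      simp only [norm_mul]
      have := b₁ i
      have := b₄ j
      have := b₆ k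
      gcongr
    have h0 : 0 ≤ sixSum A.re B.re (α₁ + n + 2 * i : ℂ).re (α₄ + n + 2 * j : ℂ).re
        (α₆ + n + 2 * k : ℂ).re := by
      rw [← hNp]
      exact integral_nonneg fun x => norm_nonneg _
    refine (mul_le_mul hcn hsix h0 ((norm_nonneg _).trans hcn)).trans (le_of_eq ?_)
    ring
  have key := hasSum_integral_of_summable_integral_norm (F := F)
    (fun p => (hI p).1.const_mul (c p)) hS
  have e1 : ∀ p, ∫ x, F p x = c p * sixSum A B (α₁ + n + 2 * p.1) (α₄ + n + 2 * p.2.1)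
      (α₆ + n + 2 * p.2.2) := fun p => by
    rw [← (hI p).2, ← integral_const_mul]
  simp_rw [e1] at key
  have e2 : ∫ x, ∑' p, F p x = ∫ x : ℝ × ℝ, cexp (A * x.1 + B * x.2) *
      (radial D α₁ n (x.1 - x.2) * (radial D α₄ n x.2 * radial D α₆ n x.1)) := by
    refine integral_congr_ae ?_
    filter_upwards [ae_regions] with x hx
    rw [radial, radial, radial, ← tsum_mul_mul_of_summable_norm
      (summable_radial n a₁ (sub_ne_zero.2 hx.2.2)) (summable_radial n a₄ hx.2.1)
      (summable_radial n a₆ hx.1), ← tsum_mul_left]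
    refine tsum_congr fun p => ?_
    simp only [hF, hc, expKer]
    have e3 : cexp (A * x.1 + B * x.2 - (α₆ + n + 2 * p.2.2) * |x.1| -
        (α₁ + n + 2 * p.1) * |x.1 - x.2| - (α₄ + n + 2 * p.2.1) * |x.2|) =
        cexp (A * x.1 + B * x.2) * (cexp (-(α₁ + n + 2 * p.1) * |x.1 - x.2|) *
          (cexp (-(α₄ + n + 2 * p.2.1) * |x.2|) * cexp (-(α₆ + n + 2 * p.2.2) * |x.1|))) := by
      rw [← exp_add, ← exp_add, ← exp_add]
      ring_nf
    rw [e3]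
    ring
  rw [e2] at key
  exact key

/-- The sum of the series `∑ₖ cₖ hker (g + n + 2 k) w`. -/
noncomputable def hval (D g : ℂ) (n : ℕ) (w : ℂ) : ℂ :=
  Gamma D * Gamma (D - g) / (2 * Gamma g) *
    (Gamma ((g + n + w) / 2) / Gamma ((g + n + w) / 2 + (D - g)) *
      (Gamma ((g + n - w) / 2) / Gamma ((g + n - w) / 2 + (D - g))))

lemma hasSum_line {D g₀ g₁ g₂ σ₁ σ₂ : ℂ} (n : ℕ) (a₀ : Admissible D g₀) (a₁ : Admissible D g₁)
    (a₂ : Admissible D g₂) (hD : 1 < 2 * (D - g₀).re + 2 * (D - g₁).re + 2 * (D - g₂).re)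
    (hp₁ : 0 < (g₁ + g₀ + σ₁).re) (hp₂ : 0 < (g₂ + g₀ + σ₂).re)
    (hz₁ : ∀ m : ℤ, (g₁ - g₀ - σ₁) / 2 ≠ m) (hz₂ : ∀ m : ℤ, (g₂ - g₀ - σ₂) / 2 ≠ m) :
    ∃ S : ℂ, HasSum (fun p : ℕ × ℕ × ℕ =>
        ccoef D g₀ n p.1 * ccoef D g₁ n p.2.1 * ccoef D g₂ n p.2.2 *
          (hker (g₁ + n + 2 * p.2.1) (g₀ + n + 2 * p.1 + σ₁) *
            hker (g₂ + n + 2 * p.2.2) (g₀ + n + 2 * p.1 + σ₂))) S ∧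
      HasSum (fun j : ℕ => ccoef D g₀ n j * hval D g₁ n (g₀ + n + 2 * j + σ₁) *
        hval D g₂ n (g₀ + n + 2 * j + σ₂)) S := by
  obtain ⟨x, y, z, -, -, hxa, hy0, hy1, hyb, hz0, hz1, hzc, hxyz⟩ := exists_exponents
    (mul_pos two_pos a₀.compl_re_pos) (mul_pos two_pos a₁.compl_re_pos)
    (mul_pos two_pos a₂.compl_re_pos) hD
  obtain ⟨C₀, -, b₀⟩ := exists_norm_ccoef_le n a₀.re_pos a₀.compl_ne_nat a₀.compl_re_pos
  obtain ⟨C₁, -, b₁⟩ := exists_norm_ccoef_le n a₁.re_pos a₁.compl_ne_nat a₁.compl_re_pos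
  obtain ⟨C₂, -, b₂⟩ := exists_norm_ccoef_le n a₂.re_pos a₂.compl_ne_nat a₂.compl_re_pos
  have aux : ∀ g σ : ℂ, Admissible D g → 0 < (g + g₀ + σ).re →
      (∀ m : ℤ, (g - g₀ - σ) / 2 ≠ m) →
      (∃ C : ℝ, ∀ j k : ℕ, ‖hker (g + n + 2 * k) (g₀ + n + 2 * j + σ)‖ ≤ C * (gap k j)⁻¹) ∧
      ∀ j : ℕ, HasSum (fun k : ℕ => ccoef D g n k * hker (g + n + 2 * k) (g₀ + n + 2 * j + σ))
        (hval D g n (g₀ + n + 2 * j + σ)) := by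
    intro g σ a hp hz
    refine ⟨?_, fun j => ?_⟩
    · obtain ⟨C, -, hC⟩ := exists_norm_hker_le (b' := (g + g₀ + σ) / 2 + n) hz (by
        have e : ((g + g₀ + σ) / 2 + n).re = (g + g₀ + σ).re / 2 + n := by
          rw [add_re, natCast_re, show (2 : ℂ) = ((2 : ℝ) : ℂ) by norm_num, div_ofReal_re]
        rw [e]; positivity)
      exact ⟨C, fun j k => hC j k _ _ (by ring) (by ring)⟩
    · refine hasSum_ccoef_hker n a.re_pos a.compl_ne_nat a.compl_re_pos ?_ ?_
      · refine ne_neg_nat_of_re_pos ?_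
        have e : (g + n + (g₀ + n + 2 * j + σ)) / 2 = (((1 / 2 : ℝ)) : ℂ) * (g + g₀ + σ) + n + j := by
          push_cast; ring
        have e' : ((((1 / 2 : ℝ)) : ℂ) * (g + g₀ + σ) + n + j).re =
            1 / 2 * (g + g₀ + σ).re + n + j := by
          rw [add_re, add_re, re_ofReal_mul, natCast_re, natCast_re]
        rw [e, e']; positivity
      · intro i h
        apply hz (j - i)
        push_cast
        linear_combination h
  obtain ⟨⟨C₃, b₃⟩, s₁⟩ := aux g₁ σ₁ a₁ hp₁ hz₁
  obtain ⟨⟨C₄, b₄⟩, s₂⟩ := aux g₂ σ₂ a₂ hp₂ hz₂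
  obtain ⟨S, t₁, t₂⟩ := hasSum_triple (U := ccoef D g₀ n) (V := ccoef D g₁ n) (W := ccoef D g₂ n)
    (H := fun j k => hker (g₁ + n + 2 * k) (g₀ + n + 2 * j + σ₁))
    (K := fun j k => hker (g₂ + n + 2 * k) (g₀ + n + 2 * j + σ₂))
    (P := fun j => hval D g₁ n (g₀ + n + 2 * j + σ₁))
    (Q := fun j => hval D g₂ n (g₀ + n + 2 * j + σ₂))
    (a := 2 * (D - g₀).re) hy0 hy1 hyb hz0 hz1 hzc (by linarith) b₀ b₁ b₂ b₃ b₄ s₁ s₂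
  exact ⟨S, t₁, t₂⟩

theorem radial_integral_eq {D α₁ α₄ α₆ A B : ℂ} (n : ℕ) (a₁ : Admissible D α₁)
    (a₄ : Admissible D α₄) (a₆ : Admissible D α₆)
    (hD : 1 < 2 * (D - α₁).re + 2 * (D - α₄).re + 2 * (D - α₆).re)
    (h1 : 0 < (α₆ + α₁ - A).re) (h2 : 0 < (α₆ + α₁ + A).re)
    (h3 : 0 < (α₁ + α₄ - B).re) (h4 : 0 < (α₁ + α₄ + B).re) (h5 : 0 < (α₄ + α₆ - (A + B)).re)
    (h6 : 0 < (α₄ + α₆ + (A + B)).re)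
    (z1 : ∀ m : ℤ, (α₄ - α₁ + B) / 2 ≠ m) (z2 : ∀ m : ℤ, (α₆ - α₁ - A) / 2 ≠ m)
    (z3 : ∀ m : ℤ, (α₆ - α₄ - (A + B)) / 2 ≠ m) :
    ∃ S₁ S₂ S₃ : ℂ,
      HasSum (fun j : ℕ => ccoef D α₁ n j * hval D α₄ n (α₁ + n + 2 * j + -B) *
        hval D α₆ n (α₁ + n + 2 * j + A)) S₁ ∧
      HasSum (fun j : ℕ => ccoef D α₄ n j * hval D α₁ n (α₄ + n + 2 * j + B) *
        hval D α₆ n (α₄ + n + 2 * j + (A + B))) S₂ ∧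
      HasSum (fun j : ℕ => ccoef D α₆ n j * hval D α₁ n (α₆ + n + 2 * j + -A) *
        hval D α₄ n (α₆ + n + 2 * j + -(A + B))) S₃ ∧
      ∫ x : ℝ × ℝ, cexp (A * x.1 + B * x.2) *
        (radial D α₁ n (x.1 - x.2) * (radial D α₄ n x.2 * radial D α₆ n x.1)) = S₁ + S₂ + S₃ := by
  have key := hasSum_radial_integral n a₁ a₄ a₆ hD h1 h2 h3 h4 h5 h6
  obtain ⟨S₁, t₁, s₁⟩ := hasSum_line (σ₁ := -B) (σ₂ := A) n a₁ a₄ a₆ hD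
    (by convert h3 using 2; ring) h2 (fun m => by convert z1 m using 2; ring)
    (fun m => by convert z2 m using 2)
  obtain ⟨S₂, t₂, s₂⟩ := hasSum_line (σ₁ := B) (σ₂ := A + B) n a₄ a₁ a₆ (by linarith)
    h4 (by convert h6 using 2; ring)
    (fun m h => z1 (-m) (by push_cast; linear_combination -h))
    (fun m => by convert z3 m using 2)
  obtain ⟨S₃, t₃, s₃⟩ := hasSum_line (σ₁ := -A) (σ₂ := -(A + B)) n a₆ a₁ a₄ (by linarith)
    (by convert h1 using 2; ring) (by convert h5 using 2; ring)
    (fun m h => z2 (-m) (by push_cast; linear_combination -h))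
    (fun m h => z3 (-m) (by push_cast; linear_combination -h))
  refine ⟨S₁, S₂, S₃, s₁, s₂, s₃, key.unique ?_⟩
  let e₂ : ℕ × ℕ × ℕ ≃ ℕ × ℕ × ℕ :=
    ⟨fun p => (p.2.1, p.1, p.2.2), fun p => (p.2.1, p.1, p.2.2), fun _ => rfl, fun _ => rfl⟩
  let e₃ : ℕ × ℕ × ℕ ≃ ℕ × ℕ × ℕ :=
    ⟨fun p => (p.2.2, p.1, p.2.1), fun p => (p.2.1, p.2.2, p.1), fun _ => rfl, fun _ => rfl⟩
  have u₂ := e₂.hasSum_iff.2 t₂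
  have u₃ := e₃.hasSum_iff.2 t₃
  refine ((t₁.add u₂).add u₃).congr_fun ?_
  rintro ⟨i, j, k⟩
  simp only [Function.comp_apply, e₂, e₃, Equiv.coe_fn_mk]
  have pos : ∀ {z : ℂ} (a b : ℕ), 0 < z.re → z + (2 * n : ℕ) + (2 * a + 2 * b) ≠ 0 :=
    fun {z} a b hz h0 => by
      have h := congrArg re h0
      have e : (z + (2 * n : ℕ) + (2 * a + 2 * b)).re = z.re + (2 * n : ℕ) + (2 * a + 2 * b) := by
        simp
      rw [e, zero_re] at h
      have : (0 : ℝ) ≤ (2 * n : ℕ) + (2 * a + 2 * b) := by positivity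
      linarith
  rw [sixSum_eq_hker]
  · simp only [← sub_eq_add_neg, ← sub_sub, ← add_assoc]; ring
  · convert pos i k h1 using 1; push_cast; ring
  · convert pos i k h2 using 1; push_cast; ring
  · convert pos i j h3 using 1; push_cast; ring
  · convert pos i j h4 using 1; push_cast; ring
  · convert pos j k h5 using 1; push_cast; ring
  · convert pos j k h6 using 1; push_cast; ring
  · intro h; apply z1 (i - j); push_cast; linear_combination h / 2
  · intro h; apply z2 (i - k); push_cast; linear_combination h / 2
  · intro h; apply z3 (j - k); push_cast; linear_combination h / 2

end RadialSeries

section Quadratic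

/-- The Chu–Vandermonde identity. -/
lemma sum_choose_mul_poch_div (m : ℕ) : ∀ {β δ : ℂ}, (∀ j : ℕ, δ ≠ -j) →
    ∑ k ∈ Finset.range (m + 1), (m.choose k : ℂ) * ((-1) ^ k * (poch β k / poch δ k)) =
      poch (δ - β) m / poch δ m := by
  induction m with
  | zero => intro β δ _; simp
  | succ m ih =>
    intro β δ hδ
    have hδ' : ∀ j : ℕ, δ + 1 ≠ -j := fun j h => hδ (j + 1) (by push_cast; linear_combination h)
    have hδ0 : δ ≠ 0 := by simpa using hδ 0
    have key := Finset.sum_choose_succ_mul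
      (fun k _ => (-1 : ℂ) ^ k * (poch β k / poch δ k)) m
    rw [show m + 1 + 1 = m + 2 from rfl, key, ih hδ]
    have h2 : ∑ k ∈ Finset.range (m + 1), (m.choose k : ℂ) *
        ((-1) ^ (k + 1) * (poch β (k + 1) / poch δ (k + 1))) =
        -(β / δ) * (poch ((δ + 1) - (β + 1)) m / poch (δ + 1) m) := by
      rw [← ih hδ', Finset.mul_sum]
      refine Finset.sum_congr rfl fun k _ => ?_
      have := poch_ne_zero hδ' k
      rw [poch_succ_left, poch_succ_left]
      field_simp
      ring
    rw [h2, show δ + 1 - (β + 1) = δ - β by ring]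
    have e := (poch_succ δ m).symm.trans (poch_succ_left δ m)
    have n1 := poch_ne_zero hδ m
    have n2 := poch_ne_zero hδ' m
    have n3 : δ + m ≠ 0 := fun h => hδ m (eq_neg_of_add_eq_zero_left h)
    rw [poch_succ, poch_succ, eq_div_iff (mul_ne_zero n1 n3)]
    have e2 : poch δ m * (δ + m) / poch (δ + 1) m = δ := by rw [e]; field_simp
    calc _ = poch (δ - β) m * (δ + m) - β / δ * poch (δ - β) m *
          (poch δ m * (δ + m) / poch (δ + 1) m) := by field_simp; ring
      _ = _ := by rw [e2]; field_simp; ring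

lemma poch_reflect (z : ℂ) (m : ℕ) : poch (z - m) m = (-1) ^ m * poch (1 - z) m := by
  induction m with
  | zero => simp
  | succ m ih =>
    rw [poch_succ_left, show z - (m + 1 : ℕ) + 1 = z - m by push_cast; ring, ih, poch_succ]
    push_cast; ring

/-- The coefficients of the expansion of the zonal projections in powers of `1 / (2 cosh s)`. -/
noncomputable def acoef (D g : ℂ) (n k : ℕ) : ℂ :=
  poch g (n + 2 * k) / (k.factorial * poch D (n + k))

lemma sum_acoef (D g : ℂ) (n m : ℕ) (hD : ∀ j : ℕ, D ≠ -j) :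
    ∑ p ∈ Finset.HasAntidiagonal.antidiagonal m, acoef D g n p.1 *
      (poch (g + n + 2 * p.1) p.2 / p.2.factorial * (-1) ^ p.2) = ccoef D g n m := by
  have hD' : ∀ j : ℕ, D + n ≠ -j := fun j h => hD (n + j) (by push_cast; linear_combination h)
  have cv := sum_choose_mul_poch_div m (β := g + n + m) hD'
  rw [show D + n - (g + n + m) = (D - g) - m by ring, poch_reflect] at cv
  rw [Finset.Nat.sum_antidiagonal_eq_sum_range_succ_mk]
  have n1 := poch_ne_zero hD n
  have n2 := poch_ne_zero hD' m
  have nf : (m.factorial : ℂ) ≠ 0 := by exact_mod_cast m.factorial_ne_zero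
  calc _ = (-1) ^ m * poch g (n + m) / (m.factorial * poch D n) *
      ∑ k ∈ Finset.range (m + 1), (m.choose k : ℂ) *
        ((-1) ^ k * (poch (g + n + m) k / poch (D + n) k)) := by
        rw [Finset.mul_sum]
        refine Finset.sum_congr rfl fun k hk => ?_
        have hk : k ≤ m := Nat.lt_succ_iff.1 (Finset.mem_range.1 hk)
        have e1 : poch g (n + 2 * k) * poch (g + n + 2 * k) (m - k) =
            poch g (n + m) * poch (g + n + m) k := by
          have h1 := poch_add g (n + 2 * k) (m - k)
          have h2 := poch_add g (n + m) k
          rw [show n + 2 * k + (m - k) = n + m + k by omega] at h1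
          push_cast at h1 h2
          rw [← add_assoc] at h1 h2
          rw [← h1, h2]
        have e2 : (m.factorial : ℂ) = m.choose k * k.factorial * (m - k).factorial := by
          exact_mod_cast (Nat.choose_mul_factorial_mul_factorial hk).symm
        have e3 : (-1 : ℂ) ^ m = (-1) ^ (m - k) * (-1) ^ k := by
          rw [← pow_add, Nat.sub_add_cancel hk]
        have e4 : (-1 : ℂ) ^ k * (-1) ^ k = 1 := by rw [← mul_pow]; simp
        have n3 := poch_ne_zero hD' k
        have n4 : (k.factorial : ℂ) ≠ 0 := by exact_mod_cast k.factorial_ne_zero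
        have n5 : ((m - k).factorial : ℂ) ≠ 0 := by exact_mod_cast (m - k).factorial_ne_zero
        have n6 : (m.choose k : ℂ) ≠ 0 := by exact_mod_cast (Nat.choose_pos hk).ne'
        rw [acoef, poch_add D n k, e2, e3]
        field_simp
        linear_combination e1 - poch g (n + m) * poch (g + n + m) k * e4
    _ = _ := by
        rw [cv, ccoef, poch_add D n m]
        have e4 : (-1 : ℂ) ^ m * (-1) ^ m = 1 := by rw [← mul_pow]; simp
        field_simp
        linear_combination (poch g (n + m) * poch (1 - (D - g)) m) * e4

lemma acoef_succ {D g : ℂ} (n k : ℕ) :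
    acoef D g n (k + 1) = acoef D g n k *
      ((g + n + 2 * k) * (g + n + 2 * k + 1) / ((k + 1) * (D + n + k))) := by
  rw [acoef, acoef, show n + 2 * (k + 1) = n + 2 * k + 1 + 1 by ring, poch_succ, poch_succ,
    Nat.factorial_succ, ← add_assoc, poch_succ]
  push_cast
  rw [div_mul_div_comm]
  congr 1 <;> ring

lemma tendsto_add_div_add (a b : ℂ) :
    Tendsto (fun k : ℕ => ((k : ℂ) + a) / (k + b)) atTop (𝓝 1) := by
  have h1 := tendsto_natCast_div_add_atTop (𝕜 := ℂ) b
  have h2 := (tendsto_natCast_div_add_atTop (𝕜 := ℂ) a).inv₀ one_ne_zero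
  have h := h1.mul h2
  rw [inv_one, one_mul] at h
  refine h.congr' ?_
  filter_upwards [eventually_ne_atTop 0] with k hk
  have : (k : ℂ) ≠ 0 := by exact_mod_cast hk
  rw [inv_div, div_mul_div_comm, mul_comm ((k : ℂ) + b), mul_div_mul_left _ _ this]

lemma summable_norm_acoef {D g : ℂ} (hD : 0 < D.re) (hg : 0 < g.re) (n : ℕ) {r : ℝ} (hr : 0 < r)
    (hr4 : 4 * r < 1) : Summable fun k => ‖acoef D g n k‖ * r ^ k := by
  have hne : ∀ k, acoef D g n k ≠ 0 := fun k =>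
    div_ne_zero (poch_ne_zero (ne_neg_nat_of_re_pos hg) _)
      (mul_ne_zero (by exact_mod_cast k.factorial_ne_zero)
        (poch_ne_zero (ne_neg_nat_of_re_pos hD) _))
  have hlim : Tendsto (fun k : ℕ => (g + n + 2 * k) * (g + n + 2 * k + 1) /
      (((k : ℂ) + 1) * (D + n + k))) atTop (𝓝 4) := by
    have h := ((tendsto_add_div_add ((g + n) / 2) 1).mul
      (tendsto_add_div_add ((g + n + 1) / 2) (D + n))).const_mul 4
    rw [mul_one, mul_one] at h
    refine h.congr fun k => ?_
    rw [div_mul_div_comm, ← mul_div_assoc, add_comm (k : ℂ) (D + n)]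
    congr 1
    ring
  refine summable_of_ratio_test_tendsto_lt_one hr4
    (Eventually.of_forall fun k => mul_ne_zero (norm_ne_zero_iff.2 (hne k)) (by positivity)) ?_
  have h := hlim.norm.mul_const r
  rw [show ‖(4 : ℂ)‖ = 4 by simp] at h
  refine h.congr fun k => ?_
  have h1 : ‖acoef D g n k‖ ≠ 0 := norm_ne_zero_iff.2 (hne k)
  simp only [acoef_succ, norm_mul, norm_norm, norm_pow, Real.norm_of_nonneg hr.le]
  field_simp
  ring

lemma norm_poch_le (z : ℂ) (k : ℕ) : ‖poch z k‖ ≤ poch ‖z‖ k := by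
  rw [poch, poch, norm_prod]
  refine Finset.prod_le_prod (fun _ _ => norm_nonneg _) fun j _ => ?_
  exact (norm_add_le _ _).trans (by simp)

lemma poch_mono {x y : ℝ} (hx : 0 ≤ x) (h : x ≤ y) (k : ℕ) : poch x k ≤ poch y k :=
  Finset.prod_le_prod (fun _ _ => by positivity) fun j _ => by linarith

lemma hasSum_one_sub_rpow {a x : ℝ} (hx : 0 ≤ x) (hx1 : x < 1) :
    HasSum (fun j : ℕ => poch a j / j.factorial * x ^ j) ((1 - x) ^ (-a)) := by
  have h := hasSum_one_sub_cpow (a : ℂ) (x := (x : ℂ)) (by simpa [abs_of_nonneg hx] using hx1)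
  rw [← hasSum_ofReal]
  convert! h using 1
  · ext j; simp
  · rw [ofReal_cpow (by linarith)]; simp

lemma tsum_acoef_of_norm_le {D g : ℂ} (hD : 0 < D.re) (hg : 0 < g.re) (n : ℕ) {x : ℂ}
    (hx : ‖x‖ ≤ 1 / 8) :
    ∑' k : ℕ, acoef D g n k * x ^ k * (1 + x) ^ (-(g + n + 2 * k)) =
      ∑' m : ℕ, ccoef D g n m * x ^ m := by
  set F : ℕ × ℕ → ℂ := fun p => (acoef D g n p.1 * x ^ p.1) *
    (poch (g + n + 2 * p.1) p.2 / p.2.factorial * (-x) ^ p.2) with hF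
  set N : ℝ := ‖g + n‖ with hN
  set ρ : ℝ := ‖x‖ with hρ
  have hρ0 : 0 ≤ ρ := norm_nonneg x
  have hinner : ∀ k : ℕ, HasSum (fun j : ℕ => ‖acoef D g n k‖ * ρ ^ k *
      (poch (N + 2 * k) j / j.factorial * ρ ^ j))
      (‖acoef D g n k‖ * ρ ^ k * (1 - ρ) ^ (-(N + 2 * k))) := fun k =>
    (hasSum_one_sub_rpow hρ0 (by linarith)).mul_left _
  have hpos : ∀ (k j : ℕ), 0 ≤ ‖acoef D g n k‖ * ρ ^ k *
      (poch (N + 2 * k) j / j.factorial * ρ ^ j) := fun k j => by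
    have : 0 ≤ poch (N + 2 * k) j := Finset.prod_nonneg fun _ _ => by positivity
    positivity
  have hsum : Summable F := by
    refine Summable.of_norm_bounded (g := fun p : ℕ × ℕ => ‖acoef D g n p.1‖ * ρ ^ p.1 *
      (poch (N + 2 * p.1) p.2 / p.2.factorial * ρ ^ p.2)) ?_ ?_
    · refine (summable_prod_of_nonneg fun p => hpos p.1 p.2).2 ⟨fun k => (hinner k).summable, ?_⟩
      simp only [(hinner _).tsum_eq]
      have h0 := (summable_norm_acoef hD hg n (r := 1 / 5) (by norm_num) (by norm_num)).mul_left
        ((1 - ρ) ^ (-N))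
      refine Summable.of_nonneg_of_le (fun k => ?_) (fun k => ?_) h0
      · have : 0 ≤ 1 - ρ := by linarith
        positivity
      · have h1 : 0 < 1 - ρ := by linarith
        have e : (1 - ρ) ^ (-(N + 2 * k)) = (1 - ρ) ^ (-N) * (((1 - ρ) ^ 2)⁻¹) ^ k := by
          rw [neg_add, Real.rpow_add h1, Real.rpow_neg h1.le (2 * k)]
          congr 1
          rw [inv_pow, ← pow_mul, ← Real.rpow_natCast]
          push_cast; rfl
        have h2 : ρ * ((1 - ρ) ^ 2)⁻¹ ≤ 1 / 5 := by
          rw [← div_eq_mul_inv, div_le_iff₀ (by positivity)]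
          nlinarith
        have h3 : 0 ≤ ρ * ((1 - ρ) ^ 2)⁻¹ := by positivity
        have h4 := pow_le_pow_left₀ h3 h2 k
        rw [mul_pow] at h4
        rw [e]
        calc _ = (1 - ρ) ^ (-N) * (‖acoef D g n k‖ * (ρ ^ k * (((1 - ρ) ^ 2)⁻¹) ^ k)) := by ring
          _ ≤ _ := by gcongr
    · rintro ⟨k, j⟩
      simp only [hF, norm_mul, norm_pow, norm_div, norm_neg, RCLike.norm_natCast]
      gcongr
      refine (norm_poch_le _ _).trans (poch_mono (norm_nonneg _) ?_ _)
      exact (norm_add_le _ _).trans (by simp [hN])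
  have h1 : ∑' p, F p = ∑' k : ℕ, acoef D g n k * x ^ k * (1 + x) ^ (-(g + n + 2 * k)) := by
    rw [hsum.tsum_prod]
    refine tsum_congr fun k => ?_
    have := (hasSum_one_sub_cpow (g + n + 2 * k) (x := -x) (by rw [norm_neg]; linarith)).mul_left
      (acoef D g n k * x ^ k)
    rw [sub_neg_eq_add] at this
    exact this.tsum_eq
  have h2 : ∑' p, F p = ∑' m : ℕ, ccoef D g n m * x ^ m := by
    rw [← Finset.HasAntidiagonal.sigmaAntidiagonalEquivProd.tsum_eq F,
      Summable.tsum_sigma (f := fun c => F (Finset.HasAntidiagonal.sigmaAntidiagonalEquivProd c))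
        (Finset.HasAntidiagonal.sigmaAntidiagonalEquivProd.summable_iff.2 hsum)]
    refine tsum_congr fun m => ?_
    rw [tsum_fintype, ← sum_acoef D g n m (ne_neg_nat_of_re_pos hD), Finset.sum_mul,
      ← Finset.sum_coe_sort (Finset.HasAntidiagonal.antidiagonal m)]
    refine Finset.sum_congr rfl fun p _ => ?_
    have hp := Finset.HasAntidiagonal.mem_antidiagonal.1 p.2
    simp only [hF, Finset.HasAntidiagonal.sigmaAntidiagonalEquivProd_apply]
    have hp' : x ^ m = x ^ (p : ℕ × ℕ).1 * x ^ (p : ℕ × ℕ).2 := by rw [← pow_add, hp]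
    rw [neg_pow x, hp']
    ring
  rw [← h1, h2]

lemma analyticAt_tsum_pow {c : ℕ → ℂ} {r : ℝ} (h : Summable fun k => ‖c k‖ * r ^ k) {w : ℂ}
    (hw : ‖w‖ < r) : AnalyticAt ℂ (fun w => ∑' k, c k * w ^ k) w := by
  have hd : DifferentiableOn ℂ (fun w : ℂ => ∑' k, c k * w ^ k) (Metric.ball 0 r) := by
    refine differentiableOn_tsum_of_summable_norm h (fun k => by fun_prop) Metric.isOpen_ball ?_
    intro k w hw
    rw [mem_ball_zero_iff] at hw
    rw [norm_mul, norm_pow]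
    gcongr
  exact hd.analyticAt (Metric.isOpen_ball.mem_nhds (by simpa using hw))

lemma cpow_neg_add_two_mul {w : ℂ} (hw : w ≠ 0) (μ : ℂ) (k : ℕ) :
    w ^ (-(μ + 2 * k)) = w ^ (-μ) * ((w ^ 2)⁻¹) ^ k := by
  rw [neg_add, cpow_add _ _ hw, cpow_neg w (2 * k), inv_pow, ← pow_mul]
  congr 2
  rw [← cpow_natCast]
  push_cast; rfl

lemma tsum_acoef_eq {D g : ℂ} (hD : 0 < D.re) (hg : 0 < g.re) (n : ℕ)
    (hc : ∀ r : ℝ, 0 < r → r < 1 → Summable fun k => ‖ccoef D g n k‖ * r ^ k) {x : ℝ}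
    (hx : x ∈ Set.Ioo (-(1 / 8)) (1 : ℝ)) :
    ∑' k : ℕ, acoef D g n k * (x : ℂ) ^ k * (1 + (x : ℂ)) ^ (-(g + n + 2 * k)) =
      ∑' m : ℕ, ccoef D g n m * (x : ℂ) ^ m := by
  have hfac : ∀ x : ℝ, x ∈ Set.Ioo (-(1 / 8)) (1 : ℝ) →
      ∑' k : ℕ, acoef D g n k * (x : ℂ) ^ k * (1 + (x : ℂ)) ^ (-(g + n + 2 * k)) =
        (1 + (x : ℂ)) ^ (-(g + n)) *
          ∑' k : ℕ, acoef D g n k * ((x : ℂ) * ((1 + (x : ℂ)) ^ 2)⁻¹) ^ k := by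
    intro x hx
    have h1 : 1 + (x : ℂ) ≠ 0 := by
      have : 1 + x ≠ 0 := by linarith [hx.1]
      exact_mod_cast this
    rw [← tsum_mul_left]
    refine tsum_congr fun k => ?_
    rw [cpow_neg_add_two_mul h1, mul_pow]
    ring
  rw [hfac x hx]
  have hA : AnalyticOnNhd ℝ (fun x : ℝ => (1 + (x : ℂ)) ^ (-(g + n)) *
      ∑' k : ℕ, acoef D g n k * ((x : ℂ) * ((1 + (x : ℂ)) ^ 2)⁻¹) ^ k)
      (Set.Ioo (-(1 / 8)) 1) := by
    intro x hx
    have h1 : 0 < 1 + x := by linarith [hx.1]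
    have h1' : 1 + (x : ℂ) ≠ 0 := by exact_mod_cast h1.ne'
    obtain ⟨r, hr1, hr2⟩ := exists_between (show ‖(x : ℂ) * ((1 + (x : ℂ)) ^ 2)⁻¹‖ < 1 / 4 by
      have e : (x : ℂ) * ((1 + (x : ℂ)) ^ 2)⁻¹ = ((x / (1 + x) ^ 2 : ℝ) : ℂ) := by
        push_cast; rw [div_eq_mul_inv]
      rw [e, norm_real, Real.norm_eq_abs, abs_div, abs_of_pos (by positivity : 0 < (1 + x) ^ 2),
        div_lt_iff₀ (by positivity)]
      obtain ⟨h2, h3⟩ := hx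
      rcases abs_cases x with ⟨h, _⟩ | ⟨h, _⟩ <;> rw [h]
      · have : 0 < (1 - x) ^ 2 := by have : 0 < 1 - x := by linarith
                                     positivity
        nlinarith
      · nlinarith)
    have hG := analyticAt_tsum_pow (summable_norm_acoef hD hg n
      ((norm_nonneg _).trans_lt hr1) (by linarith)) hr1
    have hC : AnalyticAt ℂ (fun w : ℂ => (1 + w) ^ (-(g + n)) *
        ∑' k : ℕ, acoef D g n k * (w * ((1 + w) ^ 2)⁻¹) ^ k) (x : ℂ) := by
      refine AnalyticAt.mul ?_ ?_
      · refine AnalyticAt.cpow (by fun_prop) analyticAt_const ?_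
        left
        simpa using h1
      · refine AnalyticAt.comp (g := fun w => ∑' k, acoef D g n k * w ^ k)
          (f := fun w : ℂ => w * ((1 + w) ^ 2)⁻¹) hG ?_
        exact analyticAt_id.mul (AnalyticAt.inv (by fun_prop) (pow_ne_zero _ h1'))
    exact AnalyticAt.comp (g := fun w : ℂ => (1 + w) ^ (-(g + n)) *
        ∑' k : ℕ, acoef D g n k * (w * ((1 + w) ^ 2)⁻¹) ^ k) (f := fun x : ℝ => (x : ℂ))
        hC.restrictScalars (ofRealCLM.analyticAt x)
  have hB : AnalyticOnNhd ℝ (fun x : ℝ => ∑' m : ℕ, ccoef D g n m * (x : ℂ) ^ m)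
      (Set.Ioo (-(1 / 8)) 1) := by
    intro x hx
    have : ‖(x : ℂ)‖ < 1 := by
      rw [norm_real, Real.norm_eq_abs, abs_lt]; exact ⟨by linarith [hx.1], hx.2⟩
    obtain ⟨r, hr1, hr2⟩ := exists_between this
    have hC := analyticAt_tsum_pow (hc r ((norm_nonneg _).trans_lt hr1) hr2) hr1
    exact AnalyticAt.comp (g := fun w : ℂ => ∑' m : ℕ, ccoef D g n m * w ^ m)
      (f := fun x : ℝ => (x : ℂ)) hC.restrictScalars (ofRealCLM.analyticAt x)
  refine hA.eqOn_of_preconnected_of_eventuallyEq hB isPreconnected_Ioo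
    (z₀ := 0) ⟨by norm_num, by norm_num⟩ ?_ hx
  filter_upwards [Ioo_mem_nhds (show -(1 / 8 : ℝ) < 0 by norm_num)
    (show (0 : ℝ) < 1 / 8 by norm_num)] with y hy
  rw [← hfac y ⟨hy.1, by linarith [hy.2]⟩]
  refine tsum_acoef_of_norm_le hD hg n ?_
  rw [norm_real, Real.norm_eq_abs, abs_le]
  exact ⟨hy.1.le, hy.2.le⟩

lemma two_mul_cosh_eq (s : ℝ) :
    2 * Real.cosh s = Real.exp |s| * (1 + Real.exp (-(2 * |s|))) := by
  rw [mul_add, ← Real.exp_add, ← Real.cosh_abs, Real.cosh_eq]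
  ring_nf

lemma summable_acoef_cosh {D g : ℂ} (hD : 0 < D.re) (hg : 0 < g.re) (n : ℕ) {s : ℝ}
    (hs : s ≠ 0) : Summable fun k : ℕ =>
      ‖acoef D g n k * ((2 * Real.cosh s : ℝ) : ℂ) ^ (-(g + n + 2 * k))‖ := by
  have h1 := Real.one_lt_cosh.2 hs
  have h2 : ((2 * Real.cosh s : ℝ) : ℂ) ≠ 0 := by
    have : 2 * Real.cosh s ≠ 0 := by positivity
    exact_mod_cast this
  have h := (summable_norm_acoef hD hg n (r := ((2 * Real.cosh s) ^ 2)⁻¹) (by positivity) (by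
    rw [← div_eq_mul_inv, div_lt_one (by positivity)]; nlinarith)).mul_left
    ‖((2 * Real.cosh s : ℝ) : ℂ) ^ (-(g + n))‖
  refine h.congr fun k => ?_
  rw [cpow_neg_add_two_mul h2, norm_mul, norm_mul, norm_pow, norm_inv, norm_pow, norm_real,
    Real.norm_of_nonneg (by positivity : 0 ≤ 2 * Real.cosh s)]
  ring

lemma hasSum_acoef_cosh {D g : ℂ} (hD : 0 < D.re) (n : ℕ) (hg : Admissible D g) {s : ℝ}
    (hs : s ≠ 0) :
    HasSum (fun k : ℕ => acoef D g n k * ((2 * Real.cosh s : ℝ) : ℂ) ^ (-(g + n + 2 * k)))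
      (radial D g n s) := by
  have hS := (summable_acoef_cosh hD hg.re_pos n hs).of_norm
  convert! hS.hasSum using 1
  set x : ℝ := Real.exp (-(2 * |s|)) with hx
  have hs' : 0 < |s| := abs_pos.2 hs
  have hx1 : x < 1 := by rw [hx, Real.exp_lt_one_iff]; linarith
  have hx0 : 0 < x := Real.exp_pos _
  have hxk : ∀ k : ℕ, cexp (-(g + n + 2 * k) * |s|) = cexp (-(g + n) * |s|) * (x : ℂ) ^ k := by
    intro k
    rw [hx, ofReal_exp, ← Complex.exp_nat_mul, ← Complex.exp_add]
    congr 1; push_cast; ring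
  have hc : ∀ r : ℝ, 0 < r → r < 1 → Summable fun k => ‖ccoef D g n k‖ * r ^ k := by
    intro r hr hr1
    have hl : Real.log r < 0 := Real.log_neg hr hr1
    have h := summable_radial n hg (s := -Real.log r / 2) (by linarith)
    have ha : |(-Real.log r / 2)| = -Real.log r / 2 := abs_of_pos (by linarith)
    refine (h.mul_left (Real.exp (-(g.re + n) * (Real.log r / 2)))).congr fun k => ?_
    rw [norm_mul, norm_exp, ha]
    have e : ((-(g + n + 2 * k) * ((-Real.log r / 2 : ℝ) : ℂ))).re =
      (g.re + n) * (Real.log r / 2) + k * Real.log r := by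
        rw [re_mul_ofReal]; simp; ring
    rw [e, Real.exp_add, Real.exp_nat_mul, Real.exp_log hr]
    have : Real.exp (-(g.re + n) * (Real.log r / 2)) * Real.exp ((g.re + n) * (Real.log r / 2)) = 1 := by
      rw [← Real.exp_add, ← Real.exp_zero]; congr 1; ring
    linear_combination (‖ccoef D g n k‖ * r ^ k) * this
  have key := tsum_acoef_eq hD hg.re_pos n hc (x := x) ⟨by linarith, hx1⟩
  have hL : radial D g n s = cexp (-(g + n) * |s|) * ∑' m : ℕ, ccoef D g n m * (x : ℂ) ^ m := by
    rw [radial, ← tsum_mul_left]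
    exact tsum_congr fun k => by rw [hxk]; ring
  rw [hL, ← key, ← tsum_mul_left]
  refine tsum_congr fun k => ?_
  rw [two_mul_cosh_eq, ofReal_mul, mul_cpow_ofReal_nonneg (Real.exp_nonneg _) (by positivity),
    cpow_def_of_ne_zero (x := ((Real.exp |s| : ℝ) : ℂ))
    (by exact_mod_cast (Real.exp_pos |s|).ne'), ← ofReal_log
    (Real.exp_nonneg _), Real.log_exp, mul_comm ((|s| : ℝ) : ℂ), hxk, ← hx]
  push_cast
  ring

end Quadratic

section ZonalMoments

/-- The moments of the normalised zonal functions, in half-dimension `D`. -/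
noncomputable def zmom (D : ℝ) (i n : ℕ) : ℝ :=
  if n ≤ i ∧ Even (i - n) then
    i.factorial / (2 ^ i * ((i - n) / 2).factorial * poch D ((i + n) / 2)) else 0

/-- The multiplicities of the zonal functions. -/
noncomputable def zdim (D : ℝ) (n : ℕ) : ℝ :=
  (n + (D - 1)) * poch (2 * (D - 1)) n / ((D - 1) * n.factorial)

lemma zmom_add_two_mul (D : ℝ) (n k : ℕ) :
    zmom D (n + 2 * k) n = (n + 2 * k).factorial / (2 ^ (n + 2 * k) * k.factorial *
      poch D (n + k)) := by
  rw [zmom, if_pos ⟨by omega, by simp⟩]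
  rw [show (n + 2 * k - n) / 2 = k by omega, show (n + 2 * k + n) / 2 = n + k by omega]

lemma zmom_eq_zero (D : ℝ) {i n : ℕ} (h : ∀ k, i ≠ n + 2 * k) : zmom D i n = 0 := by
  rw [zmom, if_neg]
  rintro ⟨h1, k, hk⟩
  exact h k (by omega)

lemma zmom_of_lt (D : ℝ) {i n : ℕ} (h : i < n) : zmom D i n = 0 :=
  zmom_eq_zero D fun k hk => by omega

lemma zmom_nonneg {D : ℝ} (hD : 0 < D) (i n : ℕ) : 0 ≤ zmom D i n := by
  rw [zmom]
  split_ifs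
  · have := poch_pos hD ((i + n) / 2)
    positivity
  · rfl

lemma zmom_zero_zero (D : ℝ) : zmom D 0 0 = 1 := by simp [zmom]

lemma zmom_succ_succ {D : ℝ} (hD : 0 < D) (i n : ℕ) :
    (i + 1) * zmom D i n = (i + n + 2 * D) * zmom D (i + 1) (n + 1) := by
  by_cases h : ∃ k, i = n + 2 * k
  · obtain ⟨k, rfl⟩ := h
    rw [show n + 2 * k + 1 = (n + 1) + 2 * k by ring, zmom_add_two_mul, zmom_add_two_mul,
      show n + 1 + 2 * k = n + 2 * k + 1 by ring, Nat.factorial_succ, pow_succ,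
      show n + 1 + k = n + k + 1 by ring, poch_succ]
    have h1 := poch_pos hD (n + k)
    have h2 : 0 < D + (n + k : ℕ) := by positivity
    push_cast at h2 ⊢
    have h3 : (D + n + k) ≠ 0 := by linarith
    field_simp
    ring
  · push Not at h
    rw [zmom_eq_zero D h, zmom_eq_zero D (fun k hk => h k (by omega))]
    simp

lemma zmom_succ_right {D : ℝ} (hD : 0 < D) (i n : ℕ) :
    (i + 1) * zmom D i (n + 1) = (i + 1 - n) * zmom D (i + 1) n := by
  by_cases h : ∃ k, i = (n + 1) + 2 * k
  · obtain ⟨k, rfl⟩ := h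
    rw [show n + 1 + 2 * k + 1 = n + 2 * (k + 1) by ring, zmom_add_two_mul, zmom_add_two_mul,
      show n + 2 * (k + 1) = n + 1 + 2 * k + 1 by ring, Nat.factorial_succ (n + 1 + 2 * k), pow_succ,
      Nat.factorial_succ k, show n + (k + 1) = n + 1 + k by ring]
    have h1 := poch_pos hD (n + 1 + k)
    push_cast
    field_simp
    ring
  · push Not at h
    rw [zmom_eq_zero D h]
    by_cases h' : i + 1 = n
    · rw [← h']; simp
    · rw [zmom_eq_zero D (fun k hk => ?_)]
      · simp
      · rcases k with _ | k
        · omega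
        · exact h k (by omega)

lemma zmom_add_two {D : ℝ} (hD : 0 < D) (i n : ℕ) :
    (i + 2) * (i + 1) * zmom D i n = (i + 2 - n) * (i + n + 2 * D) * zmom D (i + 2) n := by
  have h1 := zmom_succ_succ hD i n
  have h2 := zmom_succ_right hD (i + 1) n
  push_cast at h2
  linear_combination (i + 2 : ℝ) * h1 + (i + n + 2 * D) * h2

lemma zdim_zero {D : ℝ} (hD : 1 < D) : zdim D 0 = 1 := by
  have : D - 1 ≠ 0 := by linarith
  simp [zdim, this]

lemma zdim_nonneg {D : ℝ} (hD : 1 < D) (n : ℕ) : 0 ≤ zdim D n := by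
  have h : 0 < D - 1 := by linarith
  have := poch_pos (x := 2 * (D - 1)) (by linarith) n
  unfold zdim; positivity

/-- The recurrence coefficients of the zonal functions. -/
lemma zdim_succ {D : ℝ} (hD : 1 < D) (n : ℕ) :
    zdim D (n + 1) * ((n + 1) / (n + 1 + (D - 1))) =
      zdim D n * ((n + 2 * (D - 1)) / (n + (D - 1))) := by
  have h : 0 < D - 1 := by linarith
  rw [zdim, zdim, poch_succ, Nat.factorial_succ]
  push_cast
  have h1 : (n + 1 + (D - 1)) ≠ 0 := by positivity
  have h2 : (n + (D - 1)) ≠ 0 := by positivity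
  field_simp
  ring

lemma zmom_recurrence {D : ℝ} (hD : 1 < D) (i n : ℕ) :
    zmom D (i + 1) n = (n + 2 * (D - 1)) / (2 * (n + (D - 1))) * zmom D i (n + 1) +
      n / (2 * (n + (D - 1))) * zmom D i (n - 1) := by
  have h : 0 < D - 1 := by linarith
  have h2 : (n + (D - 1)) ≠ 0 := by positivity
  have hi : (i + 1 : ℝ) ≠ 0 := by positivity
  have e1 := zmom_succ_right (by linarith : 0 < D) i n
  have e2 : (n : ℝ) * ((i + 1) * zmom D i (n - 1)) =
      n * ((i + 1 + n + 2 * (D - 1)) * zmom D (i + 1) n) := by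
    rcases n with _ | n
    · simp
    · have := zmom_succ_succ (by linarith : 0 < D) i n
      simp only [Nat.add_sub_cancel]
      rw [this]; push_cast; ring
  apply mul_left_cancel₀ hi
  calc _ = (n + 2 * (D - 1)) / (2 * (n + (D - 1))) * ((i + 1 - n) * zmom D (i + 1) n) +
        n * ((i + 1 + n + 2 * (D - 1)) * zmom D (i + 1) n) / (2 * (n + (D - 1))) := by
        field_simp; ring
    _ = _ := by rw [← e1, ← e2]; ring

/-- The product of zonal moments satisfies the recurrence of the two-point moments. -/
lemma zmom_mul_recurrence {D : ℝ} (hD : 1 < D) (i j n : ℕ) :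
    (2 * D + i + j - 1) * (zmom D (i + 1) n * zmom D j n) =
      i * (zmom D (i - 1) n * zmom D j n) +
      j * ((n + 2 * (D - 1)) / (2 * (n + (D - 1))) * (zmom D i (n + 1) * zmom D (j - 1) (n + 1)) +
        n / (2 * (n + (D - 1))) * (zmom D i (n - 1) * zmom D (j - 1) (n - 1))) := by
  have h : 0 < D - 1 := by linarith
  have h0 : 0 < D := by linarith
  have h2 : (n + (D - 1)) ≠ 0 := by positivity
  have hi : (i + 1 : ℝ) ≠ 0 := by positivity
  have a1 : (i + 1) * (i : ℝ) * zmom D (i - 1) n =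
      (i + 1 - n) * (i + n + 2 * D - 1) * zmom D (i + 1) n := by
    rcases i with _ | i
    · rcases n with _ | n
      · rw [zmom_eq_zero D (i := 0 + 1) (n := 0) (fun k hk => by omega)]; simp
      · rcases n with _ | n
        · simp
        · rw [zmom_of_lt D (by omega : 0 + 1 < n + 1 + 1)]; simp
    · have := zmom_add_two h0 i n
      simp only [Nat.add_sub_cancel]
      push_cast
      linear_combination this
  have a2 := zmom_succ_right h0 i n
  have a3 : (n : ℝ) * ((i + 1) * zmom D i (n - 1)) =
      n * ((i + 1 + n + 2 * (D - 1)) * zmom D (i + 1) n) := by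
    rcases n with _ | n
    · simp
    · have := zmom_succ_succ h0 i n
      simp only [Nat.add_sub_cancel]
      rw [this]; push_cast; ring
  have b2 : (j : ℝ) * zmom D (j - 1) (n + 1) = (j - n) * zmom D j n := by
    rcases j with _ | j
    · rcases n with _ | n
      · simp
      · rw [zmom_of_lt D (by omega : 0 < n + 1)]; simp
    · have := zmom_succ_right h0 j n
      simp only [Nat.add_sub_cancel]
      push_cast
      linear_combination this
  have b3 : (n : ℝ) * (j * zmom D (j - 1) (n - 1)) =
      n * ((j + n + 2 * (D - 1)) * zmom D j n) := by
    rcases n with _ | n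
    · simp
    · rcases j with _ | j
      · rw [zmom_of_lt D (by omega : 0 < n + 1)]; simp
      · have := zmom_succ_succ h0 j n
        simp only [Nat.add_sub_cancel]
        push_cast
        linear_combination ((n : ℝ) + 1) * this
  have c3 : n * ((i + 1) * zmom D i (n - 1)) * (j * zmom D (j - 1) (n - 1)) =
      n * ((i + 1 + n + 2 * (D - 1)) * zmom D (i + 1) n) * ((j + n + 2 * (D - 1)) * zmom D j n) := by
    by_cases hn : (n : ℝ) = 0
    · simp [hn]
    · rw [mul_left_cancel₀ hn a3, mul_left_cancel₀ hn b3]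
  apply mul_left_cancel₀ hi
  calc _ = ((i + 1 - n) * (i + n + 2 * D - 1) * zmom D (i + 1) n) * zmom D j n +
        (n + 2 * (D - 1)) / (2 * (n + (D - 1))) * (((i + 1 - n) * zmom D (i + 1) n) *
          ((j - n) * zmom D j n)) + 1 / (2 * (n + (D - 1))) *
        (n * ((i + 1 + n + 2 * (D - 1)) * zmom D (i + 1) n) *
          ((j + n + 2 * (D - 1)) * zmom D j n)) := by field_simp; ring
    _ = _ := by rw [← a1, ← a2, ← b2, ← c3]; ring

/-- Summation by parts against the zonal multiplicities. -/
lemma sum_zdim_shift {D : ℝ} (hD : 1 < D) {a b : ℕ → ℝ} {N : ℕ} (ha : ∀ n, N ≤ n → a n = 0) :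
    ∑ n ∈ Finset.range (N + 1), zdim D n * (((n + 2 * (D - 1)) / (2 * (n + (D - 1))) * a (n + 1) +
        n / (2 * (n + (D - 1))) * a (n - 1)) * b n) =
      ∑ n ∈ Finset.range (N + 1), zdim D n * (a n * ((n + 2 * (D - 1)) / (2 * (n + (D - 1))) *
        b (n + 1) + n / (2 * (n + (D - 1))) * b (n - 1))) := by
  have hshift : ∀ p q : ℕ → ℝ, p N * q (N + 1) = 0 → p (N + 1) * q N = 0 →
      ∑ n ∈ Finset.range (N + 1), zdim D n * ((n + 2 * (D - 1)) / (2 * (n + (D - 1)))) *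
        (p n * q (n + 1)) =
      ∑ n ∈ Finset.range (N + 1), zdim D n * (n / (2 * (n + (D - 1)))) * (p (n - 1) * q n) := by
    intro p q h1 h2
    rw [Finset.sum_range_succ, h1, Finset.sum_range_succ' _ N]
    simp only [mul_zero, add_zero, Nat.cast_zero, zero_div, zero_mul]
    refine Finset.sum_congr rfl fun n _ => ?_
    have := zdim_succ hD n
    rw [Nat.add_sub_cancel]
    push_cast
    have e1 : zdim D n * ((n + 2 * (D - 1)) / (2 * (n + (D - 1)))) =
      zdim D n * ((n + 2 * (D - 1)) / (n + (D - 1))) / 2 := by rw [← mul_div_assoc, ← mul_div_assoc, div_div]; ring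
    have e2 : zdim D (n + 1) * ((n + 1) / (2 * (n + 1 + (D - 1)))) =
      zdim D (n + 1) * ((n + 1) / (n + 1 + (D - 1))) / 2 := by
        rw [← mul_div_assoc, ← mul_div_assoc, div_div]; ring
    rw [e1, e2, this]
  have h1 := hshift b a (by simp [ha]) (by simp [ha])
  have h2 := hshift a b (by simp [ha]) (by simp [ha])
  calc _ = ∑ n ∈ Finset.range (N + 1), zdim D n * ((n + 2 * (D - 1)) / (2 * (n + (D - 1)))) *
        (b n * a (n + 1)) + ∑ n ∈ Finset.range (N + 1), zdim D n * (n / (2 * (n + (D - 1)))) *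
          (a (n - 1) * b n) := by
        rw [← Finset.sum_add_distrib]; exact Finset.sum_congr rfl fun n _ => by ring
    _ = ∑ n ∈ Finset.range (N + 1), zdim D n * ((n + 2 * (D - 1)) / (2 * (n + (D - 1)))) *
        (a n * b (n + 1)) + ∑ n ∈ Finset.range (N + 1), zdim D n * (n / (2 * (n + (D - 1)))) *
          (b (n - 1) * a n) := by rw [h1, h2, add_comm]
    _ = _ := by
        rw [← Finset.sum_add_distrib]; exact Finset.sum_congr rfl fun n _ => by ring

/-- A function satisfying the recurrence of the three-point moments is given by zonal moments. -/
lemma three_point_eq {D : ℝ} (hD : 1 < D) {T : ℕ → ℕ → ℕ → ℝ}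
    (h0 : ∀ j l, T 0 j l = zmom D j 0 * zmom D l 0)
    (hrec : ∀ i j l, (2 * D + i + j - 1) * T (i + 1) j l =
      i * T (i - 1) j l + j * T i (j - 1) (l + 1)) (i : ℕ) :
    ∀ j l N, i ≤ N → T i j l =
      ∑ n ∈ Finset.range (N + 1), zdim D n * (zmom D i n * zmom D j n * zmom D l n) := by
  induction i using Nat.strong_induction_on with
  | _ i ih =>
    intro j l N hN
    rcases i with _ | i
    · rw [h0, Finset.sum_range_succ', Finset.sum_eq_zero, zdim_zero hD, zmom_zero_zero]
      · simp
      · intro n _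
        rw [zmom_of_lt D (by omega : 0 < n + 1)]; simp
    · have hc : (2 * D + i + j - 1) ≠ 0 := by
        have : 0 ≤ (i : ℝ) + j := by positivity
        intro h; linarith
      apply mul_left_cancel₀ hc
      rw [hrec, ih i (by omega) (j - 1) (l + 1) N (by omega)]
      have e1 : (i : ℝ) * T (i - 1) j l = i * ∑ n ∈ Finset.range (N + 1),
          zdim D n * (zmom D (i - 1) n * zmom D j n * zmom D l n) := by
        rcases i with _ | i
        · simp
        · rw [ih (i + 1 - 1) (by omega) j l N (by omega)]
      have e2 := sum_zdim_shift hD (a := fun n => zmom D i n * zmom D (j - 1) n)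
        (b := fun n => zmom D l n) (N := N) (fun n hn => by
          simp only [zmom_of_lt D (by omega : i < n), zero_mul])
      simp only [← zmom_recurrence hD] at e2
      rw [e1, ← e2, Finset.mul_sum, Finset.mul_sum, Finset.mul_sum, ← Finset.sum_add_distrib]
      refine Finset.sum_congr rfl fun n _ => ?_
      linear_combination -(zdim D n * zmom D l n) * zmom_mul_recurrence hD i j n

end ZonalMoments

section Polar

open Metric Set Measure

/-- The measure on the line corresponding to `r ^ (d - 1) dr` in the coordinate `log r`. -/
noncomputable def expMeasure (d : ℕ) : Measure ℝ :=
  volume.withDensity fun s => ENNReal.ofReal (Real.exp (d * s))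

instance (d : ℕ) : SFinite (expMeasure d) := by unfold expMeasure; infer_instance

lemma measurePreserving_expOrderIso {d : ℕ} (hd : d ≠ 0) :
    MeasurePreserving Real.expOrderIso (expMeasure d) (volumeIoiPow (d - 1)) := by
  have hm : Measurable Real.expOrderIso := Real.continuous_exp.measurable.subtype_mk
  refine ⟨hm, ?_⟩
  ext A hA
  rw [Measure.map_apply hm hA, expMeasure, withDensity_apply _ (hm hA), volumeIoiPow,
    withDensity_apply _ hA, setLIntegral_subtype measurableSet_Ioi _
      fun a : ℝ ↦ ENNReal.ofReal (a ^ (d - 1))]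
  have himg : Subtype.val '' A = Real.exp '' (Real.expOrderIso ⁻¹' A) := by
    ext r
    constructor
    · rintro ⟨a, ha, rfl⟩
      exact ⟨Real.expOrderIso.symm a, by simpa using ha, by
        rw [← Real.coe_expOrderIso_apply, OrderIso.apply_symm_apply]⟩
    · rintro ⟨s, hs, rfl⟩
      exact ⟨Real.expOrderIso s, hs, Real.coe_expOrderIso_apply s⟩
  rw [himg, lintegral_image_eq_lintegral_abs_deriv_mul (hm hA)
    (fun x _ => (Real.hasDerivAt_exp x).hasDerivWithinAt) Real.exp_injective.injOn]
  refine lintegral_congr fun s => ?_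
  rw [← ENNReal.ofReal_mul (abs_nonneg _), abs_of_pos (Real.exp_pos _), ← pow_succ',
    Nat.sub_add_cancel (Nat.pos_of_ne_zero hd), Real.exp_nat_mul]

variable {E : Type*} [NormedAddCommGroup E] [NormedSpace ℝ E] [FiniteDimensional ℝ E]
  [MeasurableSpace E] [BorelSpace E]

/-- Exponential polar coordinates. -/
lemma measurePreserving_polar [Nontrivial E] (μ : Measure E) [μ.IsAddHaarMeasure] :
    MeasurePreserving (fun p : sphere (0 : E) 1 × ℝ => Real.exp p.2 • (p.1 : E))
      (μ.toSphere.prod (expMeasure (Module.finrank ℝ E))) μ := by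
  have h1 := (MeasurePreserving.id μ.toSphere).prod
    (measurePreserving_expOrderIso (Module.finrank_pos (R := ℝ) (M := E)).ne')
  have h2 : MeasurePreserving (homeomorphUnitSphereProd E).symm
      (μ.toSphere.prod (volumeIoiPow (Module.finrank ℝ E - 1))) (μ.comap (↑)) :=
    MeasurePreserving.symm (homeomorphUnitSphereProd E).toMeasurableEquiv
      μ.measurePreserving_homeomorphUnitSphereProd
  have h3 : MeasurePreserving (Subtype.val : ({(0 : E)}ᶜ : Set E) → E) (μ.comap (↑)) μ := by
    have := measurePreserving_subtype_coe (μa := μ) (measurableSet_singleton (0 : E)).compl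
    rwa [restrict_compl_singleton] at this
  exact h3.comp (h2.comp h1)

lemma measurableEmbedding_polar :
    MeasurableEmbedding (fun p : sphere (0 : E) 1 × ℝ => Real.exp p.2 • (p.1 : E)) := by
  have h1 : MeasurableEmbedding (Prod.map (id : sphere (0 : E) 1 → sphere (0 : E) 1)
      Real.expOrderIso) :=
    MeasurableEmbedding.id.prodMap Real.expOrderIso.toHomeomorph.measurableEmbedding
  have := (MeasurableEmbedding.subtype_coe (measurableSet_singleton (0 : E)).compl).comp
    ((homeomorphUnitSphereProd E).symm.measurableEmbedding.comp h1)
  exact this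

end Polar

section Gaussian

open Metric Set Measure

variable {E : Type*} [NormedAddCommGroup E] [InnerProductSpace ℝ E] [FiniteDimensional ℝ E]
  [MeasurableSpace E] [BorelSpace E] [Nontrivial E] (μ : Measure E) [μ.IsAddHaarMeasure]

lemma integrable_norm_pow_mul_exp_neg (p : ℕ) :
    Integrable (fun x : E => ‖x‖ ^ p * Real.exp (-‖x‖ ^ 2)) μ := by
  have h := integrable_fun_norm_addHaar μ (f := fun r : ℝ => r ^ p * Real.exp (-r ^ 2))
  rw [h]
  have h2 := integrableOn_rpow_mul_exp_neg_rpow (s := ((Module.finrank ℝ E - 1 + p : ℕ) : ℝ))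
    (p := 2) (lt_of_lt_of_le (by norm_num) (Nat.cast_nonneg _)) (by norm_num)
  refine h2.congr_fun (fun r hr => ?_) measurableSet_Ioi
  simp only [Real.rpow_natCast, smul_eq_mul, pow_add]
  rw [show ((2 : ℝ)) = ((2 : ℕ) : ℝ) by norm_num, Real.rpow_natCast]
  ring

lemma integrable_inner_pow_mul_exp_neg {b c : E} (hb : ‖b‖ = 1) (hc : ‖c‖ = 1) (i j : ℕ) :
    Integrable (fun x : E => (inner ℝ b x ^ i * inner ℝ c x ^ j) * Real.exp (-‖x‖ ^ 2)) μ := by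
  refine (integrable_norm_pow_mul_exp_neg μ (i + j)).mono' (by fun_prop) (ae_of_all _ fun x => ?_)
  have h1 : |inner ℝ b x| ≤ ‖x‖ := by simpa [hb] using abs_real_inner_le_norm b x
  have h2 : |inner ℝ c x| ≤ ‖x‖ := by simpa [hc] using abs_real_inner_le_norm c x
  rw [norm_mul, norm_mul, norm_pow, norm_pow, Real.norm_eq_abs, Real.norm_eq_abs,
    Real.norm_of_nonneg (Real.exp_pos _).le, pow_add]
  gcongr

/-- Integration by parts for Gaussian moments. -/
lemma gaussian_moment_recurrence {b c : E} (hb : ‖b‖ = 1) (hc : ‖c‖ = 1) (i j : ℕ) :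
    2 * ∫ x : E, (inner ℝ b x ^ (i + 1) * inner ℝ c x ^ j) * Real.exp (-‖x‖ ^ 2) ∂μ =
      i * ∫ x : E, (inner ℝ b x ^ (i - 1) * inner ℝ c x ^ j) * Real.exp (-‖x‖ ^ 2) ∂μ +
      j * (inner ℝ b c * ∫ x : E, (inner ℝ b x ^ i * inner ℝ c x ^ (j - 1)) *
        Real.exp (-‖x‖ ^ 2) ∂μ) := by
  have hI := fun i j => integrable_inner_pow_mul_exp_neg μ hb hc i j
  have key := integral_bilinear_hasLineDerivAt_right_eq_neg_left_of_integrable (μ := μ) (v := b)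
    (f := fun x : E => inner ℝ b x ^ i * inner ℝ c x ^ j)
    (f' := fun x => i * (inner ℝ b x ^ (i - 1) * inner ℝ c x ^ j) +
      j * (inner ℝ b c * (inner ℝ b x ^ i * inner ℝ c x ^ (j - 1))))
    (g := fun x => Real.exp (-‖x‖ ^ 2)) (g' := fun x => Real.exp (-‖x‖ ^ 2) * (-(2 * inner ℝ b x)))
    (B := ContinuousLinearMap.mul ℝ ℝ) ?_ ?_ ?_ ?_ ?_
  · simp only [ContinuousLinearMap.mul_apply'] at key
    rw [← integral_const_mul, ← integral_const_mul, ← integral_const_mul, ← integral_const_mul,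
      ← integral_add ((hI _ _).const_mul _) (((hI _ _).const_mul _).const_mul _)]
    rw [← neg_eq_iff_eq_neg, ← integral_neg] at key
    refine Eq.trans (integral_congr_ae (ae_of_all _ fun x => ?_)) (key.trans
      (integral_congr_ae (ae_of_all _ fun x => ?_))) <;> simp only <;> ring
  · simp only [ContinuousLinearMap.mul_apply']
    refine (((hI (i - 1) j).const_mul (i : ℝ)).add
      (((hI i (j - 1)).const_mul (inner ℝ b c)).const_mul (j : ℝ))).congr (ae_of_all _ fun x => ?_)
    simp only [Pi.add_apply]; ring
  · simp only [ContinuousLinearMap.mul_apply']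
    refine ((hI (i + 1) j).const_mul (-2)).congr (ae_of_all _ fun x => ?_)
    simp only; ring
  · exact hI i j
  · intro x _
    have h1 : ∀ a : E, HasDerivAt (fun t : ℝ => inner ℝ a (x + t • b)) (inner ℝ a b) 0 := by
      intro a
      simp only [inner_add_right, inner_smul_right]
      simpa using ((hasDerivAt_id (0 : ℝ)).mul_const (inner ℝ a b)).const_add (inner ℝ a x)
    have h2 := ((h1 b).pow i).mul ((h1 c).pow j)
    refine h2.congr_deriv ?_
    simp only [zero_smul, add_zero, Pi.pow_apply, real_inner_self_eq_norm_sq, hb,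
      real_inner_comm b c]
    ring
  · intro x _
    have h1 : HasDerivAt (fun t : ℝ => -‖x + t • b‖ ^ 2) (-(2 * inner ℝ b x)) 0 := by
      have : ∀ t : ℝ, -‖x + t • b‖ ^ 2 = -(‖x‖ ^ 2 + t * (2 * inner ℝ b x) + t ^ 2) := by
        intro t
        rw [norm_add_sq_real, inner_smul_right, norm_smul, hb, real_inner_comm,
          mul_one, Real.norm_eq_abs, sq_abs]
        ring
      simp only [this]
      have h2 := ((((hasDerivAt_id (0 : ℝ)).mul_const (2 * inner ℝ b x)).const_add
        (‖x‖ ^ 2)).add ((hasDerivAt_id (0 : ℝ)).pow 2)).neg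
      refine h2.congr_deriv ?_
      simp
    have h3 := h1.exp
    refine h3.congr_deriv ?_
    simp

lemma integral_exp_radial {p q : ℕ} :
    ∫ s, Real.exp s ^ p * Real.exp (-Real.exp s ^ 2) ∂(expMeasure q) =
      ∫ s : ℝ, Real.exp s ^ (q + p) * Real.exp (-Real.exp s ^ 2) := by
  rw [expMeasure, integral_withDensity_eq_integral_toReal_smul (by fun_prop) (by simp)]
  refine integral_congr_ae (ae_of_all _ fun s => ?_)
  simp only [ENNReal.toReal_ofReal (Real.exp_pos _).le, smul_eq_mul]
  rw [pow_add, Real.exp_nat_mul]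
  ring

lemma integrable_exp_radial {q : ℕ} (hq : q ≠ 0) :
    Integrable fun s : ℝ => Real.exp s ^ q * Real.exp (-Real.exp s ^ 2) := by
  have h2 := integrableOn_rpow_mul_exp_neg_rpow (s := ((q - 1 : ℕ) : ℝ))
    (p := 2) (lt_of_lt_of_le (by norm_num) (Nat.cast_nonneg _)) (by norm_num)
  rw [← Real.range_exp, ← image_univ, integrableOn_image_iff_integrableOn_abs_deriv_smul
    MeasurableSet.univ (fun x _ => (Real.hasDerivAt_exp x).hasDerivWithinAt)
    Real.exp_injective.injOn, integrableOn_univ] at h2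
  refine h2.congr (ae_of_all _ fun s => ?_)
  simp only [Real.rpow_natCast, smul_eq_mul, abs_of_pos (Real.exp_pos _)]
  rw [show ((2 : ℝ)) = ((2 : ℕ) : ℝ) by norm_num, Real.rpow_natCast, ← mul_assoc, ← pow_succ',
    Nat.sub_add_cancel (Nat.pos_of_ne_zero hq)]

lemma integral_exp_radial_pos {q : ℕ} (hq : q ≠ 0) :
    0 < ∫ s : ℝ, Real.exp s ^ q * Real.exp (-Real.exp s ^ 2) := by
  rw [integral_pos_iff_support_of_nonneg (fun s => by positivity) (integrable_exp_radial hq)]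
  have : Function.support (fun s : ℝ => Real.exp s ^ q * Real.exp (-Real.exp s ^ 2)) = univ := by
    ext s; simp
  simp [this]

lemma integral_exp_radial_add_two {q : ℕ} (hq : q ≠ 0) :
    2 * ∫ s : ℝ, Real.exp s ^ (q + 2) * Real.exp (-Real.exp s ^ 2) =
      q * ∫ s : ℝ, Real.exp s ^ q * Real.exp (-Real.exp s ^ 2) := by
  have h1 := integrable_exp_radial hq
  have h2 := integrable_exp_radial (q := q + 2) (by omega)
  have key := integral_eq_zero_of_hasDerivAt_of_integrable
    (f := fun s : ℝ => Real.exp s ^ q * Real.exp (-Real.exp s ^ 2))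
    (f' := fun s => q * (Real.exp s ^ q * Real.exp (-Real.exp s ^ 2)) -
      2 * (Real.exp s ^ (q + 2) * Real.exp (-Real.exp s ^ 2))) ?_
      ((h1.const_mul _).sub (h2.const_mul _)) h1
  · rw [integral_sub (h1.const_mul _) (h2.const_mul _), integral_const_mul, integral_const_mul]
      at key
    linarith
  · intro s
    have h := ((Real.hasDerivAt_exp s).pow q).mul ((((Real.hasDerivAt_exp s).pow 2).neg).exp)
    refine h.congr_deriv ?_
    obtain ⟨q, rfl⟩ := Nat.exists_eq_succ_of_ne_zero hq
    simp only [Pi.pow_apply, Pi.neg_apply, Nat.succ_eq_add_one, Nat.add_sub_cancel]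
    push_cast
    ring

lemma gaussian_moment_eq (b c : E) (i j : ℕ) :
    ∫ x : E, (inner ℝ b x ^ i * inner ℝ c x ^ j) * Real.exp (-‖x‖ ^ 2) ∂μ =
      (∫ ω : sphere (0 : E) 1, inner ℝ b (ω : E) ^ i * inner ℝ c (ω : E) ^ j ∂μ.toSphere) *
      ∫ s : ℝ, Real.exp s ^ (Module.finrank ℝ E + (i + j)) * Real.exp (-Real.exp s ^ 2) := by
  rw [← (measurePreserving_polar μ).integral_comp measurableEmbedding_polar,
    ← integral_exp_radial, ← integral_prod_mul]
  refine integral_congr_ae (ae_of_all _ fun p => ?_)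
  have hω : ‖(p.1 : E)‖ = 1 := by simp
  simp only [inner_smul_right, norm_smul, hω, Real.norm_eq_abs, abs_of_pos (Real.exp_pos _),
    mul_one]
  ring

/-- The recurrence for the mixed moments of two linear forms on the sphere. -/
lemma sphere_moment_recurrence {b c : E} (hb : ‖b‖ = 1) (hc : ‖c‖ = 1) (i j : ℕ) :
    ((Module.finrank ℝ E : ℝ) + i + j - 1) *
        ∫ ω : sphere (0 : E) 1, inner ℝ b (ω : E) ^ (i + 1) * inner ℝ c (ω : E) ^ j ∂μ.toSphere =
      i * ∫ ω : sphere (0 : E) 1, inner ℝ b (ω : E) ^ (i - 1) * inner ℝ c (ω : E) ^ j ∂μ.toSphere +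
      j * (inner ℝ b c *
        ∫ ω : sphere (0 : E) 1, inner ℝ b (ω : E) ^ i * inner ℝ c (ω : E) ^ (j - 1) ∂μ.toSphere) := by
  have hd : 0 < Module.finrank ℝ E := Module.finrank_pos
  have key := gaussian_moment_recurrence μ hb hc i j
  simp only [gaussian_moment_eq] at key
  set q := Module.finrank ℝ E + i + j - 1 with hq
  rcases Nat.eq_zero_or_pos (i + j) with h0 | h0
  · obtain ⟨rfl, rfl⟩ : i = 0 ∧ j = 0 := by omega
    have hp := integral_exp_radial_pos (q := Module.finrank ℝ E + (0 + 1 + 0)) (by omega)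
    simp only [Nat.cast_zero, zero_mul, add_zero] at key ⊢
    have : ∫ ω : sphere (0 : E) 1, inner ℝ b (ω : E) ^ (0 + 1) * inner ℝ c (ω : E) ^ 0 ∂μ.toSphere
      = 0 := by
      rcases mul_eq_zero.1 key with h | h
      · norm_num at h
      · exact (mul_eq_zero.1 h).resolve_right hp.ne'
    rw [this, mul_zero]
  · have hq0 : q ≠ 0 := by omega
    have hR := integral_exp_radial_add_two hq0
    have hp := integral_exp_radial_pos hq0
    have hqc : ((Module.finrank ℝ E : ℝ) + i + j - 1) = q := by
      rw [hq, Nat.cast_sub (by omega)]; push_cast; ring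
    rw [show Module.finrank ℝ E + (i + 1 + j) = q + 2 by omega] at key
    apply mul_right_cancel₀ hp.ne'
    rw [hqc]
    have e1 : ∀ x : ℝ, (i : ℝ) * (x * ∫ s : ℝ, Real.exp s ^ (Module.finrank ℝ E + (i - 1 + j)) *
        Real.exp (-Real.exp s ^ 2)) = i * (x * ∫ s : ℝ, Real.exp s ^ q *
        Real.exp (-Real.exp s ^ 2)) := by
      intro x
      rcases i with _ | i
      · simp
      · rw [show Module.finrank ℝ E + (i + 1 - 1 + j) = q by omega]
    have e2 : ∀ x : ℝ, (j : ℝ) * (inner ℝ b c * (x * ∫ s : ℝ, Real.exp s ^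
        (Module.finrank ℝ E + (i + (j - 1))) * Real.exp (-Real.exp s ^ 2))) =
        j * (inner ℝ b c * (x * ∫ s : ℝ, Real.exp s ^ q * Real.exp (-Real.exp s ^ 2))) := by
      intro x
      rcases j with _ | j
      · simp
      · rw [show Module.finrank ℝ E + (i + (j + 1 - 1)) = q by omega]
    rw [e1, e2] at key
    linear_combination key - (∫ ω : sphere (0 : E) 1, inner ℝ b (ω : E) ^ (i + 1) *
      inner ℝ c (ω : E) ^ j ∂μ.toSphere) * hR

end Gaussian

section SphereSeries

open Metric Set Measure

variable {E : Type*} [NormedAddCommGroup E] [InnerProductSpace ℝ E] [FiniteDimensional ℝ E]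
  [MeasurableSpace E] [BorelSpace E] [Nontrivial E] (μ : Measure E) [μ.IsAddHaarMeasure]

lemma abs_inner_sphere_le {E : Type*} [NormedAddCommGroup E] [InnerProductSpace ℝ E]
    (a b : sphere (0 : E) 1) : |inner ℝ (a : E) (b : E)| ≤ 1 := by
  simpa using abs_real_inner_le_norm (a : E) (b : E)

/-- The uniform probability measure on the unit sphere. -/
noncomputable def sphereProb {E : Type*} [NormedAddCommGroup E] [NormedSpace ℝ E]
    [MeasurableSpace E] (μ : Measure E) : Measure (sphere (0 : E) 1) :=
  (μ.toSphere univ)⁻¹ • μ.toSphere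

instance : IsProbabilityMeasure (sphereProb μ) := by
  have h0 : μ.toSphere univ ≠ 0 := by
    rw [Ne, measure_univ_eq_zero]; exact toSphere_ne_zero μ
  exact ⟨by simp only [sphereProb, Measure.smul_apply, smul_eq_mul]
            exact ENNReal.inv_mul_cancel h0 (measure_ne_top _ _)⟩

lemma sphereProb_moment_recurrence {b c : E} (hb : ‖b‖ = 1) (hc : ‖c‖ = 1) (i j : ℕ) :
    ((Module.finrank ℝ E : ℝ) + i + j - 1) *
        ∫ ω : sphere (0 : E) 1, inner ℝ b (ω : E) ^ (i + 1) * inner ℝ c (ω : E) ^ j ∂sphereProb μ =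
      i * ∫ ω : sphere (0 : E) 1, inner ℝ b (ω : E) ^ (i - 1) * inner ℝ c (ω : E) ^ j ∂sphereProb μ +
      j * (inner ℝ b c *
        ∫ ω : sphere (0 : E) 1, inner ℝ b (ω : E) ^ i * inner ℝ c (ω : E) ^ (j - 1) ∂sphereProb μ) := by
  simp only [sphereProb, integral_smul_measure, smul_eq_mul]
  linear_combination ((μ.toSphere univ)⁻¹).toReal * sphere_moment_recurrence μ hb hc i j

lemma integral_inner_pow {D : ℝ} (hD1 : 1 < D) (hD : 2 * D = Module.finrank ℝ E) (c : sphere (0 : E) 1) (i : ℕ) :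
    ∫ ω : sphere (0 : E) 1, inner ℝ (c : E) (ω : E) ^ i ∂sphereProb μ = zmom D i 0 := by
  have hd : (0 : ℝ) < Module.finrank ℝ E := by exact_mod_cast Module.finrank_pos
  have hc : ‖(c : E)‖ = 1 := by simp
  have hr := fun i => sphereProb_moment_recurrence μ hc hc (i + 1) 0
  simp only [pow_zero, mul_one, Nat.cast_zero, zero_mul, add_zero, Nat.add_sub_cancel,
    ← hD] at hr
  have h1 : ∫ ω : sphere (0 : E) 1, inner ℝ (c : E) (ω : E) ^ 1 ∂sphereProb μ = 0 := by
    have h := sphereProb_moment_recurrence μ hc hc 0 0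
    simp only [pow_zero, mul_one, Nat.cast_zero, zero_mul, add_zero, zero_add, ← hD] at h
    exact (mul_eq_zero.1 h).resolve_left (by linarith)
  induction i using Nat.strong_induction_on with
  | _ i ih =>
    rcases i with _ | _ | i
    · simp [zmom_zero_zero]
    · rw [zmom_eq_zero D (by omega), ← h1]
    · have e := zmom_add_two (D := D) (by linarith) i 0
      have h2 := hr i
      rw [ih i (by omega)] at h2
      have h3 : (0 : ℝ) < i + 2 * D := by have : (0 : ℝ) ≤ i := Nat.cast_nonneg i; linarith
      apply mul_left_cancel₀ h3.ne'
      push_cast at e h2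
      have h4 : (i : ℝ) + 2 ≠ 0 := by positivity
      apply mul_left_cancel₀ h4
      linear_combination (i + 2) * h2 + e

/-- The moments of three points on the sphere, one of them fixed. -/
noncomputable def tripleMoment (e : sphere (0 : E) 1) (i j l : ℕ) : ℝ :=
  ∫ p : sphere (0 : E) 1 × sphere (0 : E) 1, inner ℝ (e : E) (p.1 : E) ^ i *
    inner ℝ (p.2 : E) (p.1 : E) ^ j * inner ℝ (e : E) (p.2 : E) ^ l
    ∂(sphereProb μ).prod (sphereProb μ)

lemma integrable_of_continuous_sphere {f : sphere (0 : E) 1 → ℝ} (hf : Continuous f) :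
    Integrable f (sphereProb μ) :=
  hf.integrable_of_hasCompactSupport (HasCompactSupport.of_compactSpace f)

lemma integrable_of_continuous_sphere_prod {F : Type*} [NormedAddCommGroup F]
    {f : sphere (0 : E) 1 × sphere (0 : E) 1 → F} (hf : Continuous f) :
    Integrable f ((sphereProb μ).prod (sphereProb μ)) :=
  hf.integrable_of_hasCompactSupport (HasCompactSupport.of_compactSpace f)

lemma tripleMoment_eq_integral (e : sphere (0 : E) 1) (i j l : ℕ) :
    tripleMoment μ e i j l = ∫ η : sphere (0 : E) 1, inner ℝ (e : E) (η : E) ^ l *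
      ∫ ω : sphere (0 : E) 1, inner ℝ (e : E) (ω : E) ^ i *
        inner ℝ (η : E) (ω : E) ^ j ∂sphereProb μ ∂sphereProb μ := by
  rw [tripleMoment, integral_prod_symm _ (integrable_of_continuous_sphere_prod μ (by fun_prop))]
  refine integral_congr_ae (ae_of_all _ fun η => ?_)
  simp only
  rw [integral_mul_const, mul_comm]

lemma continuous_inner_moment (e : sphere (0 : E) 1) (i j l : ℕ) :
    Continuous fun η : sphere (0 : E) 1 => inner ℝ (e : E) (η : E) ^ l *
      ∫ ω : sphere (0 : E) 1, inner ℝ (e : E) (ω : E) ^ i *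
        inner ℝ (η : E) (ω : E) ^ j ∂sphereProb μ := by
  refine Continuous.mul (by fun_prop) ?_
  refine continuous_of_dominated (bound := fun _ => 1) (fun η => ?_) (fun η => ?_)
    (integrable_const _) ?_
  · exact (by fun_prop : Continuous _).aestronglyMeasurable
  · refine ae_of_all _ fun ω => ?_
    rw [norm_mul, norm_pow, norm_pow]
    exact mul_le_one₀ (pow_le_one₀ (abs_nonneg _) (abs_inner_sphere_le e ω)) (by positivity)
      (pow_le_one₀ (abs_nonneg _) (abs_inner_sphere_le η ω))
  · exact ae_of_all _ fun ω => by fun_prop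

lemma tripleMoment_eq {D : ℝ} (hD1 : 1 < D) (hD : 2 * D = Module.finrank ℝ E)
    (e : sphere (0 : E) 1) {i N : ℕ} (j l : ℕ) (hN : i ≤ N) :
    tripleMoment μ e i j l =
      ∑ n ∈ Finset.range (N + 1), zdim D n * (zmom D i n * zmom D j n * zmom D l n) := by
  refine three_point_eq hD1 (T := tripleMoment μ e) ?_ ?_ i j l N hN
  · intro j l
    rw [tripleMoment_eq_integral]
    simp only [pow_zero, one_mul, integral_inner_pow μ hD1 hD]
    rw [integral_mul_const, integral_inner_pow μ hD1 hD, mul_comm]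
  · intro i j l
    have hI := fun i j l => integrable_of_continuous_sphere μ (continuous_inner_moment μ e i j l)
    simp only [tripleMoment_eq_integral, hD]
    rw [← integral_const_mul, ← integral_const_mul, ← integral_const_mul,
      ← integral_add ((hI _ _ _).const_mul _) ((hI _ _ _).const_mul _)]
    refine integral_congr_ae (ae_of_all _ fun η => ?_)
    simp only
    have h := sphereProb_moment_recurrence μ (b := (e : E)) (c := (η : E)) (by simp) (by simp) i j
    rw [pow_succ (inner ℝ (e : E) (η : E)) l]
    linear_combination (inner ℝ (e : E) (η : E)) ^ l * h

lemma abs_tripleMoment_le (e : sphere (0 : E) 1) (i j l : ℕ) : |tripleMoment μ e i j l| ≤ 1 := by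
  have h := norm_integral_le_of_norm_le_const (μ := (sphereProb μ).prod (sphereProb μ))
    (f := fun p : sphere (0 : E) 1 × sphere (0 : E) 1 => inner ℝ (e : E) (p.1 : E) ^ i *
    inner ℝ (p.2 : E) (p.1 : E) ^ j * inner ℝ (e : E) (p.2 : E) ^ l) (C := 1)
    (ae_of_all _ fun p => ?_)
  · simpa [tripleMoment] using h
  · rw [norm_mul, norm_mul, norm_pow, norm_pow, norm_pow]
    exact mul_le_one₀ (mul_le_one₀ (pow_le_one₀ (abs_nonneg _) (abs_inner_sphere_le e p.1))
      (by positivity) (pow_le_one₀ (abs_nonneg _) (abs_inner_sphere_le p.2 p.1))) (by positivity)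
      (pow_le_one₀ (abs_nonneg _) (abs_inner_sphere_le e p.2))

lemma poch_ge_factorial {D : ℝ} (hD : 1 ≤ D) (m : ℕ) : (m.factorial : ℝ) ≤ poch D m := by
  induction m with
  | zero => simp [poch_zero]
  | succ m ih =>
    rw [poch_succ, Nat.factorial_succ, mul_comm, Nat.cast_mul]
    push_cast
    have : (0 : ℝ) ≤ m.factorial := Nat.cast_nonneg _
    exact mul_le_mul ih (by linarith) (by positivity) (this.trans ih)

lemma zmom_le_one {D : ℝ} (hD : 1 ≤ D) (i n : ℕ) : zmom D i n ≤ 1 := by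
  by_cases h : ∃ k, i = n + 2 * k
  · obtain ⟨k, rfl⟩ := h
    rw [zmom_add_two_mul]
    have h1 := poch_ge_factorial hD (n + k)
    have h2 : ((n + 2 * k).choose k : ℝ) ≤ 2 ^ (n + 2 * k) := by
      exact_mod_cast Nat.choose_le_two_pow (n + 2 * k) k
    have h3 := Nat.choose_mul_factorial_mul_factorial (show k ≤ n + 2 * k by omega)
    rw [show n + 2 * k - k = n + k by omega] at h3
    have h4 : (0 : ℝ) < (n + k).factorial := by positivity
    rw [div_le_one (by have := h4.trans_le h1; positivity), ← h3]
    push_cast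
    gcongr
  · rw [zmom_eq_zero D (by simpa using h)]; norm_num

end SphereSeries

section SphereExpansion

open Metric Set Measure

variable {E : Type*} [NormedAddCommGroup E] [InnerProductSpace ℝ E] [FiniteDimensional ℝ E]
  [MeasurableSpace E] [BorelSpace E] [Nontrivial E] (μ : Measure E) [μ.IsAddHaarMeasure]

lemma summable_norm_mul_zmom {D : ℝ} (hD : 1 ≤ D) {u : ℕ → ℂ} (hu : Summable fun i => ‖u i‖)
    (n : ℕ) : Summable fun i => ‖u i * (zmom D i n : ℂ)‖ := by
  refine Summable.of_nonneg_of_le (fun _ => norm_nonneg _) (fun i => ?_) hu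
  rw [norm_mul, norm_real, Real.norm_of_nonneg (zmom_nonneg (by linarith) i n)]
  exact mul_le_of_le_one_right (norm_nonneg _) (zmom_le_one hD i n)

lemma hasSum_zdim_mul_zmom {D : ℝ} (hD1 : 1 < D) (hD : 2 * D = Module.finrank ℝ E)
    (e : sphere (0 : E) 1) (i j l : ℕ) :
    HasSum (fun n => zdim D n * (zmom D i n * zmom D j n * zmom D l n)) (tripleMoment μ e i j l) := by
  rw [tripleMoment_eq μ hD1 hD e j l le_rfl]
  refine hasSum_sum_of_ne_finset_zero fun n hn => ?_
  rw [zmom_of_lt D (by simpa using hn)]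
  simp

lemma summable_sphere_terms (ν : Measure E) [ν.IsAddHaarMeasure] {D : ℝ} (hD1 : 1 < D) (hD : 2 * D = Module.finrank ℝ E)
    (e : sphere (0 : E) 1) {u v w : ℕ → ℂ} (hu : Summable fun i => ‖u i‖)
    (hv : Summable fun i => ‖v i‖) (hw : Summable fun i => ‖w i‖) :
    Summable fun q : (ℕ × ℕ × ℕ) × ℕ => ‖(u q.1.1 * (v q.1.2.1 * w q.1.2.2)) *
      ((zdim D q.2 * (zmom D q.1.1 q.2 * zmom D q.1.2.1 q.2 * zmom D q.1.2.2 q.2) : ℝ) : ℂ)‖ := by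
  have hnn : ∀ (m : ℕ × ℕ × ℕ) n,
      0 ≤ zdim D n * (zmom D m.1 n * zmom D m.2.1 n * zmom D m.2.2 n) := fun m n => by
    have h0 : 0 < D := by linarith
    have := zdim_nonneg hD1 n
    have := zmom_nonneg h0 m.1 n
    have := zmom_nonneg h0 m.2.1 n
    have := zmom_nonneg h0 m.2.2 n
    positivity
  have hs : ∀ m : ℕ × ℕ × ℕ, HasSum (fun n => ‖(u m.1 * (v m.2.1 * w m.2.2)) *
      ((zdim D n * (zmom D m.1 n * zmom D m.2.1 n * zmom D m.2.2 n) : ℝ) : ℂ)‖)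
      (‖u m.1 * (v m.2.1 * w m.2.2)‖ * tripleMoment ν e m.1 m.2.1 m.2.2) := fun m => by
    have h := (hasSum_zdim_mul_zmom ν hD1 hD e m.1 m.2.1 m.2.2).mul_left
      ‖u m.1 * (v m.2.1 * w m.2.2)‖
    refine h.congr_fun fun n => ?_
    rw [norm_mul _ ((_ : ℝ) : ℂ), norm_real, Real.norm_of_nonneg (hnn m n)]
  rw [summable_prod_of_nonneg fun _ => norm_nonneg _]
  refine ⟨fun m => (hs m).summable, ?_⟩
  simp only [(hs _).tsum_eq]
  refine Summable.of_norm_bounded (summable_triple_prod hu hv hw) fun m => ?_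
  rw [norm_mul, norm_norm, norm_mul, norm_mul]
  exact mul_le_of_le_one_right (by positivity) (abs_tripleMoment_le ν e _ _ _)

/-- Expansion of a product of three power series in the inner products of three points. -/
lemma hasSum_sphere {D : ℝ} (hD1 : 1 < D) (hD : 2 * D = Module.finrank ℝ E)
    (e : sphere (0 : E) 1) {u v w : ℕ → ℂ} (hu : Summable fun i => ‖u i‖)
    (hv : Summable fun i => ‖v i‖) (hw : Summable fun i => ‖w i‖) :
    HasSum (fun n => (zdim D n : ℂ) * ((∑' i, u i * (zmom D i n : ℂ)) *
        ((∑' i, v i * (zmom D i n : ℂ)) * ∑' i, w i * (zmom D i n : ℂ))))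
      (∫ p : sphere (0 : E) 1 × sphere (0 : E) 1,
        (∑' i, u i * ((inner ℝ (e : E) (p.1 : E) : ℝ) : ℂ) ^ i) *
        ((∑' i, v i * ((inner ℝ (p.2 : E) (p.1 : E) : ℝ) : ℂ) ^ i) *
          ∑' i, w i * ((inner ℝ (e : E) (p.2 : E) : ℝ) : ℂ) ^ i)
        ∂(sphereProb μ).prod (sphereProb μ)) := by
  have hpow : ∀ {u : ℕ → ℂ}, (Summable fun i => ‖u i‖) → ∀ x : ℝ, |x| ≤ 1 →
      Summable fun i => ‖u i * (x : ℂ) ^ i‖ := fun {u} hu x hx => by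
    refine Summable.of_nonneg_of_le (fun _ => norm_nonneg _) (fun i => ?_) hu
    rw [norm_mul, norm_pow, norm_real]
    exact mul_le_of_le_one_right (norm_nonneg _) (pow_le_one₀ (norm_nonneg _) hx)
  set F : ℕ × ℕ × ℕ → sphere (0 : E) 1 × sphere (0 : E) 1 → ℂ := fun m p =>
    (u m.1 * ((inner ℝ (e : E) (p.1 : E) : ℝ) : ℂ) ^ m.1) *
      ((v m.2.1 * ((inner ℝ (p.2 : E) (p.1 : E) : ℝ) : ℂ) ^ m.2.1) *
        (w m.2.2 * ((inner ℝ (e : E) (p.2 : E) : ℝ) : ℂ) ^ m.2.2)) with hF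
  have hFint : ∀ m, Integrable (F m) ((sphereProb μ).prod (sphereProb μ)) := fun m =>
    integrable_of_continuous_sphere_prod μ (by fun_prop)
  have hFle : ∀ m p, ‖F m p‖ ≤ ‖u m.1‖ * (‖v m.2.1‖ * ‖w m.2.2‖) := fun m p => by
    have h1 : ∀ (a b : sphere (0 : E) 1) (i : ℕ),
        ‖((inner ℝ (a : E) (b : E) : ℝ) : ℂ) ^ i‖ ≤ 1 := fun a b i => by
      rw [norm_pow, norm_real]
      exact pow_le_one₀ (norm_nonneg _) (abs_inner_sphere_le a b)
    simp only [hF, norm_mul]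
    gcongr
    · exact mul_le_of_le_one_right (norm_nonneg _) (h1 _ _ _)
    · exact mul_le_of_le_one_right (norm_nonneg _) (h1 _ _ _)
    · exact mul_le_of_le_one_right (norm_nonneg _) (h1 _ _ _)
  have hS1 : HasSum (fun m => ∫ p, F m p ∂(sphereProb μ).prod (sphereProb μ))
      (∫ p, ∑' m, F m p ∂(sphereProb μ).prod (sphereProb μ)) := by
    refine hasSum_integral_of_summable_integral_norm hFint ?_
    refine Summable.of_nonneg_of_le (fun m => integral_nonneg fun p => norm_nonneg _) (fun m => ?_)
      (summable_triple_prod hu hv hw)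
    calc _ ≤ ∫ p, ‖u m.1‖ * (‖v m.2.1‖ * ‖w m.2.2‖) ∂(sphereProb μ).prod (sphereProb μ) :=
          integral_mono (hFint m).norm (integrable_const _) (hFle m)
      _ = _ := by simp
  have hTm : ∀ m, ∫ p, F m p ∂(sphereProb μ).prod (sphereProb μ) =
      (u m.1 * (v m.2.1 * w m.2.2)) * (tripleMoment μ e m.1 m.2.1 m.2.2 : ℂ) := fun m => by
    rw [tripleMoment, ← integral_complex_ofReal, ← integral_const_mul]
    refine integral_congr_ae (ae_of_all _ fun p => ?_)
    simp only [hF]; push_cast; ring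
  have hsum := summable_sphere_terms μ hD1 hD e hu hv hw
  have hH := hsum.of_norm.hasSum
  have hfib : ∀ m : ℕ × ℕ × ℕ, HasSum (fun n => (u m.1 * (v m.2.1 * w m.2.2)) *
      ((zdim D n * (zmom D m.1 n * zmom D m.2.1 n * zmom D m.2.2 n) : ℝ) : ℂ))
      ((u m.1 * (v m.2.1 * w m.2.2)) * (tripleMoment μ e m.1 m.2.1 m.2.2 : ℂ)) := fun m =>
    (hasSum_ofReal.2 (hasSum_zdim_mul_zmom μ hD1 hD e m.1 m.2.1 m.2.2)).mul_left _
  have hS2 := HasSum.prod_fiberwise hH hfib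
  simp only [hTm] at hS1
  rw [hS2.unique hS1] at hH
  have hH' := (Equiv.prodComm ℕ (ℕ × ℕ × ℕ)).hasSum_iff.2 hH
  have hfib2 : ∀ n : ℕ, HasSum (fun m : ℕ × ℕ × ℕ => (u m.1 * (v m.2.1 * w m.2.2)) *
      ((zdim D n * (zmom D m.1 n * zmom D m.2.1 n * zmom D m.2.2 n) : ℝ) : ℂ))
      ((zdim D n : ℂ) * ((∑' i, u i * (zmom D i n : ℂ)) *
        ((∑' i, v i * (zmom D i n : ℂ)) * ∑' i, w i * (zmom D i n : ℂ)))) := fun n => by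
    have h := ((hsum.of_norm.prod_symm).prod_factor n).hasSum
    refine (congrArg (HasSum _) ?_).mp h
    rw [← tsum_mul_mul_of_summable_norm (summable_norm_mul_zmom hD1.le hu n)
      (summable_norm_mul_zmom hD1.le hv n) (summable_norm_mul_zmom hD1.le hw n), ← tsum_mul_left]
    refine tsum_congr fun m => ?_
    simp only [Prod.fst_swap, Prod.snd_swap]
    push_cast; ring
  have hS3 := HasSum.prod_fiberwise hH' hfib2
  refine (congrArg (HasSum _) ?_).mp hS3
  refine integral_congr_ae (ae_of_all _ fun p => ?_)
  simp only [hF]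
  exact tsum_mul_mul_of_summable_norm (hpow hu _ (abs_inner_sphere_le _ _))
    (hpow hv _ (abs_inner_sphere_le _ _)) (hpow hw _ (abs_inner_sphere_le _ _))

end SphereExpansion

section SphereKernel

open Metric Set Measure

/-- The kernel `(2 cosh s - 2 x) ^ (-γ)`. -/
noncomputable def cosKer (γ : ℂ) (s x : ℝ) : ℂ := ((2 * Real.cosh s - 2 * x : ℝ) : ℂ) ^ (-γ)

/-- The coefficients of `(2 cosh s - 2 x) ^ (-γ)` in powers of `x`. -/
noncomputable def binCoef (γ : ℂ) (s : ℝ) (i : ℕ) : ℂ :=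
  poch γ i / (i.factorial : ℂ) * 2 ^ i * ((2 * Real.cosh s : ℝ) : ℂ) ^ (-(γ + i))

lemma cosKer_base_pos {s x : ℝ} (hs : s ≠ 0) (hx : |x| ≤ 1) : 0 < 2 * Real.cosh s - 2 * x := by
  have := Real.one_lt_cosh.2 hs
  have := (abs_le.1 hx).2
  linarith

lemma binCoef_eq (γ : ℂ) (s : ℝ) (i : ℕ) :
    binCoef γ s i = ((2 * Real.cosh s : ℝ) : ℂ) ^ (-γ) *
      (poch γ i / (i.factorial : ℂ) * (((Real.cosh s)⁻¹ : ℝ) : ℂ) ^ i) := by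
  have hc := Real.cosh_pos s
  have h2 : ((2 * Real.cosh s : ℝ) : ℂ) ≠ 0 := by
    rw [Ne, ofReal_eq_zero]; positivity
  have h3 : (Real.cosh s : ℂ) ≠ 0 := by rw [Ne, ofReal_eq_zero]; positivity
  rw [binCoef, neg_add, cpow_add _ _ h2, cpow_neg _ (i : ℂ), cpow_natCast]
  push_cast at h2 h3 ⊢
  rw [mul_pow, inv_pow]
  field_simp

lemma hasSum_binCoef (γ : ℂ) {s x : ℝ} (hs : s ≠ 0) (hx : |x| ≤ 1) :
    HasSum (fun i => binCoef γ s i * (x : ℂ) ^ i) (cosKer γ s x) := by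
  have hc := Real.one_lt_cosh.2 hs
  have hc0 := Real.cosh_pos s
  have hlt : |(Real.cosh s)⁻¹ * x| < 1 := by
    rw [abs_mul, abs_of_pos (inv_pos.2 hc0)]
    calc (Real.cosh s)⁻¹ * |x| ≤ (Real.cosh s)⁻¹ * 1 := by gcongr
      _ < 1 := by rw [mul_one]; exact inv_lt_one_of_one_lt₀ hc
  have h := (hasSum_one_sub_cpow γ (x := (((Real.cosh s)⁻¹ * x : ℝ) : ℂ))
    (by rwa [norm_real])).mul_left (((2 * Real.cosh s : ℝ) : ℂ) ^ (-γ))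
  have e : cosKer γ s x = ((2 * Real.cosh s : ℝ) : ℂ) ^ (-γ) *
      (1 - (((Real.cosh s)⁻¹ * x : ℝ) : ℂ)) ^ (-γ) := by
    rw [cosKer, ← ofReal_one, ← ofReal_sub, ← mul_cpow_ofReal_nonneg (by positivity)
      (by linarith [(abs_lt.1 hlt).2]), ← ofReal_mul]
    congr 2
    field_simp
  rw [e]
  refine h.congr_fun fun i => ?_
  rw [binCoef_eq]
  push_cast
  ring

lemma norm_binCoef_eq {r : ℝ} (hr : 0 < r) (s : ℝ) (i : ℕ) :
    binCoef r s i = ((‖binCoef r s i‖ : ℝ) : ℂ) := by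
  have h : binCoef r s i = ((poch r i / (i.factorial : ℝ) * 2 ^ i *
      (2 * Real.cosh s) ^ (-(r + i)) : ℝ) : ℂ) := by
    have hc := Real.cosh_pos s
    have hpw : ((2 * Real.cosh s : ℝ) : ℂ) ^ (-((r : ℂ) + i)) =
        (((2 * Real.cosh s) ^ (-(r + i)) : ℝ) : ℂ) := by
      rw [ofReal_cpow (by positivity)]; norm_num
    rw [binCoef, hpw, ofReal_mul, ofReal_mul, ofReal_div, poch_ofReal]
    norm_num
  have h0 : 0 ≤ poch r i / (i.factorial : ℝ) * 2 ^ i * (2 * Real.cosh s) ^ (-(r + i)) := by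
    have := poch_pos hr i
    have hc := Real.cosh_pos s
    positivity
  rw [h, norm_real, Real.norm_of_nonneg h0]

lemma summable_norm_binCoef_of_pos {r : ℝ} (hr : 0 < r) {s : ℝ} (hs : s ≠ 0) :
    Summable fun i => ‖binCoef r s i‖ := by
  have h := (hasSum_binCoef r hs (x := 1) (by simp)).summable
  simp only [ofReal_one, one_pow, mul_one] at h
  rw [← Complex.summable_ofReal]
  refine h.congr fun i => ?_
  exact norm_binCoef_eq hr s i

lemma exists_norm_binCoef_le {γ : ℂ} (hγ : 0 < γ.re) :
    ∃ C, 0 < C ∧ ∀ s i, ‖binCoef γ s i‖ ≤ C * ‖binCoef γ.re s i‖ := by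
  obtain ⟨C, hC, h⟩ := exists_norm_poch_le hγ
  refine ⟨C, hC, fun s i => ?_⟩
  have hc := Real.cosh_pos s
  have h2 : 0 < 2 * Real.cosh s := by positivity
  have hp : ‖poch (γ.re : ℂ) i‖ = poch γ.re i := by
    rw [← poch_ofReal, norm_real, Real.norm_of_nonneg (poch_pos hγ i).le]
  simp only [binCoef, norm_mul, norm_div, norm_cpow_eq_rpow_re_of_pos h2, hp]
  simp only [neg_re, add_re, ofReal_re]
  have e : C * (poch γ.re i / ‖(i.factorial : ℂ)‖ * ‖(2 : ℂ) ^ i‖ *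
      (2 * Real.cosh s) ^ (-(γ.re + (i : ℂ).re))) = (C * poch γ.re i) / ‖(i.factorial : ℂ)‖ *
      ‖(2 : ℂ) ^ i‖ * (2 * Real.cosh s) ^ (-(γ.re + (i : ℂ).re)) := by ring
  rw [e]
  gcongr
  exact h i

lemma summable_norm_binCoef {γ : ℂ} (hγ : 0 < γ.re) {s : ℝ} (hs : s ≠ 0) :
    Summable fun i => ‖binCoef γ s i‖ := by
  obtain ⟨C, hC, h⟩ := exists_norm_binCoef_le hγ
  exact Summable.of_nonneg_of_le (fun _ => norm_nonneg _) (h s)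
    ((summable_norm_binCoef_of_pos hγ hs).mul_left C)

/-- The zonal components of `cosKer`. -/
noncomputable def zonal (D : ℝ) (γ : ℂ) (n : ℕ) (s : ℝ) : ℂ :=
  ∑' i, binCoef γ s i * (zmom D i n : ℂ)

lemma zonal_eq_radial {D : ℝ} (hD : 1 < D) {γ : ℂ} (hγ : Admissible D γ) (n : ℕ) {s : ℝ}
    (hs : s ≠ 0) : zonal D γ n s = radial D γ n s := by
  refine HasSum.tsum_eq ?_
  have hinj : Function.Injective (fun k : ℕ => n + 2 * k) := fun a b h => by
    simp only at h; omega
  refine (hinj.hasSum_iff ?_).1 ?_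
  · intro i hi
    rw [zmom_eq_zero D (fun k hk => hi ⟨k, hk.symm⟩)]; simp
  · have hD0 : 0 < D := by linarith
    refine (hasSum_acoef_cosh (by simpa using hD0) n hγ hs).congr_fun fun k => ?_
    simp only [Function.comp_apply, binCoef, acoef, zmom_add_two_mul]
    have h1 := poch_pos hD0 (n + k)
    push_cast
    rw [← poch_ofReal]
    have h2 : ((poch D (n + k) : ℝ) : ℂ) ≠ 0 := by rw [Ne, ofReal_eq_zero]; exact h1.ne'
    have h3 : (((n + 2 * k).factorial : ℕ) : ℂ) ≠ 0 := by exact_mod_cast (Nat.factorial_pos _).ne'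
    rw [show -(γ + ((n : ℂ) + 2 * k)) = -(γ + n + 2 * k) by ring]
    field_simp

lemma zonal_of_pos (D : ℝ) {r : ℝ} (hr : 0 < r) (n : ℕ) (s : ℝ) :
    zonal D r n s = ((∑' i, ‖binCoef r s i‖ * zmom D i n : ℝ) : ℂ) := by
  rw [zonal, ofReal_tsum]
  refine tsum_congr fun i => ?_
  rw [ofReal_mul, ← norm_binCoef_eq hr]

lemma exists_norm_zonal_le {D : ℝ} (hD : 1 < D) {γ : ℂ} (hγ : 0 < γ.re) :
    ∃ C, 0 < C ∧ ∀ n s, s ≠ 0 → ‖zonal D γ n s‖ ≤ C * ∑' i, ‖binCoef γ.re s i‖ * zmom D i n := by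
  obtain ⟨C, hC, h⟩ := exists_norm_binCoef_le hγ
  refine ⟨C, hC, fun n s hs => ?_⟩
  have hz := fun i => zmom_nonneg (by linarith : 0 < D) i n
  have h1 := summable_norm_mul_zmom hD.le (summable_norm_binCoef hγ hs) n
  have h2 := summable_norm_mul_zmom hD.le (summable_norm_binCoef_of_pos hγ hs) n
  have e : ∀ (u : ℂ) i, ‖u * (zmom D i n : ℂ)‖ = ‖u‖ * zmom D i n := fun u i => by
    rw [norm_mul, norm_real, Real.norm_of_nonneg (hz i)]
  simp only [e] at h2
  rw [← tsum_mul_left]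
  refine (norm_tsum_le_tsum_norm h1).trans (h1.tsum_le_tsum (fun i => ?_) (h2.mul_left C))
  rw [e, ← mul_assoc]
  exact mul_le_mul_of_nonneg_right (h s i) (hz i)

lemma norm_cosKer {γ : ℂ} {s x : ℝ} (hs : s ≠ 0) (hx : |x| ≤ 1) :
    cosKer γ.re s x = ((‖cosKer γ s x‖ : ℝ) : ℂ) := by
  have h := cosKer_base_pos hs hx
  rw [cosKer, cosKer, norm_cpow_eq_rpow_re_of_pos h, ofReal_cpow h.le]
  simp

variable {E : Type*} [NormedAddCommGroup E] [InnerProductSpace ℝ E] [FiniteDimensional ℝ E]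
  [MeasurableSpace E] [BorelSpace E] [Nontrivial E] (μ : Measure E) [μ.IsAddHaarMeasure]

lemma hasSum_zonal {D : ℝ} (hD1 : 1 < D) (hD : 2 * D = Module.finrank ℝ E)
    (e : sphere (0 : E) 1) {γ₁ γ₂ γ₃ : ℂ} (h₁ : 0 < γ₁.re) (h₂ : 0 < γ₂.re) (h₃ : 0 < γ₃.re)
    {s r t : ℝ} (hs : s ≠ 0) (hr : r ≠ 0) (ht : t ≠ 0) :
    HasSum (fun n => (zdim D n : ℂ) * (zonal D γ₁ n s * (zonal D γ₂ n r * zonal D γ₃ n t)))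
      (∫ p : sphere (0 : E) 1 × sphere (0 : E) 1, cosKer γ₁ s (inner ℝ (e : E) (p.1 : E)) *
        (cosKer γ₂ r (inner ℝ (p.2 : E) (p.1 : E)) * cosKer γ₃ t (inner ℝ (e : E) (p.2 : E)))
        ∂(sphereProb μ).prod (sphereProb μ)) := by
  have h := hasSum_sphere μ hD1 hD e (summable_norm_binCoef h₁ hs) (summable_norm_binCoef h₂ hr)
    (summable_norm_binCoef h₃ ht)
  refine (congrArg (HasSum _) ?_).mp h
  refine integral_congr_ae (ae_of_all _ fun p => ?_)
  simp only
  rw [(hasSum_binCoef γ₁ hs (abs_inner_sphere_le e p.1)).tsum_eq,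
    (hasSum_binCoef γ₂ hr (abs_inner_sphere_le p.2 p.1)).tsum_eq,
    (hasSum_binCoef γ₃ ht (abs_inner_sphere_le e p.2)).tsum_eq]

lemma exists_sum_norm_zonal_le {D : ℝ} (hD1 : 1 < D) (hD : 2 * D = Module.finrank ℝ E)
    (e : sphere (0 : E) 1) {γ₁ γ₂ γ₃ : ℂ} (h₁ : 0 < γ₁.re) (h₂ : 0 < γ₂.re) (h₃ : 0 < γ₃.re) :
    ∃ C, ∀ s r t : ℝ, s ≠ 0 → r ≠ 0 → t ≠ 0 → ∃ S,
      HasSum (fun n => ‖(zdim D n : ℂ) * (zonal D γ₁ n s * (zonal D γ₂ n r * zonal D γ₃ n t))‖) S ∧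
      S ≤ C * ∫ p : sphere (0 : E) 1 × sphere (0 : E) 1,
        ‖cosKer γ₁ s (inner ℝ (e : E) (p.1 : E)) *
        (cosKer γ₂ r (inner ℝ (p.2 : E) (p.1 : E)) * cosKer γ₃ t (inner ℝ (e : E) (p.2 : E)))‖
        ∂(sphereProb μ).prod (sphereProb μ) := by
  obtain ⟨C₁, hC₁, H₁⟩ := exists_norm_zonal_le hD1 h₁
  obtain ⟨C₂, hC₂, H₂⟩ := exists_norm_zonal_le hD1 h₂
  obtain ⟨C₃, hC₃, H₃⟩ := exists_norm_zonal_le hD1 h₃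
  refine ⟨C₁ * (C₂ * C₃), fun s r t hs hr ht => ?_⟩
  have h := hasSum_zonal μ hD1 hD e (γ₁ := γ₁.re) (γ₂ := γ₂.re) (γ₃ := γ₃.re) (by simpa using h₁)
    (by simpa using h₂) (by simpa using h₃) hs hr ht
  have e1 : ∫ p : sphere (0 : E) 1 × sphere (0 : E) 1,
      cosKer γ₁.re s (inner ℝ (e : E) (p.1 : E)) * (cosKer γ₂.re r (inner ℝ (p.2 : E) (p.1 : E)) *
        cosKer γ₃.re t (inner ℝ (e : E) (p.2 : E))) ∂(sphereProb μ).prod (sphereProb μ) =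
      ((∫ p : sphere (0 : E) 1 × sphere (0 : E) 1,
        ‖cosKer γ₁ s (inner ℝ (e : E) (p.1 : E)) *
        (cosKer γ₂ r (inner ℝ (p.2 : E) (p.1 : E)) * cosKer γ₃ t (inner ℝ (e : E) (p.2 : E)))‖
        ∂(sphereProb μ).prod (sphereProb μ) : ℝ) : ℂ) := by
    rw [← integral_complex_ofReal]
    refine integral_congr_ae (ae_of_all _ fun p => ?_)
    simp only [norm_mul, ofReal_mul]
    rw [norm_cosKer hs (abs_inner_sphere_le e p.1), norm_cosKer hr (abs_inner_sphere_le p.2 p.1),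
      norm_cosKer ht (abs_inner_sphere_le e p.2)]
  rw [e1] at h
  simp only [zonal_of_pos D h₁, zonal_of_pos D h₂, zonal_of_pos D h₃, ← ofReal_mul] at h
  have h' := (hasSum_ofReal.1 h).mul_left (C₁ * (C₂ * C₃))
  have hle : ∀ n, ‖(zdim D n : ℂ) * (zonal D γ₁ n s * (zonal D γ₂ n r * zonal D γ₃ n t))‖ ≤
      C₁ * (C₂ * C₃) * (zdim D n * ((∑' i, ‖binCoef γ₁.re s i‖ * zmom D i n) *
        ((∑' i, ‖binCoef γ₂.re r i‖ * zmom D i n) * ∑' i, ‖binCoef γ₃.re t i‖ * zmom D i n))) := by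
    intro n
    have hz := zdim_nonneg hD1 n
    rw [norm_mul, norm_mul, norm_mul, norm_real, Real.norm_of_nonneg hz]
    have a1 := H₁ n s hs
    have a2 := H₂ n r hr
    have a3 := H₃ n t ht
    calc _ ≤ zdim D n * ((C₁ * ∑' i, ‖binCoef γ₁.re s i‖ * zmom D i n) *
        ((C₂ * ∑' i, ‖binCoef γ₂.re r i‖ * zmom D i n) *
          (C₃ * ∑' i, ‖binCoef γ₃.re t i‖ * zmom D i n))) := by
          have b2 := (norm_nonneg _).trans a2
          have b1 := (norm_nonneg _).trans a1
          gcongr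
      _ = _ := by ring
  have hsum := Summable.of_nonneg_of_le (fun _ => norm_nonneg _) hle h'.summable
  exact ⟨_, hsum.hasSum, hasSum_le hle hsum.hasSum h'⟩

end SphereKernel

section Inversion

open Metric Set Measure

variable {E : Type*} [NormedAddCommGroup E] [InnerProductSpace ℝ E]

lemma abs_det_smul_reflection [FiniteDimensional ℝ E] (K : Submodule ℝ E) (r : ℝ) :
    |((r ^ 2 • (K.reflection : E →L[ℝ] E)) : E →L[ℝ] E).det| = r ^ (2 * Module.finrank ℝ E) := by
  have h : ((r ^ 2 • (K.reflection : E →L[ℝ] E)) : E →L[ℝ] E).det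
      = (r ^ 2) ^ Module.finrank ℝ E * LinearMap.det (K.reflection.toLinearMap) := by
    rw [← LinearMap.det_smul]; rfl
  rw [h, abs_mul, ← pow_mul, abs_of_nonneg (by rw [pow_mul]; positivity)]
  have : |LinearMap.det (K.reflection.toLinearMap)| = 1 := by
    rw [K.det_reflection, abs_pow, abs_neg, abs_one, one_pow]
  rw [this, mul_one]

lemma inversion_image_compl {R : ℝ} (hR : R ≠ 0) :
    EuclideanGeometry.inversion (0 : E) R '' {0}ᶜ = {0}ᶜ := by
  rw [Set.image_compl_eq (EuclideanGeometry.inversion_bijective 0 hR), image_singleton,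
    EuclideanGeometry.inversion_self]

lemma inversion_deriv {R : ℝ} : ∀ x ∈ ({0}ᶜ : Set E), HasFDerivWithinAt
    (EuclideanGeometry.inversion (0 : E) R)
    ((R / ‖x‖) ^ 2 • ((ℝ ∙ x)ᗮ.reflection : E →L[ℝ] E)) {0}ᶜ x := by
  intro x hx
  have := (EuclideanGeometry.hasFDerivAt_inversion (R := R) (c := (0 : E)) (x := x) hx).hasFDerivWithinAt (s := {0}ᶜ)
  simpa using this

variable [FiniteDimensional ℝ E]
  [MeasurableSpace E] [BorelSpace E] [Nontrivial E] (μ : Measure E) [μ.IsAddHaarMeasure]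
  {F : Type*} [NormedAddCommGroup F] [NormedSpace ℝ F]

lemma integral_inversion {R : ℝ} (hR : R ≠ 0) (f : E → F) :
    ∫ b, (R / ‖b‖) ^ (2 * Module.finrank ℝ E) • f (EuclideanGeometry.inversion 0 R b) ∂μ
      = ∫ a, f a ∂μ := by
  have h := integral_image_eq_integral_abs_det_fderiv_smul μ (measurableSet_singleton (0 : E)).compl
    (inversion_deriv (R := R)) (EuclideanGeometry.inversion_injective (0 : E) hR).injOn f
  rw [inversion_image_compl hR] at h
  simp only [abs_det_smul_reflection, restrict_compl_singleton] at h
  exact h.symm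

lemma integrable_inversion {R : ℝ} (hR : R ≠ 0) (f : E → F) :
    Integrable (fun b => (R / ‖b‖) ^ (2 * Module.finrank ℝ E) •
      f (EuclideanGeometry.inversion 0 R b)) μ ↔ Integrable f μ := by
  have h := integrableOn_image_iff_integrableOn_abs_det_fderiv_smul μ
    (measurableSet_singleton (0 : E)).compl
    (inversion_deriv (R := R)) (EuclideanGeometry.inversion_injective (0 : E) hR).injOn f
  rw [inversion_image_compl hR] at h
  simp only [abs_det_smul_reflection, IntegrableOn, restrict_compl_singleton] at h
  exact h.symm

lemma ae_of_ae_inversion {R : ℝ} (hR : R ≠ 0) {p : E → Prop}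
    (h : ∀ᵐ b ∂μ, p (EuclideanGeometry.inversion 0 R b)) : ∀ᵐ a ∂μ, p a := by
  rw [ae_iff] at h ⊢
  have h1 : μ ({b | ¬ p (EuclideanGeometry.inversion 0 R b)} ∩ {0}ᶜ) = 0 :=
    measure_mono_null inter_subset_left h
  have h2 := addHaar_image_eq_zero_of_differentiableOn_of_addHaar_eq_zero μ
    (f := EuclideanGeometry.inversion (0 : E) R)
    (fun x hx => ((inversion_deriv (R := R) x hx.2).mono inter_subset_right).differentiableWithinAt) h1
  refine measure_mono_null (t := _ ∪ {0}) (fun a ha => ?_) (measure_union_null h2 (measure_singleton 0))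
  by_cases ha0 : a = 0
  · exact Or.inr ha0
  · refine Or.inl ⟨EuclideanGeometry.inversion 0 R a, ⟨?_, ?_⟩, EuclideanGeometry.inversion_inversion 0 hR a⟩
    · simpa [EuclideanGeometry.inversion_inversion 0 hR a] using ha
    · simpa [EuclideanGeometry.inversion_eq_center hR] using ha0

end Inversion

section Swap

open Metric Set Measure EuclideanGeometry

variable {E : Type*} [NormedAddCommGroup E] [InnerProductSpace ℝ E] [FiniteDimensional ℝ E]
  [MeasurableSpace E] [BorelSpace E]

/-- A function of three points which is homogeneous of degree `-3 d` and isometry invariant. -/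
structure IsConformalKernel (G : E → E → E → ℂ) : Prop where
  measurable : Measurable fun p : E × E × E => G p.1 p.2.1 p.2.2
  smul : ∀ (r : ℝ), 0 < r → ∀ a b c, G (r • a) (r • b) (r • c)
    = ((r ^ (3 * Module.finrank ℝ E))⁻¹ : ℝ) • G a b c
  map : ∀ (U : E ≃ₗᵢ[ℝ] E) (a b c : E), G (U a) (U b) (U c) = G a b c

lemma integral_comp_smul_isometry {F : Type*} [NormedAddCommGroup F] [NormedSpace ℝ F]
    (f : E → F) {r : ℝ} (hr : 0 < r) (U : E ≃ₗᵢ[ℝ] E) :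
    ∫ c, f (r • U c) = (r ^ Module.finrank ℝ E)⁻¹ • ∫ c, f c := by
  have h := U.measurePreserving.integral_comp U.toHomeomorph.measurableEmbedding fun c => f (r • c)
  refine h.trans ?_
  rw [Measure.integral_comp_smul, abs_of_pos (by positivity)]

lemma integrable_comp_smul_isometry {F : Type*} [NormedAddCommGroup F] [NormedSpace ℝ F]
    (f : E → F) {r : ℝ} (hr : 0 < r) (U : E ≃ₗᵢ[ℝ] E) :
    Integrable (fun c => f (r • U c)) ↔ Integrable f := by
  have h := U.measurePreserving.integrable_comp_emb (g := fun c => f (r • c))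
    U.toHomeomorph.measurableEmbedding
  refine h.trans ?_
  rw [integrable_comp_smul_iff _ _ hr.ne']

namespace IsConformalKernel

variable {G : E → E → E → ℂ}

lemma inversion_eq (hG : IsConformalKernel G) {z b : E} (hz : z ≠ 0) (hb : b ≠ 0) : ∃ U : E ≃ₗᵢ[ℝ] E, ∀ c,
    G (b - z) b ((‖b‖ / ‖z‖) • U c) = (((‖b‖ / ‖z‖) ^ (3 * Module.finrank ℝ E))⁻¹ : ℝ) •
      G (z - inversion 0 ‖z‖ b) z c := by
  have hz' := norm_pos_iff.2 hz
  have hb' := norm_pos_iff.2 hb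
  set w := (‖z‖ / ‖b‖) • b with hw
  have hwn : ‖w‖ = ‖z‖ := by
    rw [hw, norm_smul, Real.norm_of_nonneg (by positivity)]; field_simp
  set U := (ℝ ∙ (w - z))ᗮ.reflection with hU
  have hUw : U w = z := Submodule.reflection_sub hwn
  have hUz : U z = w := by rw [← hUw]; exact Submodule.reflection_reflection _ _
  refine ⟨U, fun c => ?_⟩
  have h1 : (‖b‖ / ‖z‖) • U z = b := by
    rw [hUz, hw, smul_smul]
    have : ‖b‖ / ‖z‖ * (‖z‖ / ‖b‖) = 1 := by field_simp
    rw [this, one_smul]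
  have h2 : inversion 0 ‖z‖ b = (‖z‖ / ‖b‖) • w := by
    rw [hw, smul_smul, inversion]; simp [pow_two]
  have h3 : (‖b‖ / ‖z‖) • U (z - inversion 0 ‖z‖ b) = b - z := by
    have : ‖b‖ / ‖z‖ * (‖z‖ / ‖b‖) = 1 := by field_simp
    rw [map_sub, smul_sub, h1, h2, map_smul, hUw, smul_smul, this, one_smul]
  have h4 := hG.smul (‖b‖ / ‖z‖) (by positivity) (U (z - inversion 0 ‖z‖ b)) (U z) (U c)
  rwa [h3, h1, hG.map] at h4

lemma section_integrable (hG : IsConformalKernel G) {z b : E} (hz : z ≠ 0) (hb : b ≠ 0) :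
    Integrable (fun c => G (b - z) b c) ↔
      Integrable (fun c => G (z - inversion 0 ‖z‖ b) z c) := by
  have hz' := norm_pos_iff.2 hz
  have hb' := norm_pos_iff.2 hb
  obtain ⟨U, hU⟩ := hG.inversion_eq hz hb
  rw [← integrable_comp_smul_isometry (fun c => G (b - z) b c) (r := ‖b‖ / ‖z‖) (by positivity) U]
  simp only [hU]
  have hne : (((‖b‖ / ‖z‖) ^ (3 * Module.finrank ℝ E))⁻¹ : ℝ) ≠ 0 := by positivity
  exact integrable_smul_iff hne _

lemma scale_aux {r s : ℝ} (hr : 0 < r) (hs : s = r⁻¹) (d : ℕ) :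
    r ^ d * (r ^ (3 * d))⁻¹ = s ^ (2 * d) := by
  subst hs
  rw [inv_pow, show 3 * d = 2 * d + d by ring, pow_add]
  field_simp

lemma section_integral (hG : IsConformalKernel G) {z b : E} (hz : z ≠ 0) (hb : b ≠ 0) :
    ∫ c, G (b - z) b c = (‖z‖ / ‖b‖) ^ (2 * Module.finrank ℝ E) •
      ∫ c, G (z - inversion 0 ‖z‖ b) z c := by
  have hz' := norm_pos_iff.2 hz
  have hb' := norm_pos_iff.2 hb
  obtain ⟨U, hU⟩ := hG.inversion_eq hz hb
  have h := integral_comp_smul_isometry (fun c => G (b - z) b c) (r := ‖b‖ / ‖z‖) (by positivity) U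
  simp only [hU] at h
  rw [integral_smul] at h
  rw [← scale_aux (r := ‖b‖ / ‖z‖) (by positivity) (by rw [inv_div]), mul_smul, h, smul_smul,
    mul_inv_cancel₀ (by positivity), one_smul]

lemma section_integral_norm (hG : IsConformalKernel G) {z b : E} (hz : z ≠ 0) (hb : b ≠ 0) :
    ∫ c, ‖G (b - z) b c‖ = (‖z‖ / ‖b‖) ^ (2 * Module.finrank ℝ E) •
      ∫ c, ‖G (z - inversion 0 ‖z‖ b) z c‖ := by
  have hz' := norm_pos_iff.2 hz
  have hb' := norm_pos_iff.2 hb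
  obtain ⟨U, hU⟩ := hG.inversion_eq hz hb
  have h := integral_comp_smul_isometry (fun c => ‖G (b - z) b c‖) (r := ‖b‖ / ‖z‖) (by positivity) U
  simp only [hU, norm_smul] at h
  rw [integral_const_mul, Real.norm_of_nonneg (by positivity)] at h
  rw [← scale_aux (r := ‖b‖ / ‖z‖) (by positivity) (by rw [inv_div]), mul_smul, smul_eq_mul (a := (_)⁻¹), h, smul_smul,
    mul_inv_cancel₀ (by positivity), one_smul]

variable [Nontrivial E]

lemma ae_ne_zero : ∀ᵐ b : E, b ≠ 0 := by
  rw [ae_iff]; simp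

theorem swap_integrable (hG : IsConformalKernel G) {z : E} (hz : z ≠ 0)
    (h : Integrable fun p : E × E => G (p.1 - z) p.1 p.2) :
    Integrable fun p : E × E => G p.1 z p.2 := by
  have hR : ‖z‖ ≠ 0 := norm_ne_zero_iff.2 hz
  have hm : Measurable fun p : E × E => G p.1 z p.2 :=
    hG.measurable.comp (measurable_fst.prodMk (measurable_const.prodMk measurable_snd))
  obtain ⟨h1, h2⟩ := (integrable_prod_iff h.aestronglyMeasurable).1 h
  refine (integrable_prod_iff hm.aestronglyMeasurable).2 ⟨?_, ?_⟩
  · have h4 : ∀ᵐ a : E, Integrable (fun c => G (z - a) z c) := by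
      refine ae_of_ae_inversion volume hR ?_
      filter_upwards [h1, ae_ne_zero] with b hb hb0
      exact (hG.section_integrable hz hb0).1 hb
    have h5 := (measurePreserving_sub_left volume z).quasiMeasurePreserving.ae h4
    filter_upwards [h5] with a ha
    rwa [sub_sub_cancel] at ha
  · have h3 : Integrable fun b : E => (‖z‖ / ‖b‖) ^ (2 * Module.finrank ℝ E) •
        ∫ c, ‖G (z - inversion 0 ‖z‖ b) z c‖ := by
      refine h2.congr ?_
      filter_upwards [ae_ne_zero] with b hb0 using hG.section_integral_norm hz hb0
    have h4 := (integrable_inversion volume hR fun a => ∫ c, ‖G (z - a) z c‖).1 h3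
    have h5 := h4.comp_sub_left z
    refine h5.congr (Eventually.of_forall fun a => ?_)
    simp only [sub_sub_cancel]

theorem swap_integral (hG : IsConformalKernel G) {z : E} (hz : z ≠ 0)
    (h : Integrable fun p : E × E => G (p.1 - z) p.1 p.2) :
    ∫ p : E × E, G (p.1 - z) p.1 p.2 = ∫ p : E × E, G p.1 z p.2 := by
  have hR : ‖z‖ ≠ 0 := norm_ne_zero_iff.2 hz
  have h3 : ∫ b : E, ∫ c, G (b - z) b c = ∫ b : E, (‖z‖ / ‖b‖) ^ (2 * Module.finrank ℝ E) •
        ∫ c, G (z - inversion 0 ‖z‖ b) z c := by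
    refine integral_congr_ae ?_
    filter_upwards [ae_ne_zero] with b hb0 using hG.section_integral hz hb0
  have h4 := integral_inversion volume hR fun a => ∫ c, G (z - a) z c
  have h5 := integral_sub_left_eq_self (fun a => ∫ c, G a z c) volume z
  have h6 := integral_prod (μ := (volume : Measure E)) (ν := volume) _ h
  have h7 := integral_prod (μ := (volume : Measure E)) (ν := volume) _ (hG.swap_integrable hz h)
  exact h6.trans (h3.trans (h4.trans (h5.trans h7.symm)))

end IsConformalKernel

end Swap

section Tetra

open Metric Set Measure

variable {E : Type*} [NormedAddCommGroup E] [InnerProductSpace ℝ E]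

/-- The tetrahedral kernel with vertices `0, a, b, c`. -/
noncomputable def tetra (α₁ α₂ α₃ α₄ α₅ α₆ : ℂ) (a b c : E) : ℂ :=
  (‖a - c‖ : ℂ) ^ (-2 * α₁) * (‖a‖ : ℂ) ^ (-2 * α₂) * (‖b‖ : ℂ) ^ (-2 * α₃) *
    (‖b - c‖ : ℂ) ^ (-2 * α₄) * (‖c‖ : ℂ) ^ (-2 * α₅) * (‖a - b‖ : ℂ) ^ (-2 * α₆)

variable {α₁ α₂ α₃ α₄ α₅ α₆ : ℂ} [FiniteDimensional ℝ E] [MeasurableSpace E] [BorelSpace E]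

lemma isConformalKernel_tetra
    (hα : 2 * (α₁ + α₂ + α₃ + α₄ + α₅ + α₆) = ((3 * Module.finrank ℝ E : ℕ) : ℂ)) :
    IsConformalKernel (tetra (E := E) α₁ α₂ α₃ α₄ α₅ α₆) where
  measurable := by unfold tetra; fun_prop
  smul := by
    intro r hr a b c
    have key : ∀ (v : E) (s : ℂ), (‖r • v‖ : ℂ) ^ s = (r : ℂ) ^ s * (‖v‖ : ℂ) ^ s := by
      intro v s
      rw [norm_smul, Real.norm_of_nonneg hr.le, ofReal_mul,
        mul_cpow_ofReal_nonneg hr.le (norm_nonneg _)]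
    have hr0 : (r : ℂ) ≠ 0 := ofReal_ne_zero.2 hr.ne'
    have hp : (((r ^ (3 * Module.finrank ℝ E))⁻¹ : ℝ) : ℂ) = (r : ℂ) ^ (-2 * α₁) *
        (r : ℂ) ^ (-2 * α₂) * (r : ℂ) ^ (-2 * α₃) * (r : ℂ) ^ (-2 * α₄) * (r : ℂ) ^ (-2 * α₅) *
        (r : ℂ) ^ (-2 * α₆) := by
      simp only [← cpow_add _ _ hr0]
      rw [show -2 * α₁ + -2 * α₂ + -2 * α₃ + -2 * α₄ + -2 * α₅ + -2 * α₆
        = -((3 * Module.finrank ℝ E : ℕ) : ℂ) by rw [← hα]; ring, cpow_neg, cpow_natCast]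
      push_cast; rfl
    rw [real_smul, hp]
    simp only [tetra, ← smul_sub, key]
    ring
  map := by
    intro U a b c
    simp only [tetra, ← map_sub, LinearIsometryEquiv.norm_map]

lemma measurePreserving_vertices (z : E) :
    MeasurePreserving (fun p : E × E => (p.2 + (z - p.1), z - p.1)) := by
  have h1 : MeasurePreserving (fun p : E × E => (p.2, z - p.1)) :=
    (measurePreserving_swap (μ := (volume : Measure E)) (ν := volume)).comp
      ((measurePreserving_sub_left volume z).prod (MeasurePreserving.id volume))
  exact (measurePreserving_add_prod (μ := (volume : Measure E)) (ν := volume)).comp h1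

lemma tetra_vertices {z : E} (b c : E) :
    (‖c + (z - b)‖ : ℂ) ^ (-2 * α₁) * (‖z - b‖ : ℂ) ^ (-2 * α₂) *
      (‖z - (z - b)‖ : ℂ) ^ (-2 * α₃) * (‖z - (c + (z - b))‖ : ℂ) ^ (-2 * α₄) *
      (‖c + (z - b) - (z - b)‖ : ℂ) ^ (-2 * α₅) * (‖z‖ : ℂ) ^ (-2 * α₆)
      = tetra α₁ α₂ α₃ α₄ α₅ α₆ (b - z) b c := by
  rw [tetra, ← norm_neg (b - z - c), ← norm_neg (b - z), show -(b - z - c) = c + (z - b) by abel,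
    show -(b - z) = z - b by abel, show z - (z - b) = b by abel,
    show z - (c + (z - b)) = b - c by abel, show c + (z - b) - (z - b) = c by abel,
    show b - z - b = -z by abel, norm_neg z]

/-- Inversion maps the two-loop integral to one with the external point opposite to the origin. -/
theorem two_loop_eq_tetra [Nontrivial E] {z : E} (hz : z ≠ 0)
    (hα : 2 * (α₁ + α₂ + α₃ + α₄ + α₅ + α₆) = ((3 * Module.finrank ℝ E : ℕ) : ℂ))
    (hint : Integrable (fun p : E × E =>
      (‖p.1‖ : ℂ) ^ (-2 * α₁) * (‖p.2‖ : ℂ) ^ (-2 * α₂) * (‖z - p.2‖ : ℂ) ^ (-2 * α₃) *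
        (‖z - p.1‖ : ℂ) ^ (-2 * α₄) * (‖p.1 - p.2‖ : ℂ) ^ (-2 * α₅)) volume) :
    (Integrable fun p : E × E => tetra α₁ α₂ α₃ α₄ α₅ α₆ p.1 ((‖z‖)⁻¹ • z) p.2) ∧
    (∫ p : E × E, (‖p.1‖ : ℂ) ^ (-2 * α₁) * (‖p.2‖ : ℂ) ^ (-2 * α₂) *
      (‖z - p.2‖ : ℂ) ^ (-2 * α₃) * (‖z - p.1‖ : ℂ) ^ (-2 * α₄) *
      (‖p.1 - p.2‖ : ℂ) ^ (-2 * α₅)) * (‖z‖ : ℂ) ^ (-2 * α₆) =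
    ((‖z‖ ^ Module.finrank ℝ E)⁻¹ : ℝ) *
      ∫ p : E × E, tetra α₁ α₂ α₃ α₄ α₅ α₆ p.1 ((‖z‖)⁻¹ • z) p.2 := by
  have hz' := norm_pos_iff.2 hz
  have hG := isConformalKernel_tetra (E := E) hα
  have hmp := measurePreserving_vertices z
  have h1 : Integrable fun p : E × E => tetra α₁ α₂ α₃ α₄ α₅ α₆ (p.1 - z) p.1 p.2 := by
    have := (hmp.integrable_comp_of_integrable hint).mul_const ((‖z‖ : ℂ) ^ (-2 * α₆))
    refine this.congr (Eventually.of_forall fun p => ?_)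
    exact tetra_vertices p.1 p.2
  have h2 : (∫ p : E × E, (‖p.1‖ : ℂ) ^ (-2 * α₁) * (‖p.2‖ : ℂ) ^ (-2 * α₂) *
      (‖z - p.2‖ : ℂ) ^ (-2 * α₃) * (‖z - p.1‖ : ℂ) ^ (-2 * α₄) *
      (‖p.1 - p.2‖ : ℂ) ^ (-2 * α₅)) * (‖z‖ : ℂ) ^ (-2 * α₆)
      = ∫ p : E × E, tetra α₁ α₂ α₃ α₄ α₅ α₆ (p.1 - z) p.1 p.2 := by
    have h := integral_map hmp.aemeasurable
      (hmp.map_eq.symm ▸ hint.aestronglyMeasurable)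
    rw [hmp.map_eq] at h
    rw [h, ← integral_mul_const]
    exact integral_congr_ae (Eventually.of_forall fun p => tetra_vertices p.1 p.2)
  have h3 := hG.swap_integrable hz h1
  have h4 := hG.swap_integral hz h1
  have hs : ∀ p : E × E, tetra α₁ α₂ α₃ α₄ α₅ α₆ (‖z‖ • p).1 z (‖z‖ • p).2
      = ((‖z‖ ^ (3 * Module.finrank ℝ E))⁻¹ : ℝ) •
        tetra α₁ α₂ α₃ α₄ α₅ α₆ p.1 ((‖z‖)⁻¹ • z) p.2 := by
    intro p
    rw [← hG.smul _ hz', smul_smul, mul_inv_cancel₀ hz'.ne', one_smul]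
    rfl
  have : (volume : Measure (E × E)).IsAddHaarMeasure :=
    Measure.prod.instIsAddHaarMeasure volume volume
  have hfr : Module.finrank ℝ (E × E) = 2 * Module.finrank ℝ E := by
    rw [Module.finrank_prod]; ring
  constructor
  · have h5 := (integrable_comp_smul_iff (volume : Measure (E × E)) _ hz'.ne').2 h3
    simp only [hs] at h5
    have hne : ((‖z‖ ^ (3 * Module.finrank ℝ E))⁻¹ : ℝ) ≠ 0 := by positivity
    exact (integrable_smul_iff hne _).1 h5
  · have h5 := Measure.integral_comp_smul (volume : Measure (E × E))
      (fun p => tetra α₁ α₂ α₃ α₄ α₅ α₆ p.1 z p.2) ‖z‖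
    simp only [hs] at h5
    rw [integral_smul, hfr, abs_of_pos (by positivity)] at h5
    rw [h2, h4, ← real_smul]
    have h6 : ((‖z‖ ^ Module.finrank ℝ E)⁻¹ : ℝ) = (‖z‖ ^ (2 * Module.finrank ℝ E)) *
      (‖z‖ ^ (3 * Module.finrank ℝ E))⁻¹ := by
      rw [show 3 * Module.finrank ℝ E = 2 * Module.finrank ℝ E + Module.finrank ℝ E by ring, pow_add]
      field_simp
    rw [h6, mul_smul, h5, smul_smul, mul_inv_cancel₀ (by positivity), one_smul]

end Tetra

section PolarTetra

open Metric Set Measure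

lemma measurePreserving_prod_rearrange {X Y : Type*} [MeasurableSpace X] [MeasurableSpace Y]
    (σ : Measure X) (ν : Measure Y) [SFinite σ] [SFinite ν] :
    MeasurePreserving (fun p : (Y × Y) × (X × X) => ((p.2.1, p.1.1), (p.2.2, p.1.2)))
      ((ν.prod ν).prod (σ.prod σ)) ((σ.prod ν).prod (σ.prod ν)) := by
  have h1 := measurePreserving_prodAssoc ν ν (σ.prod σ)
  have h2 := (MeasurePreserving.id ν).prod (measurePreserving_prodAssoc ν σ σ).symm
  have h3 := (MeasurePreserving.id ν).prod
    ((measurePreserving_swap (μ := ν) (ν := σ)).prod (MeasurePreserving.id σ))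
  have h4 := (MeasurePreserving.id ν).prod (measurePreserving_prodAssoc σ ν σ)
  have h5 := (measurePreserving_prodAssoc ν σ (ν.prod σ)).symm
  have h6 := (measurePreserving_swap (μ := ν) (ν := σ)).prod
    (measurePreserving_swap (μ := ν) (ν := σ))
  exact h6.comp (h5.comp (h4.comp (h3.comp (h2.comp h1))))

lemma ofReal_sq_cpow {x : ℝ} (hx : 0 ≤ x) (w : ℂ) : (((x ^ 2 : ℝ)) : ℂ) ^ w = (x : ℂ) ^ (2 * w) := by
  rw [pow_two, ofReal_mul, mul_cpow_ofReal_nonneg hx hx]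
  rcases eq_or_ne w 0 with rfl | hw
  · simp
  rcases eq_or_ne x 0 with rfl | hx0
  · simp [hw]
  · rw [← cpow_add _ _ (ofReal_ne_zero.2 hx0), two_mul]

lemma ofReal_exp_cpow (u : ℝ) (w : ℂ) : ((Real.exp u : ℝ) : ℂ) ^ w = cexp (u * w) := by
  rw [cpow_def_of_ne_zero (ofReal_ne_zero.2 (Real.exp_pos u).ne'), ← ofReal_log (Real.exp_pos u).le,
    Real.log_exp]

variable {E : Type*} [NormedAddCommGroup E] [InnerProductSpace ℝ E]

lemma norm_exp_smul_sub_cpow (γ : ℂ) (s t : ℝ) (ω η : sphere (0 : E) 1) :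
    (‖Real.exp s • (ω : E) - Real.exp t • (η : E)‖ : ℂ) ^ (-2 * γ)
      = cexp (-γ * (s + t)) * cosKer γ (s - t) (inner ℝ (η : E) (ω : E)) := by
  have hω : ‖(ω : E)‖ = 1 := by simp
  have hη : ‖(η : E)‖ = 1 := by simp
  have hn : ‖Real.exp s • (ω : E) - Real.exp t • (η : E)‖ ^ 2 =
      Real.exp (s + t) * (2 * Real.cosh (s - t) - 2 * inner ℝ (η : E) (ω : E)) := by
    rw [norm_sub_sq_real, norm_smul, norm_smul, hω, hη, real_inner_smul_left, real_inner_smul_right,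
      real_inner_comm, Real.cosh_eq, Real.norm_of_nonneg (Real.exp_pos s).le,
      Real.norm_of_nonneg (Real.exp_pos t).le, neg_sub, Real.exp_sub, Real.exp_sub, Real.exp_add]
    have h1 := (Real.exp_pos s).ne'
    have h2 := (Real.exp_pos t).ne'
    field_simp
    ring
  have hc : 0 ≤ 2 * Real.cosh (s - t) - 2 * inner ℝ (η : E) (ω : E) := by
    have := (abs_le.1 (abs_inner_sphere_le η ω)).2
    linarith [Real.one_le_cosh (s - t)]
  rw [show -2 * γ = 2 * -γ by ring, ← ofReal_sq_cpow (norm_nonneg _), hn, ofReal_mul,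
    mul_cpow_ofReal_nonneg (Real.exp_pos _).le hc, ofReal_exp_cpow, cosKer]
  congr 2
  push_cast
  ring

lemma norm_exp_smul_cpow (γ : ℂ) (s : ℝ) (ω : sphere (0 : E) 1) :
    (‖Real.exp s • (ω : E)‖ : ℂ) ^ (-2 * γ) = cexp (-2 * γ * s) := by
  have hω : ‖(ω : E)‖ = 1 := by simp
  rw [norm_smul, hω, mul_one, Real.norm_of_nonneg (Real.exp_pos s).le, ofReal_exp_cpow, mul_comm]

/-- The angular part of the kernel. -/
noncomputable def angKer (α₁ α₄ α₆ : ℂ) (e : sphere (0 : E) 1) (x : ℝ × ℝ)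
    (p : sphere (0 : E) 1 × sphere (0 : E) 1) : ℂ :=
  cosKer α₆ x.1 (inner ℝ (e : E) (p.1 : E)) *
    (cosKer α₁ (x.1 - x.2) (inner ℝ (p.2 : E) (p.1 : E)) * cosKer α₄ x.2 (inner ℝ (e : E) (p.2 : E)))

lemma tetra_polar (α₁ α₂ α₃ α₄ α₅ α₆ : ℂ) (d : ℕ) (e : sphere (0 : E) 1) (x : ℝ × ℝ)
    (p : sphere (0 : E) 1 × sphere (0 : E) 1) :
    (Real.exp (d * x.1) * Real.exp (d * x.2)) •
      tetra α₁ α₂ α₃ α₄ α₅ α₆ (Real.exp x.1 • (p.1 : E)) (e : E) (Real.exp x.2 • (p.2 : E)) =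
    cexp ((d - 2 * α₂ - α₁ - α₆) * x.1 + (d - 2 * α₅ - α₁ - α₄) * x.2) *
      angKer α₁ α₄ α₆ e x p := by
  have he : ‖(e : E)‖ = 1 := by simp
  have h4 := norm_exp_smul_sub_cpow α₄ x.2 0 p.2 e
  have h6 := norm_exp_smul_sub_cpow α₆ x.1 0 p.1 e
  have h1 := norm_exp_smul_sub_cpow α₁ x.1 x.2 p.1 p.2
  rw [Real.exp_zero, one_smul, sub_zero] at h4 h6
  rw [tetra, ← norm_neg ((e : E) - _), neg_sub, h4, h6, h1, norm_exp_smul_cpow, norm_exp_smul_cpow,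
    he, ofReal_one, one_cpow, real_smul, angKer]
  push_cast
  rw [show ((d : ℂ) - 2 * α₂ - α₁ - α₆) * x.1 + (d - 2 * α₅ - α₁ - α₄) * x.2
    = d * x.1 + d * x.2 + -α₁ * (x.1 + x.2) + -2 * α₂ * x.1 + -α₄ * (x.2 + 0)
      + -2 * α₅ * x.2 + -α₆ * (x.1 + 0) by ring]
  simp only [Complex.exp_add]
  ring

variable [FiniteDimensional ℝ E] [MeasurableSpace E] [BorelSpace E]

lemma expMeasure_prod (d : ℕ) : (expMeasure d).prod (expMeasure d) =
    (volume : Measure (ℝ × ℝ)).withDensity fun x =>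
      ENNReal.ofReal (Real.exp (d * x.1) * Real.exp (d * x.2)) := by
  rw [expMeasure, prod_withDensity (by fun_prop) (by fun_prop)]
  simp only [← ENNReal.ofReal_mul (Real.exp_pos _).le]
  rfl

variable [Nontrivial E] (μ : Measure E) [μ.IsAddHaarMeasure]

lemma toSphere_prod : μ.toSphere.prod μ.toSphere =
    (μ.toSphere univ * μ.toSphere univ) • (sphereProb μ).prod (sphereProb μ) := by
  have h : μ.toSphere = μ.toSphere univ • sphereProb μ := by
    rw [sphereProb, smul_smul, ENNReal.mul_inv_cancel, one_smul]
    · exact fun h => toSphere_ne_zero μ (measure_univ_eq_zero.1 h)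
    · exact measure_ne_top _ _
  conv_lhs => rw [h]
  rw [Measure.prod_smul_left, Measure.prod_smul_right, smul_smul]

/-- The tetrahedral integral in exponential polar coordinates. -/
theorem integral_tetra_polar {α₁ α₂ α₃ α₄ α₅ α₆ : ℂ} (e : sphere (0 : E) 1)
    (h : Integrable (fun p : E × E => tetra α₁ α₂ α₃ α₄ α₅ α₆ p.1 (e : E) p.2) (μ.prod μ)) :
    Integrable (fun q : (ℝ × ℝ) × (sphere (0 : E) 1 × sphere (0 : E) 1) =>
      cexp ((Module.finrank ℝ E - 2 * α₂ - α₁ - α₆) * q.1.1 +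
        (Module.finrank ℝ E - 2 * α₅ - α₁ - α₄) * q.1.2) * angKer α₁ α₄ α₆ e q.1 q.2)
      (volume.prod ((sphereProb μ).prod (sphereProb μ))) ∧
    ∫ p : E × E, tetra α₁ α₂ α₃ α₄ α₅ α₆ p.1 (e : E) p.2 ∂μ.prod μ =
      ((μ.toSphere.real univ) ^ 2 : ℝ) • ∫ x : ℝ × ℝ,
        cexp ((Module.finrank ℝ E - 2 * α₂ - α₁ - α₆) * x.1 +
          (Module.finrank ℝ E - 2 * α₅ - α₁ - α₄) * x.2) *
        ∫ p, angKer α₁ α₄ α₆ e x p ∂(sphereProb μ).prod (sphereProb μ) := by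
  set d := Module.finrank ℝ E with hd
  set σ := μ.toSphere with hσ
  have hmp := ((measurePreserving_polar μ).prod (measurePreserving_polar μ)).comp
    (measurePreserving_prod_rearrange σ (expMeasure d))
  have hmeas : (((expMeasure d).prod (expMeasure d)).prod (σ.prod σ)) =
      (σ univ * σ univ) • ((volume : Measure (ℝ × ℝ)).prod ((sphereProb μ).prod (sphereProb μ))).withDensity
        fun q => ENNReal.ofReal (Real.exp (d * q.1.1) * Real.exp (d * q.1.2)) := by
    rw [expMeasure_prod, prod_withDensity_left (by fun_prop), hσ, toSphere_prod,
      Measure.prod_smul_right, withDensity_smul_measure]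
  have hne : σ univ * σ univ ≠ 0 := by
    have : σ univ ≠ 0 := fun h => toSphere_ne_zero μ (measure_univ_eq_zero.1 h)
    exact mul_ne_zero this this
  have hnt : σ univ * σ univ ≠ ⊤ := ENNReal.mul_ne_top (measure_ne_top _ _) (measure_ne_top _ _)
  have hpt : ∀ q : (ℝ × ℝ) × (sphere (0 : E) 1 × sphere (0 : E) 1),
      (ENNReal.ofReal (Real.exp (d * q.1.1) * Real.exp (d * q.1.2))).toReal •
        tetra α₁ α₂ α₃ α₄ α₅ α₆ (Real.exp q.1.1 • (q.2.1 : E)) (e : E) (Real.exp q.1.2 • (q.2.2 : E))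
      = cexp ((d - 2 * α₂ - α₁ - α₆) * q.1.1 + (d - 2 * α₅ - α₁ - α₄) * q.1.2) *
      angKer α₁ α₄ α₆ e q.1 q.2 := by
    intro q
    rw [ENNReal.toReal_ofReal (by positivity), tetra_polar]
  have hI : Integrable (fun q : (ℝ × ℝ) × (sphere (0 : E) 1 × sphere (0 : E) 1) =>
      cexp ((d - 2 * α₂ - α₁ - α₆) * q.1.1 + (d - 2 * α₅ - α₁ - α₄) * q.1.2) *
      angKer α₁ α₄ α₆ e q.1 q.2) (volume.prod ((sphereProb μ).prod (sphereProb μ))) := by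
    have h1 := hmp.integrable_comp_of_integrable h
    rw [hmeas, integrable_smul_measure hne hnt,
      integrable_withDensity_iff_integrable_smul' (by fun_prop) (by simp)] at h1
    exact h1.congr (ae_of_all _ hpt)
  refine ⟨hI, ?_⟩
  have h2 := integral_map hmp.aemeasurable (hmp.map_eq.symm ▸ h.aestronglyMeasurable)
  rw [hmp.map_eq] at h2
  rw [h2, hmeas, integral_smul_measure,
    integral_withDensity_eq_integral_toReal_smul (by fun_prop) (by simp)]
  have h3 : (σ univ * σ univ).toReal = σ.real univ ^ 2 := by
    rw [ENNReal.toReal_mul, pow_two]; rfl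
  rw [h3]
  congr 1
  refine (integral_congr_ae (ae_of_all _ hpt)).trans ?_
  rw [integral_prod _ hI]
  simp only [integral_const_mul]

end PolarTetra

section LocalIntegrability

open Metric Set Measure

variable {E : Type*} [NormedAddCommGroup E] [InnerProductSpace ℝ E] [FiniteDimensional ℝ E]
  [MeasurableSpace E] [BorelSpace E] [Nontrivial E] (μ : Measure E) [μ.IsAddHaarMeasure]

lemma re_lt_of_integrable {γ : ℂ} {p : E} {h : E → ℂ} (hc : ContinuousAt h p) (hp : h p ≠ 0)
    (hi : Integrable (fun a => (‖a - p‖ : ℂ) ^ (-2 * γ) * h a) μ) :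
    2 * γ.re < Module.finrank ℝ E := by
  have hev : ∀ᶠ a in 𝓝 p, ‖h p‖ / 2 < ‖h a‖ :=
    hc.norm.eventually_const_lt (half_lt_self (norm_pos_iff.2 hp))
  obtain ⟨ρ, hρ, hb⟩ := Metric.eventually_nhds_iff_ball.1 hev
  have hi2 : Integrable (fun a => (‖a‖ : ℂ) ^ (-2 * γ) * h (a + p)) μ := by
    simpa using hi.comp_add_right p
  have h1 : IntegrableOn (fun a : E => ‖a‖ ^ (-2 * γ.re)) (ball 0 ρ) μ := by
    have h2 : IntegrableOn (fun a : E => (‖h p‖ / 2)⁻¹ * ‖(‖a‖ : ℂ) ^ (-2 * γ) * h (a + p)‖)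
      (ball 0 ρ) μ := (hi2.norm.const_mul _).integrableOn
    refine Integrable.mono' h2 (measurable_norm.pow_const _).aestronglyMeasurable ?_
    refine (ae_restrict_iff' measurableSet_ball).2 ?_
    have hz : ∀ᵐ a ∂μ, a ≠ 0 := by rw [ae_iff]; simp
    filter_upwards [hz] with a ha hab
    have ha' := norm_pos_iff.2 ha
    have h3 := hb (a + p) (by simpa using hab)
    have h4 := norm_pos_iff.2 hp
    rw [norm_mul, norm_cpow_eq_rpow_re_of_pos ha', Real.norm_of_nonneg (by positivity)]
    have h5 : (-2 * γ).re = -2 * γ.re := by simp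
    rw [h5, ← mul_assoc, mul_comm _ (‖a‖ ^ _), mul_assoc]
    refine le_mul_of_one_le_right (by positivity) ?_
    rw [inv_mul_eq_div, one_le_div (by positivity)]
    exact h3.le
  rw [integrableOn_fun_norm_addHaar μ (f := fun y => y ^ (-2 * γ.re))] at h1
  have hd := Module.finrank_pos (R := ℝ) (M := E)
  have h6 : IntegrableOn (fun y : ℝ => y ^ ((Module.finrank ℝ E : ℝ) - 1 + -2 * γ.re)) (Ioo 0 ρ) := by
    refine h1.congr_fun (fun y hy => ?_) measurableSet_Ioo
    simp only [smul_eq_mul]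
    rw [Real.rpow_add hy.1, ← Real.rpow_natCast, Nat.cast_sub hd, Nat.cast_one]
  rw [intervalIntegral.integrableOn_Ioo_rpow_iff hρ] at h6
  linarith

lemma continuousAt_norm_sub_cpow {p q : E} (h : p ≠ q) (s : ℂ) :
    ContinuousAt (fun a : E => (‖a - q‖ : ℂ) ^ s) p := by
  exact ContinuousAt.cpow (by fun_prop) continuousAt_const
    (ofReal_mem_slitPlane.2 (norm_pos_iff.2 (sub_ne_zero.2 h)))

lemma norm_sub_cpow_ne_zero {p q : E} (h : p ≠ q) (s : ℂ) : (‖p - q‖ : ℂ) ^ s ≠ 0 := by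
  rw [Ne, cpow_eq_zero_iff]
  simp [sub_eq_zero, h]

theorem re_lt_of_integrable_tetra {α₁ α₂ α₃ α₄ α₅ α₆ : ℂ} {e : E} (he : e ≠ 0)
    (h : Integrable (fun p : E × E => tetra α₁ α₂ α₃ α₄ α₅ α₆ p.1 e p.2) (μ.prod μ)) :
    2 * α₁.re < Module.finrank ℝ E ∧ 2 * α₄.re < Module.finrank ℝ E ∧
      2 * α₆.re < Module.finrank ℝ E := by
  have hz : ∀ q : E, ∀ᵐ a ∂μ, a ≠ q := fun q => by rw [ae_iff]; simp
  obtain ⟨c, hc, hc0, hce⟩ := (h.prod_left_ae.and ((hz 0).and (hz e))).exists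
  obtain ⟨a, ha, ha0, hae⟩ := (h.prod_right_ae.and ((hz 0).and (hz e))).exists
  simp only [tetra] at hc ha
  have s0 : ∀ v : E, (‖v‖ : ℂ) = ‖v - 0‖ := fun v => by rw [sub_zero]
  have K := fun {p q : E} (h : p ≠ q) (s : ℂ) => continuousAt_norm_sub_cpow h s
  have N := fun {p q : E} (h : p ≠ q) (s : ℂ) => norm_sub_cpow_ne_zero h s
  have C := fun (p : E) (s : ℂ) => continuousAt_const (x := p) (y := s)
  refine ⟨?_, ?_, ?_⟩
  · refine re_lt_of_integrable μ (γ := α₁) (p := c) (h := fun a => (‖a - 0‖ : ℂ) ^ (-2 * α₂) *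
      ((‖e - 0‖ : ℂ) ^ (-2 * α₃) * (‖e - c‖ : ℂ) ^ (-2 * α₄) * (‖c - 0‖ : ℂ) ^ (-2 * α₅)) *
      (‖a - e‖ : ℂ) ^ (-2 * α₆)) (((K hc0 _).mul (C _ _)).mul (K hce _)) ?_ ?_
    · exact mul_ne_zero (mul_ne_zero (N hc0 _) (mul_ne_zero (mul_ne_zero (N he _) (N hce.symm _))
        (N hc0 _))) (N hce _)
    · refine hc.congr (ae_of_all _ fun a => ?_)
      simp only [sub_zero]; ring
  · refine re_lt_of_integrable μ (γ := α₄) (p := e) (h := fun c => (‖c - a‖ : ℂ) ^ (-2 * α₁) *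
      ((‖a - 0‖ : ℂ) ^ (-2 * α₂) * (‖e - 0‖ : ℂ) ^ (-2 * α₃) * (‖a - e‖ : ℂ) ^ (-2 * α₆)) *
      (‖c - 0‖ : ℂ) ^ (-2 * α₅)) (((K hae.symm _).mul (C _ _)).mul (K he _)) ?_ ?_
    · exact mul_ne_zero (mul_ne_zero (N hae.symm _) (mul_ne_zero (mul_ne_zero (N ha0 _) (N he _))
        (N hae _))) (N he _)
    · refine ha.congr (ae_of_all _ fun c => ?_)
      simp only [sub_zero]
      rw [norm_sub_rev c e, norm_sub_rev c a]; ring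
  · refine re_lt_of_integrable μ (γ := α₆) (p := e) (h := fun a => (‖a - c‖ : ℂ) ^ (-2 * α₁) *
      (‖a - 0‖ : ℂ) ^ (-2 * α₂) * ((‖e - 0‖ : ℂ) ^ (-2 * α₃) * (‖e - c‖ : ℂ) ^ (-2 * α₄) *
      (‖c - 0‖ : ℂ) ^ (-2 * α₅))) (((K hce.symm _).mul (K he _)).mul (C _ _)) ?_ ?_
    · exact mul_ne_zero (mul_ne_zero (N hce.symm _) (N he _))
        (mul_ne_zero (mul_ne_zero (N he _) (N hce.symm _)) (N hc0 _))
    · refine hc.congr (ae_of_all _ fun a => ?_)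
      simp only [sub_zero]; ring

end LocalIntegrability

section Exchange

open Metric Set Measure

lemma measurable_zonal (D : ℝ) (γ : ℂ) (n : ℕ) : Measurable (zonal D γ n) := by
  unfold zonal binCoef
  refine Measurable.tsum fun i => ?_
  have h : Measurable fun s : ℝ => ((2 * Real.cosh s : ℝ) : ℂ) :=
    continuous_ofReal.measurable.comp (Real.continuous_cosh.measurable.const_mul 2)
  exact ((h.pow_const _).const_mul _).mul_const _

variable {E : Type*} [NormedAddCommGroup E] [InnerProductSpace ℝ E] [FiniteDimensional ℝ E]
  [MeasurableSpace E] [BorelSpace E] [Nontrivial E] (μ : Measure E) [μ.IsAddHaarMeasure]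

/-- The zonal expansion of the angular integral may be integrated term by term. -/
theorem hasSum_integral_radial {D : ℝ} (hD1 : 1 < D) (hD : 2 * D = Module.finrank ℝ E)
    {α₁ α₄ α₆ A B : ℂ} (a₁ : Admissible D α₁) (a₄ : Admissible D α₄) (a₆ : Admissible D α₆)
    (e : sphere (0 : E) 1)
    (hi : Integrable (fun q : (ℝ × ℝ) × (sphere (0 : E) 1 × sphere (0 : E) 1) =>
      cexp (A * q.1.1 + B * q.1.2) * angKer α₁ α₄ α₆ e q.1 q.2)
      (volume.prod ((sphereProb μ).prod (sphereProb μ)))) :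
    HasSum (fun n => (zdim D n : ℂ) * ∫ x : ℝ × ℝ, cexp (A * x.1 + B * x.2) *
        (radial D α₁ n (x.1 - x.2) * (radial D α₄ n x.2 * radial D α₆ n x.1)))
      (∫ x : ℝ × ℝ, cexp (A * x.1 + B * x.2) *
        ∫ p, angKer α₁ α₄ α₆ e x p ∂(sphereProb μ).prod (sphereProb μ)) := by
  obtain ⟨C, hC⟩ := exists_sum_norm_zonal_le μ hD1 hD e a₆.re_pos a₁.re_pos a₄.re_pos
  set w : ℝ × ℝ → ℂ := fun x => cexp (A * x.1 + B * x.2) with hw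
  set G : ℕ → ℝ × ℝ → ℂ := fun n x => (zdim D n : ℂ) * (zonal D α₆ n x.1 *
    (zonal D α₁ n (x.1 - x.2) * zonal D α₄ n x.2)) with hG
  have hwm : Measurable w := by
    rw [hw]; fun_prop
  have hGm : ∀ n, Measurable (G n) := fun n =>
    (((measurable_zonal D α₆ n).comp measurable_fst).mul
      (((measurable_zonal D α₁ n).comp (measurable_fst.sub measurable_snd)).mul
        ((measurable_zonal D α₄ n).comp measurable_snd))).const_mul _
  have hFm : ∀ n, Measurable fun x => w x * G n x := fun n => hwm.mul (hGm n)
  have hreg : ∀ᵐ x : ℝ × ℝ, x.1 ≠ 0 ∧ x.2 ≠ 0 ∧ x.1 - x.2 ≠ 0 := by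
    filter_upwards [ae_regions] with x hx
    exact ⟨hx.1, hx.2.1, sub_ne_zero.2 hx.2.2⟩
  have key : HasSum (fun n => ∫ x, w x * G n x) (∫ x : ℝ × ℝ, w x *
        ∫ p, angKer α₁ α₄ α₆ e x p ∂(sphereProb μ).prod (sphereProb μ)) := by
    refine hasSum_integral_of_dominated_convergence (fun n x => ‖w x * G n x‖)
      (fun n => (hFm n).aestronglyMeasurable) (fun n => Eventually.of_forall fun x => le_rfl)
      ?_ ?_ ?_
    · filter_upwards [hreg] with x hx
      obtain ⟨S, hS, -⟩ := hC x.1 (x.1 - x.2) x.2 hx.1 hx.2.2 hx.2.1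
      have h2 := (hS.mul_left ‖w x‖).summable
      exact h2.congr fun n => (norm_mul _ _).symm
    · have hb := (hi.integral_norm_prod_left).const_mul C
      refine Integrable.mono' hb
        (Measurable.tsum fun n => (hFm n).norm).aestronglyMeasurable ?_
      filter_upwards [hreg] with x hx
      obtain ⟨S, hS, hSle⟩ := hC x.1 (x.1 - x.2) x.2 hx.1 hx.2.2 hx.2.1
      have h2 : HasSum (fun n => ‖w x * G n x‖) (‖w x‖ * S) :=
        (hS.mul_left ‖w x‖).congr_fun fun n => (norm_mul _ _)
      rw [h2.tsum_eq, Real.norm_of_nonneg (h2.nonneg fun n => norm_nonneg _)]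
      have h3 : ∫ p, ‖cexp (A * x.1 + B * x.2) * angKer α₁ α₄ α₆ e x p‖
          ∂(sphereProb μ).prod (sphereProb μ) = ‖w x‖ * ∫ p, ‖angKer α₁ α₄ α₆ e x p‖
          ∂(sphereProb μ).prod (sphereProb μ) := by
        rw [← integral_const_mul]
        exact integral_congr_ae (Eventually.of_forall fun p => norm_mul _ _)
      rw [h3]
      calc ‖w x‖ * S ≤ ‖w x‖ * (C * _) := mul_le_mul_of_nonneg_left hSle (norm_nonneg _)
        _ = _ := by rw [mul_left_comm]; rfl
    · filter_upwards [hreg] with x hx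
      exact (hasSum_zonal μ hD1 hD e a₆.re_pos a₁.re_pos a₄.re_pos hx.1 hx.2.2 hx.2.1).mul_left _
  refine key.congr_fun fun n => ?_
  rw [← integral_const_mul]
  refine integral_congr_ae ?_
  filter_upwards [hreg] with x hx
  simp only [hG, hw]
  rw [zonal_eq_radial hD1 a₁ n hx.2.2, zonal_eq_radial hD1 a₄ n hx.2.1,
    zonal_eq_radial hD1 a₆ n hx.1]
  ring

end Exchange

section GammaForms

open Metric Set Measure

lemma ccoef_eq_Gamma {D g : ℂ} (hD : 0 < D.re) (a : Admissible D g) (n k : ℕ) :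
    ccoef D g n k = (-1) ^ k / k.factorial * (Gamma D * Gamma (D - g) / Gamma g) *
      (Gamma (g + n + k) / (Gamma (D - g - k) * Gamma (D + n + k))) := by
  have e1 := Gamma_add_nat (ne_neg_nat_of_re_pos a.re_pos) (n + k)
  have e2 := Gamma_add_nat (ne_neg_nat_of_re_pos hD) (n + k)
  have e3 := Gamma_sub_nat a.compl_ne_nat k
  push_cast at e1 e2
  rw [← add_assoc] at e1 e2
  have g1 := Gamma_ne_zero_of_re_pos a.re_pos
  have g2 := Gamma_ne_zero_of_re_pos hD
  have g3 := Gamma_ne_zero_of_re_pos a.compl_re_pos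
  have p2 := poch_ne_zero (ne_neg_nat_of_re_pos hD) (n + k)
  have g4 : Gamma (D - g - k) ≠ 0 := by
    intro h
    rw [h, zero_mul] at e3
    exact mul_ne_zero (pow_ne_zero k (by norm_num : (-1 : ℂ) ≠ 0)) g3 e3.symm
  have hk : (k.factorial : ℂ) ≠ 0 := Nat.cast_ne_zero.2 k.factorial_ne_zero
  rw [ccoef, e1, e2]
  field_simp
  linear_combination poch g (n + k) * e3

lemma hval_of_eq {D g w u v u' v' : ℂ} {n : ℕ} (hu : (g + n + w) / 2 = u)
    (hv : (g + n - w) / 2 = v) (hu' : u + (D - g) = u') (hv' : v + (D - g) = v') :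
    hval D g n w = Gamma D * Gamma (D - g) / Gamma g / 2 *
      (Gamma u / Gamma u' * (Gamma v / Gamma v')) := by
  rw [hval, hu, hv, hu', hv']
  ring

lemma ne_int_of_ne_nat {u : ℂ} (h : ∀ k : ℕ, u - k ≠ 0) (h' : ∀ k : ℕ, -u - k ≠ 0) (m : ℤ) :
    u ≠ m := by
  obtain ⟨k, rfl | rfl⟩ := m.eq_nat_or_neg
  · exact fun e => h k (by rw [e]; simp)
  · exact fun e => h' k (by rw [e]; simp)

lemma zdim_eq {D : ℝ} (hD : 1 < D) (n : ℕ) :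
    (zdim D n : ℂ) = (n + D - 1) * Gamma (n + 2 * D - 2) / n.factorial /
      ((D - 1) * Gamma (2 * D - 2)) := by
  have hre : 0 < (2 * (D - 1) : ℂ).re := by
    simp [Complex.mul_re]; exact hD
  have e := Gamma_add_nat (ne_neg_nat_of_re_pos hre) n
  have g1 := Gamma_ne_zero_of_re_pos hre
  have hD1 : (D : ℂ) - 1 ≠ 0 := by
    rw [← ofReal_one, ← ofReal_sub, ofReal_ne_zero]; linarith
  have hk : (n.factorial : ℂ) ≠ 0 := Nat.cast_ne_zero.2 n.factorial_ne_zero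
  rw [show (n + 2 * D - 2 : ℂ) = 2 * (D - 1) + n by ring,
    show (2 * D - 2 : ℂ) = 2 * (D - 1) by ring, e, zdim]
  push_cast [poch_ofReal]
  generalize Gamma (2 * ((D : ℂ) - 1)) = G at g1
  field_simp
  ring

lemma toSphere_real_univ (d : ℕ) (hd : 0 < d) [Nontrivial (EuclideanSpace ℝ (Fin d))] :
    (volume : Measure (EuclideanSpace ℝ (Fin d))).toSphere.real univ =
      2 * √Real.pi ^ d / Real.Gamma (d / 2) := by
  have : Nonempty (Fin d) := ⟨⟨0, hd⟩⟩
  have hd' : (0 : ℝ) < d := by exact_mod_cast hd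
  have hG := Real.Gamma_pos_of_pos (half_pos hd')
  rw [toSphere_real_apply_univ, measureReal_def, EuclideanSpace.volume_ball, finrank_euclideanSpace_fin,
    Fintype.card_fin, ENNReal.ofReal_one, one_pow, one_mul, ENNReal.toReal_ofReal,
    Real.Gamma_add_one (half_pos hd').ne']
  · field_simp
  · rw [Real.Gamma_add_one (half_pos hd').ne']; positivity

end GammaForms

section Assembly

/-- The radial integral as a sum of three series of Gamma quotients. -/
theorem radial_integral_eq_tsum {d : ℕ} {D α₁ α₂ α₃ α₄ α₅ α₆ A B : ℂ}
    (hα₆ : α₆ = 3 * (d : ℂ) / 2 - (α₁ + α₂ + α₃ + α₄ + α₅))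
    (hA : A = d - 2 * α₂ - α₁ - α₆) (hB : B = d - 2 * α₅ - α₁ - α₄) (hDc : D = (d : ℂ) / 2)
    (hDpos : 0 < D.re) (a₁ : Admissible D α₁) (a₄ : Admissible D α₄) (a₆ : Admissible D α₆)
    (hD : 1 < 2 * (D - α₁).re + 2 * (D - α₄).re + 2 * (D - α₆).re)
    (h1 : 0 < (α₆ + α₁ - A).re) (h2 : 0 < (α₆ + α₁ + A).re)
    (h3 : 0 < (α₁ + α₄ - B).re) (h4 : 0 < (α₁ + α₄ + B).re) (h5 : 0 < (α₄ + α₆ - (A + B)).re)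
    (h6 : 0 < (α₄ + α₆ + (A + B)).re)
    (z1 : ∀ m : ℤ, (α₄ - α₁ + B) / 2 ≠ m) (z2 : ∀ m : ℤ, (α₆ - α₁ - A) / 2 ≠ m)
    (z3 : ∀ m : ℤ, (α₆ - α₄ - (A + B)) / 2 ≠ m) {T₁ T₂ T₃ : ℕ → ℕ → ℂ}
    (hT₁ : ∀ n k : ℕ, T₁ n k = (-1 : ℂ) ^ k / (k.factorial : ℂ) *
      (Gamma (α₄ + n + k) * Gamma ((d : ℂ) / 2 - α₅ + n + k) *
        Gamma ((α₁ + α₅) - (d : ℂ) / 2 - k) * Gamma ((d : ℂ) - (α₁ + α₂ + α₅) + n + k) *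
        Gamma ((d : ℂ) / 2 - (α₃ + α₄) - k) /
      (Gamma ((d : ℂ) / 2 - α₄ - k) * Gamma (α₅ - k) * Gamma ((d : ℂ) - (α₁ + α₅) + n + k) *
        Gamma ((α₁ + α₂ + α₅) - (d : ℂ) / 2 - k) * Gamma ((α₃ + α₄) + n + k) *
        Gamma ((d : ℂ) / 2 + n + k))))
    (hT₂ : ∀ n k : ℕ, T₂ n k = (-1 : ℂ) ^ k / (k.factorial : ℂ) *
      (Gamma ((α₁ + α₄ + α₅) - (d : ℂ) / 2 + n + k) * Gamma ((d : ℂ) / 2 - (α₁ + α₅) - k) *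
        Gamma (α₁ + n + k) * Gamma ((d : ℂ) / 2 - α₂ + n + k) *
        Gamma ((d : ℂ) - (α₁ + α₃ + α₄ + α₅) - k) /
      (Gamma ((d : ℂ) - (α₁ + α₄ + α₅) - k) * Gamma ((α₁ + α₅) + n + k) *
        Gamma ((d : ℂ) / 2 - α₁ - k) * Gamma (α₂ - k) *
        Gamma ((α₁ + α₃ + α₄ + α₅) - (d : ℂ) / 2 + n + k) * Gamma ((d : ℂ) / 2 + n + k))))
    (hT₃ : ∀ n k : ℕ, T₃ n k = (-1 : ℂ) ^ k / (k.factorial : ℂ) *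
      (Gamma ((d : ℂ) / 2 - α₃ + n + k) * Gamma ((α₃ + α₄) - (d : ℂ) / 2 - k) *
        Gamma ((d : ℂ) - (α₃ + α₄ + α₅) + n + k) * Gamma ((α₁ + α₃ + α₄ + α₅) - (d : ℂ) - k) *
        Gamma (α₆ + n + k) /
      (Gamma (α₃ - k) * Gamma ((d : ℂ) - (α₃ + α₄) + n + k) *
        Gamma ((α₃ + α₄ + α₅) - (d : ℂ) / 2 - k) *
        Gamma (3 * (d : ℂ) / 2 - (α₁ + α₃ + α₄ + α₅) + n + k) *
        Gamma ((α₁ + α₂ + α₃ + α₄ + α₅) - (d : ℂ) - k) * Gamma ((d : ℂ) / 2 + n + k)))) (n : ℕ) :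
    ∫ x : ℝ × ℝ, cexp (A * x.1 + B * x.2) *
      (radial D α₁ n (x.1 - x.2) * (radial D α₄ n x.2 * radial D α₆ n x.1)) =
      Gamma D ^ 3 * ((Gamma (D - α₁) / Gamma α₁) * (Gamma (D - α₄) / Gamma α₄) *
        (Gamma (D - α₆) / Gamma α₆)) / 4 *
      ((∑' k, T₁ n k) + (∑' k, T₂ n k) + ∑' k, T₃ n k) := by
  have hκ : ∀ k : ℕ, D - α₆ - k = (α₁ + α₂ + α₃ + α₄ + α₅) - (d : ℂ) - k := fun k => by
    rw [hDc, hα₆]; ring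
  set K : ℂ := Gamma D ^ 3 * ((Gamma (D - α₁) / Gamma α₁) * (Gamma (D - α₄) / Gamma α₄) *
    (Gamma (D - α₆) / Gamma α₆)) / 4 with hK
  obtain ⟨S₁, S₂, S₃, k₁, k₂, k₃, hS⟩ := radial_integral_eq (A := A) (B := B) n a₁ a₄ a₆
    hD h1 h2 h3 h4 h5 h6 z1 z2 z3
  rw [hS, ← k₁.tsum_eq, ← k₂.tsum_eq, ← k₃.tsum_eq, mul_add, mul_add, ← tsum_mul_left,
    ← tsum_mul_left, ← tsum_mul_left, add_comm (∑' k, K * T₁ n k)]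
  congr 1
  · congr 1
    · refine tsum_congr fun k => ?_
      rw [ccoef_eq_Gamma hDpos a₁,
        hval_of_eq (u := (α₁ + α₄ + α₅) - (d : ℂ) / 2 + n + k) (v := (d : ℂ) / 2 - (α₁ + α₅) - k)
          (u' := (α₁ + α₅) + n + k) (v' := (d : ℂ) - (α₁ + α₄ + α₅) - k)
          (by simp only [hB]; ring) (by simp only [hB]; ring) (by simp only [hDc]; ring)
          (by simp only [hDc]; ring),
        hval_of_eq (u := (d : ℂ) / 2 - α₂ + n + k) (v := (d : ℂ) - (α₁ + α₃ + α₄ + α₅) - k)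
          (u' := (α₁ + α₃ + α₄ + α₅) - (d : ℂ) / 2 + n + k) (v' := α₂ - k)
          (by simp only [hA, hα₆]; ring) (by simp only [hA, hα₆]; ring) (by simp only [hα₆, hDc]; ring)
          (by simp only [hα₆, hDc]; ring),
        hT₂, hK, hDc]
      ring
    · refine tsum_congr fun k => ?_
      rw [ccoef_eq_Gamma hDpos a₄,
        hval_of_eq (u := (d : ℂ) / 2 - α₅ + n + k) (v := (α₁ + α₅) - (d : ℂ) / 2 - k)
          (u' := (d : ℂ) - (α₁ + α₅) + n + k) (v' := α₅ - k)
          (by simp only [hB]; ring) (by simp only [hB]; ring) (by simp only [hDc]; ring)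
          (by simp only [hDc]; ring),
        hval_of_eq (u := (d : ℂ) - (α₁ + α₂ + α₅) + n + k) (v := (d : ℂ) / 2 - (α₃ + α₄) - k)
          (u' := (α₃ + α₄) + n + k) (v' := (α₁ + α₂ + α₅) - (d : ℂ) / 2 - k)
          (by simp only [hA, hB, hα₆]; ring) (by simp only [hA, hB, hα₆]; ring) (by simp only [hα₆, hDc]; ring)
          (by simp only [hα₆, hDc]; ring),
        hT₁, hK, hDc]
      ring
  · refine tsum_congr fun k => ?_
    rw [ccoef_eq_Gamma hDpos a₆,
      hval_of_eq (u := (d : ℂ) - (α₃ + α₄ + α₅) + n + k) (v := (α₁ + α₃ + α₄ + α₅) - (d : ℂ) - k)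
        (u' := 3 * (d : ℂ) / 2 - (α₁ + α₃ + α₄ + α₅) + n + k) (v' := (α₃ + α₄ + α₅) - (d : ℂ) / 2 - k)
        (by simp only [hA, hα₆]; ring) (by simp only [hA, hα₆]; ring) (by simp only [hDc]; ring)
        (by simp only [hDc]; ring),
      hval_of_eq (u := (d : ℂ) / 2 - α₃ + n + k) (v := (α₃ + α₄) - (d : ℂ) / 2 - k)
        (u' := (d : ℂ) - (α₃ + α₄) + n + k) (v' := α₃ - k)
        (by simp only [hA, hB, hα₆]; ring) (by simp only [hA, hB, hα₆]; ring) (by simp only [hDc]; ring)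
        (by simp only [hDc]; ring),
      hT₃, hK, hκ k, hDc]
    ring

lemma constant_eq {D : ℝ} (hD : 1 < D) (P G a₁ a₄ u v X r : ℂ) :
    r * (4 * P / Gamma D ^ 2 * (Gamma D ^ 3 * (a₁ * a₄ * (u / v)) / 4 / ((D - 1) * G) * X)) =
      P * (Gamma (D - 1) / G) * (a₁ * a₄ / (v / u)) * X * r := by
  have hD10 : (D : ℂ) - 1 ≠ 0 := by
    rw [← ofReal_one, ← ofReal_sub, ofReal_ne_zero]; linarith
  have hG : Gamma (D : ℂ) = (D - 1) * Gamma (D - 1) := by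
    rw [← Gamma_add_one _ hD10, sub_add_cancel]
  have hG0 : Gamma (D : ℂ) ≠ 0 := Gamma_ne_zero_of_re_pos (by rw [ofReal_re]; linarith)
  have hc : Gamma ((D : ℂ) - 1) = Gamma (D : ℂ) / (D - 1) := by
    rw [hG]; field_simp
  rw [hc, div_div_eq_mul_div]
  field_simp

end Assembly
end TwoLoop

/-- **The d-dimensional two-loop master diagram.** Let `d ≥ 3`, `0 ≠ z ∈ ℝ^d`,
and `α₁,…,α₅ ∈ ℂ`.  Assuming (i) absolute convergence of the double integral
`I(α₁,…,α₅) = ∫∫ ‖x‖^{−2α₁}‖y‖^{−2α₂}‖z−y‖^{−2α₃}‖z−x‖^{−2α₄}‖x−y‖^{−2α₅} dx dy`,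
(ii) the pole-separation and decay conditions, and (iii) absolute convergence
of the three double series `I₁, I₂, I₃` with no Gamma factor at a pole, we have
`I(α₁,…,α₅) = C·‖z‖^{−2(α₁₂₃₄₅−d)}` with
`C = π^d (Γ(d/2−1)/Γ(d−2)) (a₀(α₁)a₀(α₄)/a₀(α₁₂₃₄₅−d)) (I₁+I₂+I₃)`,
`a₀(γ) = Γ(d/2−γ)/Γ(γ)`, `Iᵢ = ∑ₙ Mₙ ∑ₖ Tᵢ(n,k)` and
`Mₙ = (n+d/2−1)Γ(n+d−2)/n!`. -/
theorem stmt10 (d : ℕ) (hd : 3 ≤ d) (z : EuclideanSpace ℝ (Fin d)) (hz : z ≠ 0)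
    (α₁ α₂ α₃ α₄ α₅ : ℂ)
    -- (i) absolute convergence of the double integral :
    (hint : Integrable (fun p : EuclideanSpace ℝ (Fin d) × EuclideanSpace ℝ (Fin d) =>
      (‖p.1‖ : ℂ) ^ (-2 * α₁) * (‖p.2‖ : ℂ) ^ (-2 * α₂) * (‖z - p.2‖ : ℂ) ^ (-2 * α₃) *
        (‖z - p.1‖ : ℂ) ^ (-2 * α₄) * (‖p.1 - p.2‖ : ℂ) ^ (-2 * α₅)) volume)
    -- (ii) pole-separation and decay conditions :
    (h₁ : α₄.re > d / 4) (h₂ : (α₁ + α₄ + α₅).re > 3 * d / 4) (h₃ : α₃.re < d / 4)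
    (h₄ : (α₄ + α₅).re < 3 * d / 4) (h₅ : (α₁ + α₂ + α₄ + α₅).re < 5 * d / 4)
    (h₆ : (α₂ + α₃ + α₅).re > 1 / 2)
    -- the coefficients Mₙ and the terms of the series I₁, I₂, I₃ :
    (M : ℕ → ℂ)
    (hM : ∀ n : ℕ, M n = ((n : ℂ) + d / 2 - 1) * Gamma ((n : ℂ) + d - 2) / (n.factorial : ℂ))
    (T₁ T₂ T₃ : ℕ → ℕ → ℂ)
    (hT₁ : ∀ n k : ℕ, T₁ n k = (-1 : ℂ) ^ k / (k.factorial : ℂ) *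
      (Gamma (α₄ + n + k) * Gamma ((d : ℂ) / 2 - α₅ + n + k) *
        Gamma ((α₁ + α₅) - (d : ℂ) / 2 - k) * Gamma ((d : ℂ) - (α₁ + α₂ + α₅) + n + k) *
        Gamma ((d : ℂ) / 2 - (α₃ + α₄) - k) /
      (Gamma ((d : ℂ) / 2 - α₄ - k) * Gamma (α₅ - k) * Gamma ((d : ℂ) - (α₁ + α₅) + n + k) *
        Gamma ((α₁ + α₂ + α₅) - (d : ℂ) / 2 - k) * Gamma ((α₃ + α₄) + n + k) *
        Gamma ((d : ℂ) / 2 + n + k))))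
    (hT₂ : ∀ n k : ℕ, T₂ n k = (-1 : ℂ) ^ k / (k.factorial : ℂ) *
      (Gamma ((α₁ + α₄ + α₅) - (d : ℂ) / 2 + n + k) * Gamma ((d : ℂ) / 2 - (α₁ + α₅) - k) *
        Gamma (α₁ + n + k) * Gamma ((d : ℂ) / 2 - α₂ + n + k) *
        Gamma ((d : ℂ) - (α₁ + α₃ + α₄ + α₅) - k) /
      (Gamma ((d : ℂ) - (α₁ + α₄ + α₅) - k) * Gamma ((α₁ + α₅) + n + k) *
        Gamma ((d : ℂ) / 2 - α₁ - k) * Gamma (α₂ - k) *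
        Gamma ((α₁ + α₃ + α₄ + α₅) - (d : ℂ) / 2 + n + k) * Gamma ((d : ℂ) / 2 + n + k))))
    (hT₃ : ∀ n k : ℕ, T₃ n k = (-1 : ℂ) ^ k / (k.factorial : ℂ) *
      (Gamma ((d : ℂ) / 2 - α₃ + n + k) * Gamma ((α₃ + α₄) - (d : ℂ) / 2 - k) *
        Gamma ((d : ℂ) - (α₃ + α₄ + α₅) + n + k) * Gamma ((α₁ + α₃ + α₄ + α₅) - (d : ℂ) - k) *
        Gamma (3 * (d : ℂ) / 2 - (α₁ + α₂ + α₃ + α₄ + α₅) + n + k) /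
      (Gamma (α₃ - k) * Gamma ((d : ℂ) - (α₃ + α₄) + n + k) *
        Gamma ((α₃ + α₄ + α₅) - (d : ℂ) / 2 - k) *
        Gamma (3 * (d : ℂ) / 2 - (α₁ + α₃ + α₄ + α₅) + n + k) *
        Gamma ((α₁ + α₂ + α₃ + α₄ + α₅) - (d : ℂ) - k) * Gamma ((d : ℂ) / 2 + n + k))))
    -- (iii) absolute convergence of the three double series :
    (hs₁ : Summable fun p : ℕ × ℕ => ‖M p.1 * T₁ p.1 p.2‖)
    (hs₂ : Summable fun p : ℕ × ℕ => ‖M p.1 * T₂ p.1 p.2‖)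
    (hs₃ : Summable fun p : ℕ × ℕ => ‖M p.1 * T₃ p.1 p.2‖)
    -- (iii) no Gamma factor is evaluated at a pole :
    (hnp : ∀ n k : ℕ, ∀ w ∈ [
        α₄ + (n : ℂ) + k, (d : ℂ) / 2 - α₅ + n + k, (α₁ + α₅) - (d : ℂ) / 2 - k,
        (d : ℂ) - (α₁ + α₂ + α₅) + n + k, (d : ℂ) / 2 - (α₃ + α₄) - k,
        (d : ℂ) / 2 - α₄ - k, α₅ - k, (d : ℂ) - (α₁ + α₅) + n + k,
        (α₁ + α₂ + α₅) - (d : ℂ) / 2 - k, (α₃ + α₄) + n + k, (d : ℂ) / 2 + n + k,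
        (α₁ + α₄ + α₅) - (d : ℂ) / 2 + n + k, (d : ℂ) / 2 - (α₁ + α₅) - k,
        α₁ + (n : ℂ) + k, (d : ℂ) / 2 - α₂ + n + k, (d : ℂ) - (α₁ + α₃ + α₄ + α₅) - k,
        (d : ℂ) - (α₁ + α₄ + α₅) - k, (α₁ + α₅) + n + k, (d : ℂ) / 2 - α₁ - k,
        α₂ - k, (α₁ + α₃ + α₄ + α₅) - (d : ℂ) / 2 + n + k,
        (d : ℂ) / 2 - α₃ + n + k, (α₃ + α₄) - (d : ℂ) / 2 - k,
        (d : ℂ) - (α₃ + α₄ + α₅) + n + k, (α₁ + α₃ + α₄ + α₅) - (d : ℂ) - k,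
        3 * (d : ℂ) / 2 - (α₁ + α₂ + α₃ + α₄ + α₅) + n + k, α₃ - k,
        (d : ℂ) - (α₃ + α₄) + n + k, (α₃ + α₄ + α₅) - (d : ℂ) / 2 - k,
        3 * (d : ℂ) / 2 - (α₁ + α₃ + α₄ + α₅) + n + k,
        (α₁ + α₂ + α₃ + α₄ + α₅) - (d : ℂ) - k], ∀ j : ℕ, w ≠ -(j : ℂ)) :
    ∫ p : EuclideanSpace ℝ (Fin d) × EuclideanSpace ℝ (Fin d),
        (‖p.1‖ : ℂ) ^ (-2 * α₁) * (‖p.2‖ : ℂ) ^ (-2 * α₂) * (‖z - p.2‖ : ℂ) ^ (-2 * α₃) *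
          (‖z - p.1‖ : ℂ) ^ (-2 * α₄) * (‖p.1 - p.2‖ : ℂ) ^ (-2 * α₅)
      = (Real.pi : ℂ) ^ d * (Gamma ((d : ℂ) / 2 - 1) / Gamma ((d : ℂ) - 2)) *
          ((Gamma ((d : ℂ) / 2 - α₁) / Gamma α₁) * (Gamma ((d : ℂ) / 2 - α₄) / Gamma α₄) /
            (Gamma ((d : ℂ) / 2 - ((α₁ + α₂ + α₃ + α₄ + α₅) - d)) /
              Gamma ((α₁ + α₂ + α₃ + α₄ + α₅) - d))) *
          ((∑' n : ℕ, M n * ∑' k : ℕ, T₁ n k) + (∑' n : ℕ, M n * ∑' k : ℕ, T₂ n k) +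
            (∑' n : ℕ, M n * ∑' k : ℕ, T₃ n k)) *
          (‖z‖ : ℂ) ^ (-2 * ((α₁ + α₂ + α₃ + α₄ + α₅) - (d : ℂ))) := by
  have hd0 : 0 < d := by omega
  have hd3 : (3 : ℝ) ≤ d := by exact_mod_cast hd
  have : Nontrivial (EuclideanSpace ℝ (Fin d)) := ⟨z, 0, hz⟩
  set D : ℝ := (d : ℝ) / 2 with hDdef
  have hDc : (D : ℂ) = (d : ℂ) / 2 := by rw [hDdef]; push_cast; rfl
  have hD1 : 1 < D := by rw [hDdef]; linarith
  have hDfin : 2 * D = Module.finrank ℝ (EuclideanSpace ℝ (Fin d)) := by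
    rw [finrank_euclideanSpace_fin, hDdef]; ring
  set α₆ : ℂ := 3 * (d : ℂ) / 2 - (α₁ + α₂ + α₃ + α₄ + α₅) with hα₆
  obtain ⟨hI, hEq⟩ := TwoLoop.two_loop_eq_tetra (α₆ := α₆) hz
    (by rw [finrank_euclideanSpace_fin, hα₆]; push_cast; ring) hint
  let e : Metric.sphere (0 : EuclideanSpace ℝ (Fin d)) 1 := ⟨(‖z‖)⁻¹ • z, by
    simp [norm_smul, inv_mul_cancel₀ (norm_ne_zero_iff.2 hz)]⟩
  have he0 : (‖z‖)⁻¹ • z ≠ 0 := smul_ne_zero (inv_ne_zero (norm_ne_zero_iff.2 hz)) hz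
  obtain ⟨hI2, hpol⟩ := TwoLoop.integral_tetra_polar volume e hI
  obtain ⟨r₁, r₄, r₆⟩ := TwoLoop.re_lt_of_integrable_tetra volume he0 hI
  rw [finrank_euclideanSpace_fin] at hI2 hpol hEq r₁ r₄ r₆
  set A : ℂ := d - 2 * α₂ - α₁ - α₆ with hA
  set B : ℂ := d - 2 * α₅ - α₁ - α₄ with hB
  have hα₆re : α₆.re = 3 * d / 2 - (α₁.re + α₂.re + α₃.re + α₄.re + α₅.re) := by
    rw [hα₆]; simp
  have hAre : A.re = d - 2 * α₂.re - α₁.re - α₆.re := by rw [hA]; simp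
  have hBre : B.re = d - 2 * α₅.re - α₁.re - α₄.re := by rw [hB]; simp
  simp only [add_re] at h₂ h₄ h₅ h₆
  have hDre : (D : ℂ).re = d / 2 := ofReal_re _
  have a₁ : TwoLoop.Admissible D α₁ := by
    refine ⟨by linarith, by rw [sub_re, hDre]; linarith, fun j h => ?_⟩
    exact hnp 0 j ((d : ℂ) / 2 - α₁ - j) (by simp only [List.mem_cons, true_or, or_true]) 0
      (by rw [← hDc, h]; simp)
  have a₄ : TwoLoop.Admissible D α₄ := by
    refine ⟨by linarith, by rw [sub_re, hDre]; linarith, fun j h => ?_⟩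
    exact hnp 0 j ((d : ℂ) / 2 - α₄ - j) (by simp only [List.mem_cons, true_or, or_true]) 0
      (by rw [← hDc, h]; simp)
  have a₆ : TwoLoop.Admissible D α₆ := by
    refine ⟨by linarith, by rw [sub_re, hDre]; linarith, fun j h => ?_⟩
    exact hnp 0 j ((α₁ + α₂ + α₃ + α₄ + α₅) - (d : ℂ) - j)
      (by simp only [List.mem_cons, true_or, or_true]) 0
      (by rw [hDc, hα₆] at h; rw [← h]; push_cast; ring)
  have z1 : ∀ m : ℤ, (α₄ - α₁ + B) / 2 ≠ m := by
    refine TwoLoop.ne_int_of_ne_nat (fun k h => ?_) (fun k h => ?_)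
    · exact hnp 0 k ((d : ℂ) / 2 - (α₁ + α₅) - k)
        (by simp only [List.mem_cons, true_or, or_true]) 0
        (by rw [hB] at h; linear_combination h)
    · exact hnp 0 k ((α₁ + α₅) - (d : ℂ) / 2 - k)
        (by simp only [List.mem_cons, true_or, or_true]) 0
        (by rw [hB] at h; linear_combination h)
  have z2 : ∀ m : ℤ, (α₆ - α₁ - A) / 2 ≠ m := by
    refine TwoLoop.ne_int_of_ne_nat (fun k h => ?_) (fun k h => ?_)
    · exact hnp 0 k ((d : ℂ) - (α₁ + α₃ + α₄ + α₅) - k)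
        (by simp only [List.mem_cons, true_or, or_true]) 0
        (by rw [hA, hα₆] at h; linear_combination h)
    · exact hnp 0 k ((α₁ + α₃ + α₄ + α₅) - (d : ℂ) - k)
        (by simp only [List.mem_cons, true_or, or_true]) 0
        (by rw [hA, hα₆] at h; linear_combination h)
  have z3 : ∀ m : ℤ, (α₆ - α₄ - (A + B)) / 2 ≠ m := by
    refine TwoLoop.ne_int_of_ne_nat (fun k h => ?_) (fun k h => ?_)
    · exact hnp 0 k ((d : ℂ) / 2 - (α₃ + α₄) - k)
        (by simp only [List.mem_cons, true_or, or_true]) 0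
        (by rw [hA, hB, hα₆] at h; linear_combination h)
    · exact hnp 0 k ((α₃ + α₄) - (d : ℂ) / 2 - k)
        (by simp only [List.mem_cons, true_or, or_true]) 0
        (by rw [hA, hB, hα₆] at h; linear_combination h)
  have hsum := TwoLoop.hasSum_integral_radial volume hD1 hDfin a₁ a₄ a₆ e hI2
  set J : ℂ := ∫ x : ℝ × ℝ, cexp (A * x.1 + B * x.2) * ∫ p, TwoLoop.angKer α₁ α₄ α₆ e x p
    ∂(TwoLoop.sphereProb volume).prod (TwoLoop.sphereProb volume) with hJ
  have hDpos : 0 < (D : ℂ).re := by rw [hDre]; linarith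
  set K : ℂ := Gamma D ^ 3 * ((Gamma (D - α₁) / Gamma α₁) * (Gamma (D - α₄) / Gamma α₄) *
    (Gamma (D - α₆) / Gamma α₆)) / 4 with hK
  have hterm := TwoLoop.radial_integral_eq_tsum hα₆ hA hB hDc hDpos a₁ a₄ a₆
    (by simp only [sub_re, hDre]; linarith) (by simp only [sub_re, add_re]; linarith)
    (by simp only [add_re]; linarith) (by simp only [sub_re, add_re]; linarith)
    (by simp only [add_re]; linarith) (by simp only [sub_re, add_re]; linarith)
    (by simp only [add_re]; linarith) z1 z2 z3 hT₁ hT₂ hT₃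
  have hsumT : ∀ T : ℕ → ℕ → ℂ, (Summable fun p : ℕ × ℕ => ‖M p.1 * T p.1 p.2‖) →
      HasSum (fun n => M n * ∑' k, T n k) (∑' n, M n * ∑' k, T n k) := by
    intro T hT
    have h := hT.of_norm.prod
    refine (h.congr fun n => ?_).hasSum
    exact (tsum_mul_left (f := fun k => T n k) (a := M n))
  have hJval : J = K / ((D - 1) * Gamma (2 * D - 2)) * ((∑' n, M n * ∑' k, T₁ n k) +
      (∑' n, M n * ∑' k, T₂ n k) + ∑' n, M n * ∑' k, T₃ n k) := by
    refine hsum.unique (((((hsumT T₁ hs₁).add (hsumT T₂ hs₂)).add (hsumT T₃ hs₃)).mul_left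
      (K / ((D - 1) * Gamma (2 * D - 2)))).congr_fun fun n => ?_)
    rw [hterm, TwoLoop.zdim_eq hD1, hM, show (n + 2 * D - 2 : ℂ) = n + d - 2 by rw [hDc]; ring,
      show (n + D - 1 : ℂ) = n + d / 2 - 1 by rw [hDc]]
    ring
  have hz0 : (‖z‖ : ℂ) ≠ 0 := ofReal_ne_zero.2 (norm_ne_zero_iff.2 hz)
  have hW : (‖z‖ : ℂ) ^ (-2 * α₆) ≠ 0 := by
    rw [Ne, cpow_eq_zero_iff]; exact fun h => hz0 h.1
  have hpow : (‖z‖ : ℂ) ^ (-2 * ((α₁ + α₂ + α₃ + α₄ + α₅) - (d : ℂ))) * (‖z‖ : ℂ) ^ (-2 * α₆) =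
      ((‖z‖ ^ d)⁻¹ : ℝ) := by
    rw [← cpow_add _ _ hz0, show -2 * ((α₁ + α₂ + α₃ + α₄ + α₅) - (d : ℂ)) + -2 * α₆ = -(d : ℂ) by
      rw [hα₆]; ring, cpow_neg, cpow_natCast]
    push_cast
    rfl
  refine mul_right_cancel₀ hW ?_
  rw [mul_assoc _ _ ((‖z‖ : ℂ) ^ (-2 * α₆)), hpow, hEq]
  have hpol' : ∫ p : EuclideanSpace ℝ (Fin d) × EuclideanSpace ℝ (Fin d),
      TwoLoop.tetra α₁ α₂ α₃ α₄ α₅ α₆ p.1 (‖z‖⁻¹ • z) p.2 =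
      ((volume : Measure (EuclideanSpace ℝ (Fin d))).toSphere.real Set.univ ^ 2 : ℝ) • J := hpol
  rw [hpol', TwoLoop.toSphere_real_univ d hd0, hJval]
  have hκ0 : (α₁ + α₂ + α₃ + α₄ + α₅) - (d : ℂ) = D - α₆ := by rw [hDc, hα₆]; ring
  have hπ : (((2 * √Real.pi ^ d / Real.Gamma (d / 2)) ^ 2 : ℝ) : ℂ) =
      4 * (Real.pi : ℂ) ^ d / Gamma D ^ 2 := by
    rw [div_pow, mul_pow, ← pow_mul, mul_comm d 2, pow_mul, Real.sq_sqrt Real.pi_pos.le,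
      Gamma_ofReal, hDdef]
    push_cast
    norm_num
  rw [hκ0, ← hDc, show (D : ℂ) - (D - α₆) = α₆ by ring,
    show (d : ℂ) - 2 = 2 * D - 2 by rw [hDc]; ring, real_smul, hπ, hK]
  exact TwoLoop.constant_eq hD1 _ _ _ _ _ _ _ _
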